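/- If G is a simple graph and the isotropic 3-matroid Z₃(G) is representable over some field F with char(F) ≠ 2, then G is a circle graph. -/

import Mathlib

open Matrix

noncomputable section

/-- The rank over `F` of the set of columns of `M` indexed by `S`. -/
def colSpanRank (F : Type*) [Field F] {m n : Type*} (M : Matrix m n F) (S : Set n) : ℕ :=
  Module.finrank F ↥(Submodule.span F ((fun j i => M i j) '' S))

/-- A subtransversal of `W(G) = V × {φ,χ,ψ}`: at most one element of each triple. -/
def Subtransversal3 {V : Type*} (S : Set (V × Fin 3)) : Prop :=
  ∀ v i j, (v, i) ∈ S → (v, j) ∈ S → i = j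

/-- The matrix `IAS(G) = (I | A | I + A)` over GF(2); the columns `(v,0)`, `(v,1)`,
`(v,2)` are `φ_G(v)`, `χ_G(v)`, `ψ_G(v)` respectively. -/
def IASmat {V : Type*} [DecidableEq V] (A : Matrix V V (ZMod 2)) :
    Matrix V (V × Fin 3) (ZMod 2) :=
  Matrix.of fun v p =>
    if p.2 = 0 then (if v = p.1 then 1 else 0)
    else if p.2 = 1 then A v p.1
    else (if v = p.1 then 1 else 0) + A v p.1

/-- The isotropic 3-matroid `Z₃(G)` is representable over `F`: some matrix over `F`
with columns indexed by `W(G)` has the same rank as `IAS(G)` on every subtransversal. -/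
def Z3Rep (F : Type*) [Field F] {V : Type*} [Fintype V] [DecidableEq V]
    (A : Matrix V V (ZMod 2)) : Prop :=
  ∃ (k : ℕ) (P : Matrix (Fin k) (V × Fin 3) F),
    ∀ S : Set (V × Fin 3), Subtransversal3 S →
      colSpanRank F P S = colSpanRank (ZMod 2) (IASmat A) S

/-- `w` is a double occurrence word on `V`: each element of `V` occurs exactly twice. -/
def IsDOW {V : Type*} [DecidableEq V] (w : List V) : Prop := ∀ v : V, w.count v = 2

/-- Distinct `u` and `v` are interlaced in `w`: their occurrences appear in the order
`u v u v` or `v u v u`. -/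
def Interlaced {V : Type*} (w : List V) (u v : V) : Prop :=
  [u, v, u, v].Sublist w ∨ [v, u, v, u].Sublist w

/-- `G` (a simple graph given by its adjacency matrix over GF(2)) is a circle graph:
it is the interlacement graph of some double occurrence word on its vertex set. -/
def IsCircleGraph {V : Type*} [Fintype V] [DecidableEq V] (A : Matrix V V (ZMod 2)) : Prop :=
  ∃ w : List V, IsDOW w ∧ ∀ u v : V, A u v = 1 ↔ (u ≠ v ∧ Interlaced w u v)


set_option linter.unusedSectionVars false

section Euler

variable {V : Type*} [Fintype V] [DecidableEq V]

/-- The sum of `f` over the parallelograms `p u + ⟨φ u, χ u⟩`, `u ∈ S`. -/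
def planeSum {V L : Type*} [AddCommGroup L] (S : Finset V) (φ χ p : V → L)
    (f : L → ZMod 2) : ZMod 2 :=
  ∑ u ∈ S, (f (p u) + f (p u + φ u) + f (p u + χ u) + f (p u + φ u + χ u))

/-- Translates of the planes `⟨e_u, N(u)⟩` can be chosen to cover every point of
`GF(2)^V` an even number of times. -/
def HasEvenCover (A : Matrix V V (ZMod 2)) : Prop :=
  ∃ p : V → V → ZMod 2, ∀ f : (V → ZMod 2) → ZMod 2,
    planeSum Finset.univ (fun u => Pi.single u 1) (fun u => A u) p f = 0

/-- The first end of the edge `e`; the second end is `edgeEnd A p e + Pi.single e.1 1`. -/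
def edgeEnd (A : Matrix V V (ZMod 2)) (p : V → V → ZMod 2) (e : V × Bool) : V → ZMod 2 :=
  p e.1 + if e.2 then A e.1 else 0

/-- The sum of the labels of a list of edges. -/
def labelSum (l : List (V × Bool)) : V → ZMod 2 :=
  (l.map fun e => (Pi.single e.1 1 : V → ZMod 2)).sum

/-- `z` is an end of `e`. -/
def IsEnd (A : Matrix V V (ZMod 2)) (p : V → V → ZMod 2) (z : V → ZMod 2) (e : V × Bool) : Prop :=
  z = edgeEnd A p e ∨ z = edgeEnd A p e + Pi.single e.1 1

/-- The degree mod 2 of the point `y` in the edge set `R`. -/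
def parityDeg (A : Matrix V V (ZMod 2)) (p : V → V → ZMod 2) (R : Finset (V × Bool))
    (y : V → ZMod 2) : ZMod 2 :=
  ∑ e ∈ R, ((if edgeEnd A p e = y then 1 else 0) +
    if edgeEnd A p e + Pi.single e.1 1 = y then 1 else 0)

lemma add_self_zmod_two_pi (x : V → ZMod 2) : x + x = 0 := by
  ext i; exact CharTwo.add_self_eq_zero _

lemma labelSum_nil : labelSum ([] : List (V × Bool)) = 0 := rfl

lemma labelSum_cons (e : V × Bool) (l : List (V × Bool)) :
    labelSum (e :: l) = Pi.single e.1 1 + labelSum l := by simp [labelSum]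

lemma labelSum_append (l l' : List (V × Bool)) :
    labelSum (l ++ l') = labelSum l + labelSum l' := by simp [labelSum]

lemma labelSum_apply (l : List (V × Bool)) (w : V) :
    labelSum l w = ((l.map Prod.fst).count w : ZMod 2) := by
  induction l with
  | nil => simp [labelSum]
  | cons e l ih =>
    rw [labelSum_cons, Pi.add_apply, ih, List.map_cons, List.count_cons, Pi.single_apply]
    by_cases h : w = e.1
    · simp [h, add_comm]
    · simp [h, Ne.symm h]

lemma exists_trail (A : Matrix V V (ZMod 2)) (p : V → V → ZMod 2) :
    ∀ (n : ℕ) (R : Finset (V × Bool)) (z z₀ : V → ZMod 2), R.card = n → z ≠ z₀ →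
      (∀ y, parityDeg A p R y = (if z = y then 1 else 0) + (if z₀ = y then 1 else 0)) →
      ∃ l : List (V × Bool), l.Nodup ∧ (∀ e ∈ l, e ∈ R) ∧ z + labelSum l = z₀ ∧
        ∀ l₁ e l₂, l = l₁ ++ e :: l₂ → IsEnd A p (z + labelSum l₁) e := by
  intro n
  induction n with
  | zero =>
    intro R z z₀ hR hz hdeg
    have := hdeg z
    rw [Finset.card_eq_zero] at hR
    simp [hR, parityDeg, hz.symm] at this
  | succ n ih =>
    intro R z z₀ hR hz hdeg
    obtain ⟨e, heR, he⟩ : ∃ e ∈ R, IsEnd A p z e := by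
      by_contra! h
      have h0 : parityDeg A p R z = 0 := by
        apply Finset.sum_eq_zero
        intro e he
        have := h e he
        rw [IsEnd, not_or] at this
        rw [if_neg (Ne.symm this.1), if_neg (Ne.symm this.2), add_zero]
      rw [hdeg z] at h0
      simp [hz.symm] at h0
    have hdeg' : ∀ y, parityDeg A p (R.erase e) y =
        (if z + Pi.single e.1 1 = y then 1 else 0) + (if z₀ = y then 1 else 0) := by
      intro y
      have h1 := hdeg y
      rw [parityDeg, ← Finset.add_sum_erase R _ heR] at h1
      change _ + parityDeg A p (R.erase e) y = _ at h1
      have h2 : ((if edgeEnd A p e = y then (1 : ZMod 2) else 0) +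
          if edgeEnd A p e + Pi.single e.1 1 = y then 1 else 0) =
          (if z = y then 1 else 0) + (if z + Pi.single e.1 1 = y then 1 else 0) := by
        rcases he with he | he
        · rw [he]
        · rw [he, add_assoc, add_self_zmod_two_pi, add_zero, add_comm]
      rw [h2] at h1
      clear h2
      generalize parityDeg A p (R.erase e) y = a at *
      generalize (if z = y then (1 : ZMod 2) else 0) = b at *
      generalize (if z₀ = y then (1 : ZMod 2) else 0) = c at *
      generalize (if z + Pi.single e.1 1 = y then (1 : ZMod 2) else 0) = d at *
      revert a b c d; decide
    by_cases hz' : z + Pi.single e.1 1 = z₀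
    · refine ⟨[e], by simp, by simpa using heR, by simpa [labelSum] using hz', ?_⟩
      intro l₁ e' l₂ hl
      rcases l₁ with _ | ⟨a, l₁⟩
      · simp only [List.nil_append, List.cons.injEq] at hl
        simpa [labelSum, ← hl.1] using he
      · simp at hl
    · obtain ⟨l, hl1, hl2, hl3, hl4⟩ := ih (R.erase e) (z + Pi.single e.1 1) z₀
        (by rw [Finset.card_erase_of_mem heR, hR]; rfl) hz' hdeg'
      refine ⟨e :: l, ?_, ?_, ?_, ?_⟩
      · rw [List.nodup_cons]
        exact ⟨fun h => by simpa using hl2 e h, hl1⟩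
      · intro e' he'
        rcases List.mem_cons.1 he' with rfl | h
        · exact heR
        · exact Finset.mem_of_mem_erase (hl2 e' h)
      · rw [labelSum_cons, ← add_assoc, hl3]
      · intro l₁ e' l₂ hl
        rcases l₁ with _ | ⟨a, l₁⟩
        · simp only [List.nil_append, List.cons.injEq] at hl
          simpa [labelSum, ← hl.1] using he
        · simp only [List.cons_append, List.cons.injEq] at hl
          have := hl4 l₁ e' l₂ hl.2
          rwa [labelSum_cons, ← hl.1, ← add_assoc]

lemma exists_closed_trail (A : Matrix V V (ZMod 2)) (p : V → V → ZMod 2)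
    (R : Finset (V × Bool)) (hR : R.Nonempty) (hdeg : ∀ y, parityDeg A p R y = 0) :
    ∃ (z : V → ZMod 2) (l : List (V × Bool)), l ≠ [] ∧ l.Nodup ∧ (∀ e ∈ l, e ∈ R) ∧
      labelSum l = 0 ∧ ∀ l₁ e l₂, l = l₁ ++ e :: l₂ → IsEnd A p (z + labelSum l₁) e := by
  obtain ⟨e, he⟩ := hR
  set z₀ := edgeEnd A p e with hz₀
  set z := z₀ + Pi.single e.1 1 with hz
  have hne : z ≠ z₀ := by
    intro h
    rw [hz, add_eq_left] at h
    have := congrFun h e.1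
    simp at this
  obtain ⟨l, hl1, hl2, hl3, hl4⟩ := exists_trail A p _ (R.erase e) z z₀ rfl hne (by
    intro y
    have h1 := hdeg y
    rw [parityDeg, ← Finset.add_sum_erase R _ he] at h1
    change _ + parityDeg A p (R.erase e) y = _ at h1
    rw [← hz₀, ← hz] at h1
    generalize parityDeg A p (R.erase e) y = a at *
    generalize (if z = y then (1 : ZMod 2) else 0) = b at *
    generalize (if z₀ = y then (1 : ZMod 2) else 0) = c at *
    revert a b c; decide)
  refine ⟨z₀, e :: l, by simp, ?_, ?_, ?_, ?_⟩
  · rw [List.nodup_cons]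
    exact ⟨fun h => by simpa using hl2 e h, hl1⟩
  · intro e' he'
    rcases List.mem_cons.1 he' with rfl | h
    · exact he
    · exact Finset.mem_of_mem_erase (hl2 e' h)
  · rw [labelSum_cons]
    rw [hz, add_assoc] at hl3
    exact add_eq_left.1 hl3
  · intro l₁ e' l₂ hl
    rcases l₁ with _ | ⟨a, l₁⟩
    · simp only [List.nil_append, List.cons.injEq] at hl
      rw [← hl.1, labelSum_nil, add_zero]
      exact Or.inl rfl
    · simp only [List.cons_append, List.cons.injEq] at hl
      have := hl4 l₁ e' l₂ hl.2
      rwa [labelSum_cons, ← hl.1, ← add_assoc]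

lemma count_fst_eq (l : List (V × Bool)) (hl : l.Nodup) (u : V) :
    (l.map Prod.fst).count u =
      (if (u, true) ∈ l then 1 else 0) + (if (u, false) ∈ l then 1 else 0) := by
  induction l with
  | nil => simp
  | cons e l ih =>
    obtain ⟨v, b⟩ := e
    rw [List.nodup_cons] at hl
    rw [List.map_cons, List.count_cons, ih hl.2]
    by_cases h : v = u
    · subst h
      cases b
      · simp [hl.1]
      · simp [hl.1, add_comm]
    · simp [h, Ne.symm h]

lemma exists_trail_decomposition (A : Matrix V V (ZMod 2)) (p : V → V → ZMod 2) :
    ∀ (n : ℕ) (U : Finset V), U.card = n →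
      (∀ y, parityDeg A p (U ×ˢ Finset.univ) y = 0) →
      ∃ (W : List (V × Bool)) (s : V → V → ZMod 2), W.Nodup ∧ (∀ e, e ∈ W ↔ e.1 ∈ U) ∧
        ∀ l₁ e l₂, W = l₁ ++ e :: l₂ → IsEnd A p (s e.1 + labelSum l₁) e := by
  intro n
  induction n using Nat.strong_induction_on with
  | _ n ih =>
  intro U hU hdeg
  rcases U.eq_empty_or_nonempty with rfl | ⟨u₀, hu₀⟩
  · exact ⟨[], 0, by simp, by simp, by simp⟩
  obtain ⟨z, T, hT0, hT1, hT2, hT3, hT4⟩ := exists_closed_trail A p (U ×ˢ Finset.univ)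
    ⟨(u₀, true), by simpa using hu₀⟩ hdeg
  have hboth : ∀ u, (u, true) ∈ T ↔ (u, false) ∈ T := by
    intro u
    have h1 := labelSum_apply T u
    rw [hT3, count_fst_eq T hT1] at h1
    by_cases ha : (u, true) ∈ T <;> by_cases hb : (u, false) ∈ T <;> simp [ha, hb] at h1 ⊢
  have hmemT : ∀ e : V × Bool, e ∈ T ↔ e.1 ∈ T.map Prod.fst := by
    rintro ⟨u, b⟩
    constructor
    · intro h; exact List.mem_map_of_mem h
    · intro h
      obtain ⟨⟨v, b'⟩, h1, rfl⟩ := List.mem_map.1 h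
      cases b <;> cases b' <;> simp_all
  set U' := U.filter (fun u => u ∉ T.map Prod.fst) with hU'
  have hsub : T.toFinset ⊆ U ×ˢ Finset.univ := fun e he => hT2 e (List.mem_toFinset.1 he)
  have hsd : U' ×ˢ (Finset.univ : Finset Bool) = (U ×ˢ Finset.univ) \ T.toFinset := by
    ext e
    simp only [Finset.mem_product, Finset.mem_univ, and_true, Finset.mem_sdiff, List.mem_toFinset,
      hU', Finset.mem_filter, hmemT e]
  have hTdeg : ∀ y, parityDeg A p T.toFinset y = 0 := by
    intro y
    have key : ∀ (l : List (V × Bool)) (z : V → ZMod 2),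
        (∀ l₁ e l₂, l = l₁ ++ e :: l₂ → IsEnd A p (z + labelSum l₁) e) →
        (l.map fun e => ((if edgeEnd A p e = y then (1 : ZMod 2) else 0) +
          if edgeEnd A p e + Pi.single e.1 1 = y then 1 else 0)).sum =
          (if z = y then 1 else 0) + if z + labelSum l = y then 1 else 0 := by
      intro l
      induction l with
      | nil => intro z _; simp [labelSum, CharTwo.add_self_eq_zero]
      | cons e l ihl =>
        intro z h
        have he := h [] e l rfl
        rw [labelSum_nil, add_zero] at he
        have h' := ihl (z + Pi.single e.1 1) (by
          intro l₁ e' l₂ hl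
          have := h (e :: l₁) e' l₂ (by rw [hl]; rfl)
          rwa [labelSum_cons, ← add_assoc] at this)
        rw [List.map_cons, List.sum_cons, h', labelSum_cons, ← add_assoc z]
        have h2 : ((if edgeEnd A p e = y then (1 : ZMod 2) else 0) +
            if edgeEnd A p e + Pi.single e.1 1 = y then 1 else 0) =
            (if z = y then 1 else 0) + (if z + Pi.single e.1 1 = y then 1 else 0) := by
          rcases he with he | he
          · rw [he]
          · rw [he, add_assoc, add_self_zmod_two_pi, add_zero, add_comm]
        rw [h2]
        generalize (if z = y then (1 : ZMod 2) else 0) = b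
        generalize (if z + Pi.single e.1 1 = y then (1 : ZMod 2) else 0) = c
        generalize (if z + Pi.single e.1 1 + labelSum l = y then (1 : ZMod 2) else 0) = d
        revert b c d; decide
    have := key T z hT4
    rw [hT3, add_zero, CharTwo.add_self_eq_zero] at this
    rw [parityDeg, List.sum_toFinset _ hT1, this]
  obtain ⟨W, s, hW1, hW2, hW3⟩ := ih U'.card (by
      rw [← hU]
      apply Finset.card_lt_card
      refine ⟨Finset.filter_subset _ _, fun h => ?_⟩
      obtain ⟨e, l, rfl⟩ := List.exists_cons_of_ne_nil hT0
      have h1 : e.1 ∈ U := by simpa using hT2 e (by simp)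
      have h2 := h h1
      simp [hU'] at h2) U' rfl (by
      intro y
      have h1 := hdeg y
      rw [parityDeg, ← Finset.sum_sdiff hsub] at h1
      change parityDeg A p _ y + parityDeg A p _ y = 0 at h1
      rwa [hTdeg, add_zero, ← hsd] at h1)
  refine ⟨T ++ W, fun u => if u ∈ T.map Prod.fst then z else s u, ?_, ?_, ?_⟩
  · rw [List.nodup_append']
    refine ⟨hT1, hW1, ?_⟩
    intro e he heW
    rw [hW2, hU', Finset.mem_filter] at heW
    exact heW.2 ((hmemT e).1 he)
  · intro e
    rw [List.mem_append, hW2, hU', Finset.mem_filter, hmemT e]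
    constructor
    · rintro (h | h)
      · have := hT2 e ((hmemT e).2 h)
        simpa using this
      · exact h.1
    · intro h
      by_cases h' : e.1 ∈ T.map Prod.fst
      · exact Or.inl h'
      · exact Or.inr ⟨h, h'⟩
  · intro l₁ e l₂ hl
    rw [List.append_eq_append_iff] at hl
    rcases hl with ⟨a, h1, h2⟩ | ⟨a, h1, h2⟩
    · have heW : e ∈ W := by rw [h2]; simp
      rw [hW2, hU', Finset.mem_filter] at heW
      simp only [if_neg heW.2]
      rw [h1, labelSum_append, hT3, zero_add]
      exact hW3 _ _ _ h2
    · rcases a with _ | ⟨e', a⟩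
      · simp only [List.nil_append] at h2
        simp only [List.append_nil] at h1
        have heW : e ∈ W := by rw [← h2]; simp
        rw [hW2, hU', Finset.mem_filter] at heW
        simp only [if_neg heW.2]
        have := hW3 [] e l₂ h2.symm
        rwa [← h1, hT3, ← labelSum_nil]
      · simp only [List.cons_append, List.cons.injEq] at h2
        obtain ⟨rfl, h2⟩ := h2
        have heT : e ∈ T := by rw [h1]; simp
        simp only [if_pos ((hmemT e).1 heT)]
        exact hT4 _ _ _ h1

theorem isCircleGraph_of_hasEvenCover (A : Matrix V V (ZMod 2)) (hsym : A.IsSymm)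
    (hdiag : ∀ v, A v v = 0) (h : HasEvenCover A) : IsCircleGraph A := by
  obtain ⟨p, hp⟩ := h
  obtain ⟨W, s, hW1, hW2, hW3⟩ := exists_trail_decomposition A p _ Finset.univ rfl (by
    intro y
    rw [← hp fun z => if z = y then 1 else 0, parityDeg, Finset.sum_product, planeSum]
    apply Finset.sum_congr rfl
    intro u _
    rw [Fintype.sum_bool]
    simp only [edgeEnd, if_true, Bool.false_eq_true, if_false, add_zero]
    rw [add_right_comm (p u) (A u)]
    abel)
  have hW2' : ∀ e, e ∈ W := fun e => (hW2 e).2 (Finset.mem_univ _)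
  have hcount : ∀ v, (W.map Prod.fst).count v = 2 := by
    intro v
    rw [count_fst_eq W hW1, if_pos (hW2' _), if_pos (hW2' _)]
  have hbetween : ∀ (u w : V) l₁ l₂ l₃, W.map Prod.fst = l₁ ++ u :: (l₂ ++ u :: l₃) → w ≠ u →
      A u w = (l₂.count w : ZMod 2) := by
    intro u w l₁ l₂ l₃ hl hw
    obtain ⟨L₁, M, hWM, hL₁, hM⟩ := List.map_eq_append_iff.1 hl
    obtain ⟨e, M', rfl, he, hM'⟩ := List.map_eq_cons_iff.1 hM
    obtain ⟨L₂, M'', rfl, hL₂, hM''⟩ := List.map_eq_append_iff.1 hM'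
    obtain ⟨e', L₃, rfl, he', hL₃⟩ := List.map_eq_cons_iff.1 hM''
    have h1 := hW3 L₁ e _ hWM
    have h2 := hW3 (L₁ ++ e :: L₂) e' L₃ (by rw [hWM]; simp)
    rw [labelSum_append, labelSum_cons] at h2
    have hne : e ≠ e' := by
      rintro rfl
      rw [hWM] at hW1
      have := (List.nodup_append.1 hW1).2.1
      simp at this
    have hne2 : e.2 ≠ e'.2 := by
      intro h3; exact hne (Prod.ext (he.trans he'.symm) h3)
    have hc : labelSum L₂ w = (l₂.count w : ZMod 2) := by rw [labelSum_apply, hL₂]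
    rw [← hc]
    have k1 : (s u + labelSum L₁) w = edgeEnd A p e w := by
      rw [he] at h1
      rcases h1 with h1 | h1
      · rw [h1]
      · rw [h1, Pi.add_apply, he, Pi.single_eq_of_ne hw, add_zero]
    have k2 : (s u + (labelSum L₁ + ((Pi.single u 1 : V → ZMod 2) + labelSum L₂))) w = edgeEnd A p e' w := by
      rw [he', he] at h2
      rcases h2 with h2 | h2
      · rw [h2]
      · rw [h2, Pi.add_apply, he', Pi.single_eq_of_ne hw, add_zero]
    have k3 : edgeEnd A p e w + edgeEnd A p e' w = A u w := by
      rcases e with ⟨_, b⟩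
      rcases e' with ⟨_, b'⟩
      simp only at he he' hne2
      subst he
      subst he'
      rename_i u
      have hpp := CharTwo.add_self_eq_zero (p u w)
      cases b <;> cases b' <;> simp_all [edgeEnd]
      · rw [← add_assoc, hpp, zero_add]
      · rw [add_right_comm, hpp, zero_add]
    simp only [Pi.add_apply, Pi.single_eq_of_ne hw] at k1 k2
    rw [← k3, ← k1, ← k2]
    generalize s u w = a
    generalize labelSum L₁ w = b
    generalize labelSum L₂ w = c
    revert a b c; decide
  have hdir : ∀ u v, u ≠ v → [u, v, u, v].Sublist (W.map Prod.fst) → A u v = 1 := by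
    intro u v huv hs
    obtain ⟨r₁, r₂, hr, hu, hs⟩ := List.cons_sublist_iff.1 hs
    obtain ⟨r₃, r₄, rfl, hv, hs'⟩ := List.cons_sublist_iff.1 hs
    obtain ⟨r₅, r₆, rfl, hu', hs''⟩ := List.cons_sublist_iff.1 hs'
    rw [List.singleton_sublist] at hs''
    obtain ⟨a, b, rfl⟩ := List.append_of_mem hu
    obtain ⟨c, d, rfl⟩ := List.append_of_mem hu'
    have h1 := hbetween u v a (b ++ r₃ ++ c) (d ++ r₆) (by rw [hr]; simp) huv.symm
    have h2 := hcount v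
    rw [hr] at h2
    have h3 := List.count_pos_iff.2 hv
    have h4 := List.count_pos_iff.2 hs''
    simp only [List.count_append, List.count_cons, beq_iff_eq, if_neg huv] at h1 h2
    have : List.count v b + List.count v r₃ + List.count v c = 1 := by omega
    rw [h1, this]; rfl
  refine ⟨W.map Prod.fst, hcount, fun u v => ⟨fun h => ?_, ?_⟩⟩
  · have huv : u ≠ v := by
      rintro rfl
      rw [hdiag] at h
      exact zero_ne_one h
    refine ⟨huv, ?_⟩
    have hu : u ∈ W.map Prod.fst := List.count_pos_iff.1 (by rw [hcount]; omega)
    obtain ⟨l₁, M, hM⟩ := List.append_of_mem hu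
    have hcu := hcount u
    have hcv := hcount v
    rw [hM] at hcu hcv
    have hboth : ∃ l₁ l₂ l₃, W.map Prod.fst = l₁ ++ u :: (l₂ ++ u :: l₃) := by
      by_cases huM : u ∈ M
      · obtain ⟨l₂, l₃, rfl⟩ := List.append_of_mem huM
        exact ⟨_, _, _, hM⟩
      · have hul : u ∈ l₁ := by
          by_contra hul
          rw [List.count_append, List.count_cons_self, List.count_eq_zero.2 hul,
            List.count_eq_zero.2 huM] at hcu
          omega
        obtain ⟨a, b, rfl⟩ := List.append_of_mem hul
        exact ⟨a, b, M, by rw [hM]; simp⟩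
    clear hM hcu hcv M l₁
    obtain ⟨l₁, l₂, l₃, hl⟩ := hboth
    have h1 := hbetween u v _ _ _ hl huv.symm
    have hcv := hcount v
    rw [hl] at hcv ⊢
    simp only [List.count_append, List.count_cons, beq_iff_eq, if_neg huv] at hcv
    have h2 : l₂.count v = 1 := by
      have : l₂.count v ≤ 2 := by omega
      rw [h] at h1
      interval_cases hh : l₂.count v
      · exact absurd h1 (by decide)
      · rfl
      · exact absurd h1 (by decide)
    have hv2 : v ∈ l₂ := List.count_pos_iff.1 (by omega)
    have h3 : 0 < l₁.count v ∨ 0 < l₃.count v := by omega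
    rcases h3 with h3 | h3
    · right
      have e1 : [v].Sublist l₁ := List.singleton_sublist.2 (List.count_pos_iff.1 h3)
      have e2 : [v].Sublist l₂ := List.singleton_sublist.2 hv2
      exact e1.append ((e2.append ((List.nil_sublist l₃).cons_cons u)).cons_cons u)
    · left
      have e1 : [v].Sublist l₃ := List.singleton_sublist.2 (List.count_pos_iff.1 h3)
      have e2 : [v].Sublist l₂ := List.singleton_sublist.2 hv2
      exact (List.nil_sublist l₁).append ((e2.append (e1.cons_cons u)).cons_cons u)
  · rintro ⟨huv, h | h⟩
    · exact hdir u v huv h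
    · rw [← hsym.apply]
      exact hdir v u huv.symm h

end Euler

section Configuration

variable {V : Type*} [DecidableEq V] {L : Type*} [AddCommGroup L] [Module (ZMod 2) L]

/-- The subspace spanned by `φ v` and `χ v`. -/
def plane (φ χ : V → L) (v : V) : Submodule (ZMod 2) L := Submodule.span (ZMod 2) {φ v, χ v}

/-- The subspace spanned by the planes indexed by `X`. -/
def planes (φ χ : V → L) (X : Finset V) : Submodule (ZMod 2) L := X.sup (plane φ χ)

/-- The connectivity function. -/
def conn (φ χ : V → L) (X : Finset V) : ℤ :=
  (Module.finrank (ZMod 2) (planes φ χ X) : ℤ) - X.card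

/-- An isotropic configuration of subspaces `⟨φ v, χ v⟩`, `v ∈ S`, spanning `L`. -/
structure IsConfig (S : Finset V) (φ χ : V → L) : Prop where
  finrank_eq : Module.finrank (ZMod 2) L = S.card
  span_eq : planes φ χ S = ⊤
  isotropic : ∀ ξ : Module.Dual (ZMod 2) L, ∑ v ∈ S, (ξ (φ v) • χ v + ξ (χ v) • φ v) = 0

/-- A configuration is prime if it has no nontrivial separation of connectivity at most one. -/
def IsPrimeConfig (S : Finset V) (φ χ : V → L) : Prop :=
  ∀ X ⊆ S, 2 ≤ X.card → 2 ≤ (S \ X).card → 2 ≤ conn φ χ X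

variable {S : Finset V} {φ χ : V → L}

lemma zmod_two_cases (a : ZMod 2) : a = 0 ∨ a = 1 := by revert a; decide

lemma add_self_zmod_two (x : L) : x + x = 0 := by
  rw [← two_smul (ZMod 2), show (2 : ZMod 2) = 0 from rfl, zero_smul]

lemma neg_eq_self_zmod_two (x : L) : -x = x := by
  rw [neg_eq_iff_add_eq_zero, add_self_zmod_two]

lemma sub_eq_add_zmod_two (x y : L) : x - y = x + y := by
  rw [sub_eq_add_neg, neg_eq_self_zmod_two]

lemma left_mem_plane (v : V) : φ v ∈ plane φ χ v := Submodule.subset_span (by simp)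

lemma right_mem_plane (v : V) : χ v ∈ plane φ χ v := Submodule.subset_span (by simp)

lemma mem_plane_iff {v : V} {x : L} :
    x ∈ plane φ χ v ↔ x = 0 ∨ x = φ v ∨ x = χ v ∨ x = φ v + χ v := by
  rw [plane, Submodule.mem_span_pair]
  constructor
  · rintro ⟨a, b, rfl⟩
    rcases zmod_two_cases a with rfl | rfl <;> rcases zmod_two_cases b with rfl | rfl <;> simp
  · rintro (rfl | rfl | rfl | rfl)
    · exact ⟨0, 0, by simp⟩
    · exact ⟨1, 0, by simp⟩
    · exact ⟨0, 1, by simp⟩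
    · exact ⟨1, 1, by simp⟩

lemma plane_le_planes {X : Finset V} {v : V} (hv : v ∈ X) : plane φ χ v ≤ planes φ χ X :=
  Finset.le_sup hv

lemma planes_mono {X Y : Finset V} (h : X ⊆ Y) : planes φ χ X ≤ planes φ χ Y :=
  Finset.sup_mono h

lemma planes_insert (v : V) (X : Finset V) :
    planes φ χ (insert v X) = plane φ χ v ⊔ planes φ χ X := Finset.sup_insert

lemma planes_union (X Y : Finset V) :
    planes φ χ (X ∪ Y) = planes φ χ X ⊔ planes φ χ Y := Finset.sup_union

lemma planes_empty : planes φ χ (∅ : Finset V) = ⊥ := Finset.sup_empty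

lemma planes_singleton (v : V) : planes φ χ {v} = plane φ χ v := Finset.sup_singleton

lemma plane_map {M : Type*} [AddCommGroup M] [Module (ZMod 2) M] (g : L →ₗ[ZMod 2] M) (v : V) :
    plane (g ∘ φ) (g ∘ χ) v = (plane φ χ v).map g := by
  simp [plane, Submodule.map_span, Set.image_pair]

lemma planes_map {M : Type*} [AddCommGroup M] [Module (ZMod 2) M] (g : L →ₗ[ZMod 2] M)
    (X : Finset V) : planes (g ∘ φ) (g ∘ χ) X = (planes φ χ X).map g := by
  induction X using Finset.induction_on with
  | empty => simp [planes_empty]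
  | insert a X ha ih => rw [planes_insert, planes_insert, ih, plane_map, Submodule.map_sup]

lemma dual_eq_zero_of_planes {X : Finset V} {ξ : Module.Dual (ZMod 2) L}
    (h : ∀ v ∈ X, ξ (φ v) = 0 ∧ ξ (χ v) = 0) : ∀ x ∈ planes φ χ X, ξ x = 0 := by
  have : planes φ χ X ≤ LinearMap.ker ξ := by
    apply Finset.sup_le
    intro v hv
    rw [plane, Submodule.span_le]
    rintro x (rfl | rfl)
    · exact (h v hv).1
    · exact (h v hv).2
  exact fun x hx => this hx

/-- The map sending coefficients to the corresponding combination of the vectors over `X`. -/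
def combo (φ χ : V → L) (X : Finset V) : ((X → ZMod 2) × (X → ZMod 2)) →ₗ[ZMod 2] L where
  toFun c := ∑ v : X, (c.1 v • φ v + c.2 v • χ v)
  map_add' c d := by
    rw [← Finset.sum_add_distrib]
    refine Finset.sum_congr rfl fun v _ => ?_
    simp only [Prod.fst_add, Prod.snd_add, Pi.add_apply, add_smul]
    abel
  map_smul' a c := by
    rw [RingHom.id_apply, Finset.smul_sum]
    refine Finset.sum_congr rfl fun v _ => ?_
    simp [smul_add, mul_smul]

lemma range_combo (X : Finset V) : LinearMap.range (combo φ χ X) = planes φ χ X := by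
  apply le_antisymm
  · rintro _ ⟨c, rfl⟩
    exact Submodule.sum_mem _ fun v _ => plane_le_planes v.2
      (Submodule.add_mem _ (Submodule.smul_mem _ _ (left_mem_plane _))
        (Submodule.smul_mem _ _ (right_mem_plane _)))
  · apply Finset.sup_le
    intro v hv
    rw [plane, Submodule.span_le]
    rintro x (rfl | rfl)
    · refine ⟨(Pi.single ⟨v, hv⟩ 1, 0), ?_⟩
      simp only [combo, LinearMap.coe_mk, AddHom.coe_mk, Pi.zero_apply, zero_smul, add_zero]
      rw [Finset.sum_eq_single ⟨v, hv⟩]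
      · simp
      · intro b _ hb; simp [Pi.single_eq_of_ne hb]
      · simp
    · refine ⟨(0, Pi.single ⟨v, hv⟩ 1), ?_⟩
      simp only [combo, LinearMap.coe_mk, AddHom.coe_mk, Pi.zero_apply, zero_smul, zero_add]
      rw [Finset.sum_eq_single ⟨v, hv⟩]
      · simp
      · intro b _ hb; simp [Pi.single_eq_of_ne hb]
      · simp

variable [FiniteDimensional (ZMod 2) L]

lemma finrank_plane_le (v : V) : Module.finrank (ZMod 2) (plane φ χ v) ≤ 2 := by
  classical
  have h := finrank_span_finset_le_card (R := ZMod 2) ({φ v, χ v} : Finset L)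
  rw [Finset.coe_insert, Finset.coe_singleton] at h
  exact h.trans Finset.card_le_two

lemma conn_union_add_conn_inter_le (X Y : Finset V) :
    conn φ χ (X ∪ Y) + conn φ χ (X ∩ Y) ≤ conn φ χ X + conn φ χ Y := by
  have h1 := Submodule.finrank_sup_add_finrank_inf_eq (planes φ χ X) (planes φ χ Y)
  have h2 : Module.finrank (ZMod 2) (planes φ χ (X ∩ Y)) ≤
      Module.finrank (ZMod 2) ↥(planes φ χ X ⊓ planes φ χ Y) :=
    Submodule.finrank_mono (le_inf (planes_mono Finset.inter_subset_left)
      (planes_mono Finset.inter_subset_right))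
  rw [← planes_union] at h1
  have h3 := Finset.card_union_add_card_inter X Y
  unfold conn
  omega

lemma conn_insert {X : Finset V} {v : V} (hv : v ∉ X) :
    conn φ χ (insert v X) = conn φ χ X - 1 + Module.finrank (ZMod 2) (plane φ χ v) -
      Module.finrank (ZMod 2) ↥(plane φ χ v ⊓ planes φ χ X) := by
  have h1 := Submodule.finrank_sup_add_finrank_inf_eq (plane φ χ v) (planes φ χ X)
  rw [← planes_insert] at h1
  have h3 := Finset.card_insert_of_notMem hv
  unfold conn
  omega

lemma conn_singleton (v : V) :
    conn φ χ {v} = Module.finrank (ZMod 2) (plane φ χ v) - 1 := by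
  rw [conn, planes_singleton, Finset.card_singleton, Nat.cast_one]

namespace IsConfig

lemma conn_le_conn_compl (hc : IsConfig S φ χ) {X : Finset V} (hX : X ⊆ S) :
    conn φ χ X ≤ conn φ χ (S \ X) := by
  set N := (planes φ χ (S \ X)).dualAnnihilator with hN
  let T : Module.Dual (ZMod 2) L →ₗ[ZMod 2] ((X → ZMod 2) × (X → ZMod 2)) :=
    { toFun := fun ξ => (fun v => ξ (χ v), fun v => ξ (φ v))
      map_add' := fun ξ η => rfl
      map_smul' := fun a ξ => rfl }
  have hT : ∀ ξ ∈ N, T ξ ∈ LinearMap.ker (combo φ χ X) := by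
    intro ξ hξ
    rw [LinearMap.mem_ker]
    rw [hN, Submodule.mem_dualAnnihilator] at hξ
    have h1 := hc.isotropic ξ
    rw [← Finset.sum_sdiff hX, Finset.sum_eq_zero, zero_add] at h1
    · rw [← h1, ← Finset.sum_coe_sort X]
      simp only [combo, LinearMap.coe_mk, AddHom.coe_mk, T]
      exact Finset.sum_congr rfl fun v _ => add_comm _ _
    · intro v hv
      rw [hξ _ (plane_le_planes hv (left_mem_plane v)),
        hξ _ (plane_le_planes hv (right_mem_plane v))]
      simp
  have hinj : Function.Injective (T.restrict hT) := by
    rw [injective_iff_map_eq_zero]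
    rintro ⟨ξ, hξ⟩ h
    have h' : T ξ = 0 := congrArg Subtype.val h
    rw [hN, Submodule.mem_dualAnnihilator] at hξ
    rw [Submodule.mk_eq_zero]
    ext x
    have hx : x ∈ planes φ χ S := by rw [hc.span_eq]; trivial
    refine dual_eq_zero_of_planes (fun v hv => ?_) x hx
    by_cases hvX : v ∈ X
    · exact ⟨congrFun (congrArg Prod.snd h') ⟨v, hvX⟩, congrFun (congrArg Prod.fst h') ⟨v, hvX⟩⟩
    · have hv' : v ∈ S \ X := Finset.mem_sdiff.2 ⟨hv, hvX⟩
      exact ⟨hξ _ (plane_le_planes hv' (left_mem_plane v)),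
        hξ _ (plane_le_planes hv' (right_mem_plane v))⟩
  have h1 := LinearMap.finrank_le_finrank_of_injective hinj
  have h2 := LinearMap.finrank_range_add_finrank_ker (combo φ χ X)
  rw [range_combo, Module.finrank_prod, Module.finrank_fintype_fun_eq_card,
    Fintype.card_coe] at h2
  have h3 := Subspace.finrank_add_finrank_dualAnnihilator_eq (planes φ χ (S \ X))
  rw [hc.finrank_eq, ← hN] at h3
  have h4 := Finset.card_sdiff_add_card_eq_card hX
  unfold conn
  omega

lemma conn_compl (hc : IsConfig S φ χ) {X : Finset V} (hX : X ⊆ S) :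
    conn φ χ (S \ X) = conn φ χ X := by
  apply le_antisymm
  · have := hc.conn_le_conn_compl (X := S \ X) Finset.sdiff_subset
    rwa [Finset.sdiff_sdiff_eq_self hX] at this
  · exact hc.conn_le_conn_compl hX

lemma finrank_planes_erase (hc : IsConfig S φ χ) {v : V} (hv : v ∈ S) :
    (Module.finrank (ZMod 2) (planes φ χ (S.erase v)) : ℤ) + 2 =
      S.card + Module.finrank (ZMod 2) (plane φ χ v) := by
  have h := hc.conn_compl (X := {v}) (by simpa using hv)
  rw [conn_singleton, Finset.sdiff_singleton_eq_erase, conn, Finset.card_erase_of_mem hv] at h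
  have := Finset.card_pos.2 ⟨v, hv⟩
  omega

end IsConfig

/-- The quotient map by a vector. -/
abbrev modVec (t : L) : L →ₗ[ZMod 2] (L ⧸ Submodule.span (ZMod 2) {t}) := Submodule.mkQ _

lemma modVec_self (t : L) : modVec t t = 0 := by
  rw [Submodule.mkQ_apply, Submodule.Quotient.mk_eq_zero]
  exact Submodule.mem_span_singleton_self t

lemma modVec_eq_zero_iff {t x : L} : modVec t x = 0 ↔ x = 0 ∨ x = t := by
  rw [Submodule.mkQ_apply, Submodule.Quotient.mk_eq_zero, Submodule.mem_span_singleton]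
  constructor
  · rintro ⟨a, rfl⟩
    rcases zmod_two_cases a with rfl | rfl <;> simp
  · rintro (rfl | rfl)
    · exact ⟨0, by simp⟩
    · exact ⟨1, by simp⟩

lemma finrank_map_modVec {t : L} (ht : t ≠ 0) (P : Submodule (ZMod 2) L) [Decidable (t ∈ P)] :
    Module.finrank (ZMod 2) (P.map (modVec t)) + (if t ∈ P then 1 else 0) =
      Module.finrank (ZMod 2) P := by
  have h := LinearMap.finrank_range_add_finrank_ker ((modVec t).domRestrict P)
  rw [LinearMap.range_domRestrict] at h
  rw [← h]
  congr 1
  split_ifs with htP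
  · have : LinearMap.ker ((modVec t).domRestrict P) =
        Submodule.span (ZMod 2) {(⟨t, htP⟩ : P)} := by
      ext ⟨x, hx⟩
      rw [LinearMap.mem_ker, LinearMap.domRestrict_apply, modVec_eq_zero_iff,
        Submodule.mem_span_singleton]
      constructor
      · rintro (rfl | rfl)
        · exact ⟨0, by ext; simp⟩
        · exact ⟨1, by ext; simp⟩
      · rintro ⟨a, ha⟩
        rcases zmod_two_cases a with rfl | rfl
        · left; simpa using (congrArg Subtype.val ha).symm
        · right; simpa using (congrArg Subtype.val ha).symm
    rw [this, finrank_span_singleton]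
    intro h0
    exact ht (congrArg Subtype.val h0)
  · symm
    rw [Submodule.finrank_eq_zero, LinearMap.ker_eq_bot']
    rintro ⟨x, hx⟩ h0
    rcases modVec_eq_zero_iff.1 h0 with rfl | rfl
    · rfl
    · exact absurd hx htP

lemma conn_modVec {t : L} (ht : t ≠ 0) (X : Finset V) [Decidable (t ∈ planes φ χ X)] :
    conn (modVec t ∘ φ) (modVec t ∘ χ) X =
      conn φ χ X - (if t ∈ planes φ χ X then 1 else 0) := by
  have := finrank_map_modVec ht (planes φ χ X)
  rw [← planes_map] at this
  unfold conn
  split_ifs at * <;> omega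

lemma IsConfig.minor (hc : IsConfig S φ χ) {v : V} (hv : v ∈ S) {t : L} (ht : t ≠ 0)
    (htv : t ∈ plane φ χ v) : IsConfig (S.erase v) (modVec t ∘ φ) (modVec t ∘ χ) where
  finrank_eq := by
    have h := Submodule.finrank_quotient_add_finrank (Submodule.span (ZMod 2) {t})
    rw [finrank_span_singleton ht, hc.finrank_eq] at h
    rw [Finset.card_erase_of_mem hv]
    omega
  span_eq := by
    rw [planes_map]
    have h : planes φ χ (S.erase v) ⊔ Submodule.span (ZMod 2) {t} = ⊤ := by
      have h1 := hc.finrank_planes_erase hv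
      have h2 := finrank_plane_le (φ := φ) (χ := χ) v
      have h3 : 1 ≤ Module.finrank (ZMod 2) (plane φ χ v) := by
        have := Submodule.finrank_mono (Submodule.span_le.2 (Set.singleton_subset_iff.2 htv))
        rwa [finrank_span_singleton ht] at this
      rcases (by omega : Module.finrank (ZMod 2) (plane φ χ v) = 1 ∨
        Module.finrank (ZMod 2) (plane φ χ v) = 2) with h4 | h4
      · have h5 : Submodule.span (ZMod 2) {t} = plane φ χ v := by
          apply Submodule.eq_of_le_of_finrank_eq
            (Submodule.span_le.2 (Set.singleton_subset_iff.2 htv))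
          rw [finrank_span_singleton ht, h4]
        rw [h5, sup_comm, ← planes_insert, Finset.insert_erase hv, hc.span_eq]
      · have h5 : planes φ χ (S.erase v) = ⊤ := by
          apply Submodule.eq_top_of_finrank_eq
          rw [hc.finrank_eq]
          omega
        rw [h5, top_sup_eq]
    have h' := congrArg (Submodule.map (modVec t)) h
    rw [Submodule.map_sup, Submodule.map_span, Set.image_singleton, modVec_self,
      Submodule.span_zero_singleton, sup_bot_eq] at h'
    rw [h', Submodule.map_top, Submodule.range_mkQ]
  isotropic := by
    intro ξ
    have h := hc.isotropic (ξ ∘ₗ modVec t)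
    rw [← Finset.add_sum_erase S _ hv] at h
    have h' := congrArg (modVec t) h
    rw [map_add, map_sum, map_zero] at h'
    have hz : modVec t ((ξ ∘ₗ modVec t) (φ v) • χ v + (ξ ∘ₗ modVec t) (χ v) • φ v) = 0 := by
      have hξ : ξ (modVec t t) = 0 := by rw [modVec_self, map_zero]
      have ht' := modVec_self t
      rcases mem_plane_iff.1 htv with h0 | h0 | h0 | h0
      · exact absurd h0 ht
      · have h1 : modVec t (φ v) = 0 := by rw [← h0, ht']
        simp [h1]
      · have h1 : modVec t (χ v) = 0 := by rw [← h0, ht']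
        simp [h1]
      · have h1 : modVec t (φ v) + modVec t (χ v) = 0 := by rw [← map_add, ← h0, ht']
        have h2 : modVec t (φ v) = modVec t (χ v) := by
          rw [← sub_eq_zero, sub_eq_add_zmod_two, h1]
        simp only [map_add, map_smul, LinearMap.comp_apply]
        rw [h2, add_self_zmod_two]
    rw [hz, zero_add] at h'
    simpa using h'

end Configuration

section Prime

variable {V : Type*} [DecidableEq V] {L : Type*} [AddCommGroup L] [Module (ZMod 2) L]
  [FiniteDimensional (ZMod 2) L] {S : Finset V} {φ χ : V → L}

lemma planes_pair (a b : V) : planes φ χ {a, b} = plane φ χ a ⊔ plane φ χ b := by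
  rw [planes_insert, planes_singleton]

lemma conn_pair_le {a b : V} (hab : a ≠ b) : conn φ χ {a, b} ≤ 2 := by
  have h1 := Submodule.finrank_add_le_finrank_add_finrank (plane φ χ a) (plane φ χ b)
  have h2 := finrank_plane_le (φ := φ) (χ := χ) a
  have h3 := finrank_plane_le (φ := φ) (χ := χ) b
  rw [conn, planes_pair, Finset.card_pair hab]
  omega

lemma plane_le_of_mem {v : V} {s s' : L} (hs : s ∈ plane φ χ v) (hs' : s' ∈ plane φ χ v)
    (h0 : s ≠ 0) (h0' : s' ≠ 0) (hne : s ≠ s') {P : Submodule (ZMod 2) L} (hP : s ∈ P)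
    (hP' : s' ∈ P) : plane φ χ v ≤ P := by
  have h : φ v ∈ P ∧ χ v ∈ P := by
    have hsum := P.add_mem hP hP'
    rcases mem_plane_iff.1 hs with h | h | h | h <;> rcases mem_plane_iff.1 hs' with h' | h' | h' | h'
    all_goals first | exact absurd h h0 | exact absurd h' h0' | exact absurd (h.trans h'.symm) hne | skip
    all_goals rw [h] at hP hsum; rw [h'] at hP' hsum
    · exact ⟨hP, hP'⟩
    · rw [← add_assoc, add_self_zmod_two, zero_add] at hsum; exact ⟨hP, hsum⟩
    · exact ⟨hP', hP⟩
    · rw [add_comm (φ v), ← add_assoc, add_self_zmod_two, zero_add] at hsum; exact ⟨hsum, hP⟩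
    · rw [add_right_comm, add_self_zmod_two, zero_add] at hsum; exact ⟨hP', hsum⟩
    · rw [add_assoc, add_self_zmod_two, add_zero] at hsum; exact ⟨hsum, hP'⟩
  rw [plane, Submodule.span_le]
  rintro x (rfl | rfl)
  · exact h.1
  · exact h.2

lemma conn_insert_le_of_mem {X : Finset V} {v : V} (hv : v ∉ X) {t : L} (ht : t ≠ 0)
    (htv : t ∈ plane φ χ v) (htX : t ∈ planes φ χ X) : conn φ χ (insert v X) ≤ conn φ χ X := by
  rw [conn_insert hv]
  have h1 := finrank_plane_le (φ := φ) (χ := χ) v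
  have h2 : 1 ≤ Module.finrank (ZMod 2) ↥(plane φ χ v ⊓ planes φ χ X) := by
    have := Submodule.finrank_mono (Submodule.span_le.2 (Set.singleton_subset_iff.2
      (Submodule.mem_inf.2 ⟨htv, htX⟩)))
    rwa [finrank_span_singleton ht] at this
  omega

lemma conn_insert_of_le {X : Finset V} {v : V} (hv : v ∉ X)
    (hle : plane φ χ v ≤ planes φ χ X) : conn φ χ (insert v X) = conn φ χ X - 1 := by
  rw [conn_insert hv, inf_eq_left.2 hle]
  omega

lemma finrank_span_singleton_le_one (x : L) :
    Module.finrank (ZMod 2) (Submodule.span (ZMod 2) {x}) ≤ 1 := by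
  by_cases h : x = 0
  · rw [h, Submodule.span_zero_singleton, finrank_bot]; omega
  · rw [finrank_span_singleton h]

namespace IsPrimeConfig

lemma two_le_conn_pair (hp : IsPrimeConfig S φ χ) (h4 : 4 ≤ S.card) {a b : V} (ha : a ∈ S)
    (hb : b ∈ S) (hab : a ≠ b) : 2 ≤ conn φ χ {a, b} := by
  have hsub : ({a, b} : Finset V) ⊆ S := by
    intro x hx; simp at hx; rcases hx with rfl | rfl <;> assumption
  apply hp _ hsub
  · rw [Finset.card_pair hab]
  · rw [Finset.card_sdiff_of_subset hsub, Finset.card_pair hab]; omega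

lemma finrank_plane (hp : IsPrimeConfig S φ χ) (h4 : 4 ≤ S.card) {v : V} (hv : v ∈ S) :
    Module.finrank (ZMod 2) (plane φ χ v) = 2 := by
  obtain ⟨a, ha, hav⟩ := Finset.exists_mem_ne (by omega : 1 < S.card) v
  have h := hp.two_le_conn_pair h4 hv ha hav.symm
  have h1 := Submodule.finrank_add_le_finrank_add_finrank (plane φ χ v) (plane φ χ a)
  have h2 := finrank_plane_le (φ := φ) (χ := χ) v
  have h3 := finrank_plane_le (φ := φ) (χ := χ) a
  rw [conn, planes_pair, Finset.card_pair hav.symm] at h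
  omega

lemma disjoint_plane (hp : IsPrimeConfig S φ χ) (h4 : 4 ≤ S.card) {a b : V} (ha : a ∈ S)
    (hb : b ∈ S) (hab : a ≠ b) {x : L} (hxa : x ∈ plane φ χ a) (hxb : x ∈ plane φ χ b) :
    x = 0 := by
  by_contra hx
  have h := hp.two_le_conn_pair h4 ha hb hab
  have h1 := conn_insert_le_of_mem (φ := φ) (χ := χ) (X := {b}) (v := a) (by simpa using hab) hx hxa
    (by rwa [planes_singleton])
  rw [conn_singleton, hp.finrank_plane h4 hb] at h1
  omega

lemma left_ne_zero (hp : IsPrimeConfig S φ χ) (h4 : 4 ≤ S.card) {v : V} (hv : v ∈ S) :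
    φ v ≠ 0 := by
  intro h
  have h1 := hp.finrank_plane h4 hv
  rw [plane, h, Submodule.span_insert_zero] at h1
  have := finrank_span_singleton_le_one (χ v)
  omega

lemma right_ne_zero (hp : IsPrimeConfig S φ χ) (h4 : 4 ≤ S.card) {v : V} (hv : v ∈ S) :
    χ v ≠ 0 := by
  intro h
  have h1 := hp.finrank_plane h4 hv
  rw [plane, h, Set.pair_comm, Submodule.span_insert_zero] at h1
  have := finrank_span_singleton_le_one (φ v)
  omega

lemma left_ne_right (hp : IsPrimeConfig S φ χ) (h4 : 4 ≤ S.card) {v : V} (hv : v ∈ S) :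
    φ v ≠ χ v := by
  intro h
  have h1 := hp.finrank_plane h4 hv
  rw [plane, h, Set.pair_eq_singleton] at h1
  have := finrank_span_singleton_le_one (χ v)
  omega

end IsPrimeConfig

/-- The vectors `t`, `s`, `r` of the planes at `v`, `a`, `b` form a triangle. -/
structure Tri (S : Finset V) (φ χ : V → L) (v a b : V) (t s r : L) : Prop where
  v_mem : v ∈ S
  a_mem : a ∈ S
  b_mem : b ∈ S
  va : v ≠ a
  vb : v ≠ b
  ab : a ≠ b
  t_mem : t ∈ plane φ χ v
  s_mem : s ∈ plane φ χ a
  r_mem : r ∈ plane φ χ b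
  t_ne : t ≠ 0
  s_ne : s ≠ 0
  r_ne : r ≠ 0
  sum_eq : t + s + r = 0

namespace Tri

variable {v a b : V} {t s r : L}

lemma rot (h : Tri S φ χ v a b t s r) : Tri S φ χ a b v s r t :=
  ⟨h.a_mem, h.b_mem, h.v_mem, h.ab, h.va.symm, h.vb.symm, h.s_mem, h.r_mem, h.t_mem,
    h.s_ne, h.r_ne, h.t_ne, by rw [← h.sum_eq]; abel⟩

lemma swap (h : Tri S φ χ v a b t s r) : Tri S φ χ v b a t r s :=
  ⟨h.v_mem, h.b_mem, h.a_mem, h.vb, h.va, h.ab.symm, h.t_mem, h.r_mem, h.s_mem,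
    h.t_ne, h.r_ne, h.s_ne, by rw [← h.sum_eq]; abel⟩

lemma eq_add (h : Tri S φ χ v a b t s r) : t = s + r := by
  have := h.sum_eq
  rw [add_assoc] at this
  rw [eq_neg_of_add_eq_zero_left this, neg_eq_self_zmod_two]

lemma mem_of (h : Tri S φ χ v a b t s r) {P : Submodule (ZMod 2) L} (hs : s ∈ P) (hr : r ∈ P) :
    t ∈ P := by
  rw [h.eq_add]; exact P.add_mem hs hr

lemma mem_planes (h : Tri S φ χ v a b t s r) {X : Finset V} (ha : a ∈ X) (hb : b ∈ X) :
    t ∈ planes φ χ X :=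
  h.mem_of (plane_le_planes ha h.s_mem) (plane_le_planes hb h.r_mem)

end Tri


/-- A separation showing that contracting `t` at `v` destroys primeness. -/
structure MinorSep (S : Finset V) (φ χ : V → L) (v : V) (t : L) (X Y : Finset V) : Prop where
  sdiff_eq : S.erase v \ X = Y
  subset : X ⊆ S.erase v
  card_left : 2 ≤ X.card
  card_right : 2 ≤ Y.card
  conn_left : conn φ χ X = 2
  conn_right : conn φ χ Y = 2
  mem_left : t ∈ planes φ χ X
  mem_right : t ∈ planes φ χ Y

namespace MinorSep

variable {v : V} {t : L} {X Y : Finset V}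

lemma symm (h : MinorSep S φ χ v t X Y) : MinorSep S φ χ v t Y X where
  sdiff_eq := by rw [← h.sdiff_eq, Finset.sdiff_sdiff_eq_self h.subset]
  subset := by rw [← h.sdiff_eq]; exact Finset.sdiff_subset
  card_left := h.card_right
  card_right := h.card_left
  conn_left := h.conn_right
  conn_right := h.conn_left
  mem_left := h.mem_right
  mem_right := h.mem_left

lemma mem_iff (h : MinorSep S φ χ v t X Y) {x : V} (hx : x ∈ S) (hxv : x ≠ v) : x ∈ Y ↔ x ∉ X := by
  rw [← h.sdiff_eq, Finset.mem_sdiff, Finset.mem_erase]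
  tauto

lemma notMem (h : MinorSep S φ χ v t X Y) : v ∉ X := fun hv => by simpa using h.subset hv

lemma subset_S (h : MinorSep S φ χ v t X Y) : X ⊆ S := h.subset.trans (Finset.erase_subset _ _)

lemma compl_insert_eq (h : MinorSep S φ χ v t X Y) : S \ insert v X = Y := by
  ext x
  rw [← h.sdiff_eq, Finset.mem_sdiff, Finset.mem_sdiff, Finset.mem_erase, Finset.mem_insert]
  tauto

lemma card_eq (h : MinorSep S φ χ v t X Y) (hv : v ∈ S) : X.card + Y.card + 1 = S.card := by
  have h1 := Finset.card_sdiff_add_card_eq_card h.subset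
  rw [h.sdiff_eq, Finset.card_erase_of_mem hv] at h1
  have := Finset.card_pos.2 ⟨v, hv⟩
  omega

lemma eq_of_mem (h : MinorSep S φ χ v t X Y) (hp : IsPrimeConfig S φ χ) (hv : v ∈ S)
    (htv : t ∈ plane φ χ v) (ht : t ≠ 0) {t' : L} (htv' : t' ∈ plane φ χ v) (ht' : t' ≠ 0)
    (hX : t' ∈ planes φ χ X) : t' = t := by
  by_contra hne
  have hle := plane_le_of_mem htv htv' ht ht' (Ne.symm hne) h.mem_left hX
  have h1 := conn_insert_of_le h.notMem hle
  have h2 := hp (insert v X) (Finset.insert_subset hv h.subset_S)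
    (by rw [Finset.card_insert_of_notMem h.notMem]; have := h.card_left; omega)
    (by rw [h.compl_insert_eq]; exact h.card_right)
  have := h.conn_left
  omega

end MinorSep

lemma exists_sep (hc : IsConfig S φ χ) (hp : IsPrimeConfig S φ χ) {v : V} (hv : v ∈ S)
    {t : L} (htv : t ∈ plane φ χ v) (ht : t ≠ 0)
    (hn : ¬ IsPrimeConfig (S.erase v) (modVec t ∘ φ) (modVec t ∘ χ)) :
    ∃ X Y, MinorSep S φ χ v t X Y := by
  classical
  rw [IsPrimeConfig] at hn
  push Not at hn
  obtain ⟨X, hX, h1, h2, h3⟩ := hn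
  have key : ∀ Z ⊆ S.erase v, 2 ≤ Z.card → 2 ≤ (S.erase v \ Z).card →
      conn (modVec t ∘ φ) (modVec t ∘ χ) Z < 2 → conn φ χ Z = 2 ∧ t ∈ planes φ χ Z := by
    intro Z hZ h1 h2 h3
    have h4 : 2 ≤ conn φ χ Z := by
      refine hp Z (hZ.trans (Finset.erase_subset _ _)) h1 (h2.trans ?_)
      exact Finset.card_le_card (Finset.sdiff_subset_sdiff (Finset.erase_subset _ _) le_rfl)
    rw [conn_modVec ht] at h3
    split_ifs at h3 with h5
    · exact ⟨by omega, h5⟩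
    · omega
  have k1 := key X hX h1 h2 h3
  have hm := hc.minor hv ht htv
  have k2 := key (S.erase v \ X) Finset.sdiff_subset h2
    (by rwa [Finset.sdiff_sdiff_eq_self hX]) (by rwa [hm.conn_compl hX])
  exact ⟨X, _, rfl, hX, h1, h2, k1.1, k2.1, k1.2, k2.2⟩

lemma card_inter_le_one_of_sep (hc : IsConfig S φ χ) (hp : IsPrimeConfig S φ χ) {v : V}
    (hv : v ∈ S) {t t' : L} (htv : t ∈ plane φ χ v) (ht : t ≠ 0) (htv' : t' ∈ plane φ χ v)
    (ht' : t' ≠ 0) (hne : t ≠ t') {X Y X' Y' : Finset V} (h : MinorSep S φ χ v t X Y)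
    (h' : MinorSep S φ χ v t' X' Y') : (X ∩ X').card ≤ 1 ∨ (Y ∩ Y').card ≤ 1 := by
  by_contra! hcon
  have hle := plane_le_of_mem htv htv' ht ht' hne
    (planes_mono (Finset.subset_union_left (s₂ := X')) h.mem_left)
    (planes_mono (Finset.subset_union_right (s₁ := X)) h'.mem_left)
  have hvn : v ∉ X ∪ X' := by
    rw [Finset.mem_union]; exact not_or.2 ⟨h.notMem, h'.notMem⟩
  have h1 := conn_insert_of_le hvn hle
  have h2 := conn_union_add_conn_inter_le (φ := φ) (χ := χ) X X'
  have h3 : S \ insert v (X ∪ X') = Y ∩ Y' := by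
    rw [← h.compl_insert_eq, ← h'.compl_insert_eq]
    ext x; simp only [Finset.mem_sdiff, Finset.mem_insert, Finset.mem_union, Finset.mem_inter]
    tauto
  have h4 := hc.conn_compl (X := insert v (X ∪ X'))
    (Finset.insert_subset hv (Finset.union_subset h.subset_S h'.subset_S))
  rw [h3] at h4
  have h5 := hp (X ∩ X') (Finset.inter_subset_left.trans h.subset_S) (by omega) (by
    refine h.card_right.trans (Finset.card_le_card ?_)
    intro x hx
    rw [← h.sdiff_eq, Finset.mem_sdiff, Finset.mem_erase] at hx
    simp only [Finset.mem_sdiff, Finset.mem_inter]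
    tauto)
  have h6 := hp (Y ∩ Y') (Finset.inter_subset_left.trans h.symm.subset_S) (by omega) (by
    refine h.card_left.trans (Finset.card_le_card ?_)
    intro x hx
    rw [← h.symm.sdiff_eq, Finset.mem_sdiff, Finset.mem_erase] at hx
    simp only [Finset.mem_sdiff, Finset.mem_inter]
    tauto)
  have := h.conn_left
  have := h'.conn_left
  omega

lemma MinorSep.exists_tri {v : V} {t : L} {X Y : Finset V} (h : MinorSep S φ χ v t X Y)
    (hp : IsPrimeConfig S φ χ) (h4 : 4 ≤ S.card) (hv : v ∈ S) (htv : t ∈ plane φ χ v)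
    (ht : t ≠ 0) (h2 : X.card ≤ 2) : ∃ a b s r, Tri S φ χ v a b t s r := by
  obtain ⟨a, b, hab, rfl⟩ := Finset.card_eq_two.1 (le_antisymm h2 h.card_left)
  have hm := h.mem_left
  rw [planes_pair, Submodule.mem_sup] at hm
  obtain ⟨s, hs, r, hr, hsr⟩ := hm
  have haS : a ∈ S.erase v := h.subset (by simp)
  have hbS : b ∈ S.erase v := h.subset (by simp)
  rw [Finset.mem_erase] at haS hbS
  refine ⟨a, b, s, r, hv, haS.2, hbS.2, haS.1.symm, hbS.1.symm, hab, htv, hs, hr, ht, ?_, ?_, ?_⟩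
  · rintro rfl
    rw [zero_add] at hsr
    exact ht (hp.disjoint_plane h4 hv hbS.2 hbS.1.symm htv (hsr ▸ hr))
  · rintro rfl
    rw [add_zero] at hsr
    exact ht (hp.disjoint_plane h4 hv haS.2 haS.1.symm htv (hsr ▸ hs))
  · rw [add_assoc, hsr, add_self_zmod_two]

/-- No contraction of a single vector yields a prime configuration. -/
def NoPrimeMinor (S : Finset V) (φ χ : V → L) : Prop :=
  ∀ v ∈ S, ∀ t ∈ plane φ χ v, t ≠ 0 →
    ¬ IsPrimeConfig (S.erase v) (modVec t ∘ φ) (modVec t ∘ χ)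

lemma exists_tri_of_ne (hc : IsConfig S φ χ) (hp : IsPrimeConfig S φ χ) (h4 : 4 ≤ S.card)
    (hn : NoPrimeMinor S φ χ) {v : V} (hv : v ∈ S) (t₀ : L) :
    ∃ t a b s r, t ≠ t₀ ∧ Tri S φ χ v a b t s r := by
  have key : ∀ t ∈ plane φ χ v, ∀ t' ∈ plane φ χ v, t ≠ 0 → t' ≠ 0 → t ≠ t' → t ≠ t₀ → t' ≠ t₀ →
      ∃ t a b s r, t ≠ t₀ ∧ Tri S φ χ v a b t s r := by
    intro t htv t' htv' ht ht' hne h0 h0'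
    obtain ⟨X, Y, h⟩ := exists_sep hc hp hv htv ht (hn v hv t htv ht)
    obtain ⟨X', Y', h'⟩ := exists_sep hc hp hv htv' ht' (hn v hv t' htv' ht')
    have h1 := card_inter_le_one_of_sep hc hp hv htv ht htv' ht' hne h h'
    have h2 := card_inter_le_one_of_sep hc hp hv htv ht htv' ht' hne h h'.symm
    have split : ∀ {t t' : L} {X Y X' Y' : Finset V}, MinorSep S φ χ v t X Y → MinorSep S φ χ v t' X' Y' →
        X.card ≤ (X ∩ X').card + (X ∩ Y').card := by
      intro t t' X Y X' Y' h h'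
      refine le_trans (Finset.card_le_card ?_) (Finset.card_union_le _ _)
      intro x hx
      have hx' := h.subset hx
      rw [Finset.mem_erase] at hx'
      have := h'.mem_iff hx'.2 hx'.1
      simp only [Finset.mem_union, Finset.mem_inter]
      tauto
    have s1 := split h h'
    have s2 := split h.symm h'
    have s3 := split h' h
    have s4 := split h'.symm h
    rw [Finset.inter_comm X' X, Finset.inter_comm X' Y] at s3
    rw [Finset.inter_comm Y' X, Finset.inter_comm Y' Y] at s4
    have : X.card ≤ 2 ∨ Y.card ≤ 2 ∨ X'.card ≤ 2 ∨ Y'.card ≤ 2 := by omega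
    rcases this with h3 | h3 | h3 | h3
    · obtain ⟨a, b, s, r, hT⟩ := h.exists_tri hp h4 hv htv ht h3
      exact ⟨t, a, b, s, r, h0, hT⟩
    · obtain ⟨a, b, s, r, hT⟩ := h.symm.exists_tri hp h4 hv htv ht h3
      exact ⟨t, a, b, s, r, h0, hT⟩
    · obtain ⟨a, b, s, r, hT⟩ := h'.exists_tri hp h4 hv htv' ht' h3
      exact ⟨t', a, b, s, r, h0', hT⟩
    · obtain ⟨a, b, s, r, hT⟩ := h'.symm.exists_tri hp h4 hv htv' ht' h3
      exact ⟨t', a, b, s, r, h0', hT⟩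
  have a1 := hp.left_ne_zero h4 hv
  have a2 := hp.right_ne_zero h4 hv
  have a3 := hp.left_ne_right h4 hv
  have a4 : φ v + χ v ≠ 0 := by
    intro h
    exact a3 (by rw [eq_neg_of_add_eq_zero_left h, neg_eq_self_zmod_two])
  have m1 := left_mem_plane (φ := φ) (χ := χ) v
  have m2 := right_mem_plane (φ := φ) (χ := χ) v
  have m3 := Submodule.add_mem _ m1 m2
  by_cases h1 : φ v = t₀
  · refine key _ m2 _ m3 a2 a4 ?_ ?_ ?_
    · intro h; exact a1 (right_eq_add.1 h)
    · rw [← h1]; exact a3.symm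
    · rw [← h1]; intro h; exact a2 (add_eq_left.1 h)
  · by_cases h2 : χ v = t₀
    · refine key _ m1 _ m3 a1 a4 ?_ ?_ ?_
      · intro h; exact a2 (left_eq_add.1 h)
      · exact h1
      · rw [← h2]; intro h; exact a1 (add_eq_right.1 h)
    · exact key _ m1 _ m2 a1 a2 a3 h1 h2

end Prime

section Chain

variable {V : Type*} [DecidableEq V] {L : Type*} [AddCommGroup L] [Module (ZMod 2) L]
  [FiniteDimensional (ZMod 2) L] {S : Finset V} {φ χ : V → L}

lemma Tri.minorSep {v a b : V} {t s r : L} (T : Tri S φ χ v a b t s r) (hc : IsConfig S φ χ)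
    (hp : IsPrimeConfig S φ χ) (h6 : 6 ≤ S.card) :
    MinorSep S φ χ v t {a, b} (S.erase v \ {a, b}) := by
  classical
  have hva := T.va
  have hvb := T.vb
  have hab := T.ab
  have hv : v ∉ ({a, b} : Finset V) := by simp [hva, hvb]
  have hsub : ({a, b} : Finset V) ⊆ S.erase v := by
    intro x hx
    simp only [Finset.mem_insert, Finset.mem_singleton] at hx
    rcases hx with rfl | rfl
    · exact Finset.mem_erase.2 ⟨hva.symm, T.a_mem⟩
    · exact Finset.mem_erase.2 ⟨hvb.symm, T.b_mem⟩
  have hsubS : insert v ({a, b} : Finset V) ⊆ S :=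
    Finset.insert_subset T.v_mem (hsub.trans (Finset.erase_subset _ _))
  have hcard : (S.erase v \ {a, b}).card + 3 = S.card := by
    rw [Finset.card_sdiff_of_subset hsub, Finset.card_pair hab, Finset.card_erase_of_mem T.v_mem]
    omega
  have hcompl : S \ insert v {a, b} = S.erase v \ {a, b} := by
    ext x
    simp only [Finset.mem_sdiff, Finset.mem_insert, Finset.mem_singleton, Finset.mem_erase]
    tauto
  have htX : t ∈ planes φ χ {a, b} := T.mem_planes (by simp) (by simp)
  have h1 : conn φ χ {a, b} = 2 :=
    le_antisymm (conn_pair_le hab) (hp.two_le_conn_pair (by omega) T.a_mem T.b_mem hab)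
  have h2 : conn φ χ (insert v {a, b}) = 2 := by
    apply le_antisymm
    · rw [← h1]; exact conn_insert_le_of_mem hv T.t_ne T.t_mem htX
    · apply hp _ hsubS
      · rw [Finset.card_insert_of_notMem hv, Finset.card_pair hab]; omega
      · rw [hcompl]; omega
  have h3 : conn φ χ (S.erase v \ {a, b}) = 2 := by rw [← hcompl, hc.conn_compl hsubS, h2]
  refine ⟨rfl, hsub, by rw [Finset.card_pair hab], by omega, h1, h3, htX, ?_⟩
  have hm := (hc.minor T.v_mem T.t_ne T.t_mem).conn_compl hsub
  rw [conn_modVec T.t_ne, conn_modVec T.t_ne, if_pos htX, h1, h3] at hm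
  by_contra hcon
  rw [if_neg hcon] at hm
  omega

lemma Tri.eq_or_of_ne {v a b c d : V} {t s r t' s' r' : L} (T : Tri S φ χ v a b t s r)
    (T' : Tri S φ χ v c d t' s' r') (hc : IsConfig S φ χ) (hp : IsPrimeConfig S φ χ)
    (h6 : 6 ≤ S.card) (hne : t' ≠ t) :
    ((c = a ∨ c = b) ∧ d ≠ a ∧ d ≠ b) ∨ ((d = a ∨ d = b) ∧ c ≠ a ∧ c ≠ b) := by
  have hM := T.minorSep hc hp h6
  have k1 : ¬ t' ∈ planes φ χ {a, b} := fun h =>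
    hne (hM.eq_of_mem hp T.v_mem T.t_mem T.t_ne T'.t_mem T'.t_ne h)
  have k2 : ¬ t' ∈ planes φ χ (S.erase v \ {a, b}) := fun h =>
    hne (hM.symm.eq_of_mem hp T.v_mem T.t_mem T.t_ne T'.t_mem T'.t_ne h)
  have l1 : (c = a ∨ c = b) → (d = a ∨ d = b) → False := fun h h' =>
    k1 (T'.mem_planes (by simpa using h) (by simpa using h'))
  have l2 : ¬ (c = a ∨ c = b) → ¬ (d = a ∨ d = b) → False := fun h h' =>
    k2 (T'.mem_planes
      (by simpa [T'.a_mem, T'.va.symm] using h) (by simpa [T'.b_mem, T'.vb.symm] using h'))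
  by_cases h : c = a ∨ c = b
  · exact Or.inl ⟨h, fun h' => l1 h (Or.inl h'), fun h' => l1 h (Or.inr h')⟩
  · refine Or.inr ⟨by_contra fun h' => l2 h h', fun h' => h (Or.inl h'), fun h' => h (Or.inr h')⟩

lemma Tri.exists_next {v a b : V} {t s r : L} (T : Tri S φ χ v a b t s r) (hc : IsConfig S φ χ)
    (hp : IsPrimeConfig S φ χ) (h6 : 6 ≤ S.card) (hn : NoPrimeMinor S φ χ) :
    ∃ y t' σ q, y ≠ v ∧ y ≠ a ∧ y ≠ b ∧ t' ≠ t ∧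
      (Tri S φ χ v a y t' σ q ∨ Tri S φ χ v b y t' σ q) := by
  obtain ⟨t', c, d, s', r', hne, T'⟩ := exists_tri_of_ne hc hp (by omega) hn T.v_mem t
  rcases T.eq_or_of_ne T' hc hp h6 hne with ⟨h1, h2, h3⟩ | ⟨h1, h2, h3⟩
  · refine ⟨d, t', s', r', T'.vb.symm, h2, h3, hne, ?_⟩
    rcases h1 with rfl | rfl
    · exact Or.inl T'
    · exact Or.inr T'
  · refine ⟨c, t', r', s', T'.va.symm, h2, h3, hne, ?_⟩
    rcases h1 with rfl | rfl
    · exact Or.inl T'.swap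
    · exact Or.inr T'.swap

lemma not_four_planes_le (hp : IsPrimeConfig S φ χ) (h6 : 6 ≤ S.card) {v a b c x y : V} (s : L)
    (hv : v ∈ S) (ha : a ∈ S) (hb : b ∈ S) (hc : c ∈ S) (hva : v ≠ a) (hvb : v ≠ b) (hvc : v ≠ c)
    (hab : a ≠ b) (hac : a ≠ c) (hbc : b ≠ c)
    (h : ∀ z, z = v ∨ z = a ∨ z = b ∨ z = c →
      plane φ χ z ≤ plane φ χ x ⊔ plane φ χ y ⊔ Submodule.span (ZMod 2) {s}) : False := by
  have hcard : ({v, a, b, c} : Finset V).card = 4 := by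
    rw [Finset.card_insert_of_notMem (by simp [hva, hvb, hvc]),
      Finset.card_insert_of_notMem (by simp [hab, hac]), Finset.card_pair hbc]
  have hsub : ({v, a, b, c} : Finset V) ⊆ S := by
    intro z hz
    simp only [Finset.mem_insert, Finset.mem_singleton] at hz
    rcases hz with rfl | rfl | rfl | rfl <;> assumption
  have h1 := hp _ hsub (by omega) (by rw [Finset.card_sdiff_of_subset hsub]; omega)
  have h2 : planes φ χ {v, a, b, c} ≤
      plane φ χ x ⊔ plane φ χ y ⊔ Submodule.span (ZMod 2) {s} := by
    apply Finset.sup_le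
    intro z hz
    simp only [Finset.mem_insert, Finset.mem_singleton] at hz
    exact h z hz
  have h3 := Submodule.finrank_mono h2
  have h4 := Submodule.finrank_add_le_finrank_add_finrank (plane φ χ x ⊔ plane φ χ y)
    (Submodule.span (ZMod 2) {s})
  have h5 := Submodule.finrank_add_le_finrank_add_finrank (plane φ χ x) (plane φ χ y)
  have h6 := finrank_plane_le (φ := φ) (χ := χ) x
  have h7 := finrank_plane_le (φ := φ) (χ := χ) y
  have h8 := finrank_span_singleton_le_one s
  rw [conn, hcard] at h1
  omega

lemma Tri.third {v a b c : V} {t₁ t₂ s r₁ r₂ : L} (T₁ : Tri S φ χ v a b t₁ s r₁)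
    (T₂ : Tri S φ χ v a c t₂ s r₂) (hbc : b ≠ c) (hne : t₁ ≠ t₂) :
    Tri S φ χ v b c (t₁ + t₂) r₁ r₂ := by
  refine ⟨T₁.v_mem, T₁.b_mem, T₂.b_mem, T₁.vb, T₂.vb, hbc,
    Submodule.add_mem _ T₁.t_mem T₂.t_mem, T₁.r_mem, T₂.r_mem, ?_, T₁.r_ne, T₂.r_ne, ?_⟩
  · intro h
    exact hne (by rw [eq_neg_of_add_eq_zero_left h, neg_eq_self_zmod_two])
  · rw [T₁.eq_add, T₂.eq_add]
    have e1 := add_self_zmod_two s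
    have e2 := add_self_zmod_two r₁
    have e3 := add_self_zmod_two r₂
    calc s + r₁ + (s + r₂) + r₁ + r₂ = (s + s) + (r₁ + r₁) + (r₂ + r₂) := by abel
      _ = 0 := by rw [e1, e2, e3]; simp

lemma Tri.ne_of_ne {v a b c : V} {t₁ t₂ s₁ s₂ r₁ r₂ : L} (T₁ : Tri S φ χ v a b t₁ s₁ r₁)
    (T₂ : Tri S φ χ v a c t₂ s₂ r₂) (hc : IsConfig S φ χ) (hp : IsPrimeConfig S φ χ)
    (h6 : 6 ≤ S.card) (hne : t₁ ≠ t₂) : b ≠ c := by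
  have := T₁.eq_or_of_ne T₂ hc hp h6 hne.symm
  have := T₁.ab
  grind

lemma Tri.exists_of_shared {v a b c : V} {t₁ t₂ s r₁ r₂ : L} (T₁ : Tri S φ χ v a b t₁ s r₁)
    (T₂ : Tri S φ χ v a c t₂ s r₂) (hc : IsConfig S φ χ) (hp : IsPrimeConfig S φ χ)
    (h6 : 6 ≤ S.card) (hn : NoPrimeMinor S φ χ) (hne : t₁ ≠ t₂) :
    ∃ d s' δ, d ≠ b ∧ d ≠ c ∧ s' ≠ s ∧ Tri S φ χ v a d (t₁ + t₂) s' δ := by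
  have hbc := T₁.ne_of_ne T₂ hc hp h6 hne
  have T₃ := T₁.third T₂ hbc hne
  obtain ⟨y, s', τ, δ, hya, hyb, hyv, hs', hT⟩ := T₁.rot.exists_next hc hp h6 hn
  have hvc := T₂.vb
  rcases hT with hT | hT
  · -- the new triangle avoids `v`, so its third vertex is `c`
    exfalso
    have hyc : y = c := by
      have := T₂.rot.eq_or_of_ne hT hc hp h6 hs'
      have := T₁.vb
      grind
    subst hyc
    have mb : plane φ χ b ≤ plane φ χ b ⊔ plane φ χ y ⊔ Submodule.span (ZMod 2) {s} :=
      le_sup_left.trans le_sup_left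
    have mc : plane φ χ y ≤ plane φ χ b ⊔ plane φ χ y ⊔ Submodule.span (ZMod 2) {s} :=
      le_sup_right.trans le_sup_left
    have ms : s ∈ plane φ χ b ⊔ plane φ χ y ⊔ Submodule.span (ZMod 2) {s} :=
      Submodule.mem_sup_right (Submodule.mem_span_singleton_self s)
    refine not_four_planes_le (x := b) (y := y) hp h6 s T₁.v_mem T₁.a_mem T₁.b_mem T₂.b_mem T₁.va
      T₁.vb T₂.vb T₁.ab T₂.ab hbc ?_
    rintro z (rfl | rfl | rfl | rfl)
    · exact plane_le_of_mem T₁.t_mem T₂.t_mem T₁.t_ne T₂.t_ne hne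
        (T₁.mem_of ms (mb T₁.r_mem)) (T₂.mem_of ms (mc T₂.r_mem))
    · exact plane_le_of_mem T₁.s_mem hT.t_mem T₁.s_ne hT.t_ne hs'.symm ms
        (hT.mem_of (mb hT.s_mem) (mc hT.r_mem))
    · exact mb
    · exact mc
  · have hyc : y ≠ c := by
      have := T₂.rot.eq_or_of_ne hT hc hp h6 hs'
      grind
    have hT' := hT.rot.rot.swap.rot.rot
    have hτ : τ = t₁ + t₂ := by
      by_contra hτ
      have := T₃.eq_or_of_ne hT.rot hc hp h6 hτ
      have := T₁.ab
      have := T₂.ab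
      grind
    subst hτ
    exact ⟨y, s', δ, hyb, hyc, hs', hT.rot.swap⟩

lemma Tri.not_shared {v a b c : V} {t₁ t₂ s₁ s₂ r₁ r₂ : L} (T₁ : Tri S φ χ v a b t₁ s₁ r₁)
    (T₂ : Tri S φ χ v a c t₂ s₂ r₂) (hc : IsConfig S φ χ) (hp : IsPrimeConfig S φ χ)
    (h6 : 6 ≤ S.card) (hn : NoPrimeMinor S φ χ) (hne : t₁ ≠ t₂) : s₁ ≠ s₂ := by
  rintro rfl
  have hbc := T₁.ne_of_ne T₂ hc hp h6 hne
  have T₃ := T₁.third T₂ hbc hne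
  obtain ⟨d, s', δ, hdb, hdc, hs', T⟩ := T₁.exists_of_shared T₂ hc hp h6 hn hne
  have hne' : t₁ ≠ t₁ + t₂ := fun h => T₂.t_ne (left_eq_add.1 h)
  obtain ⟨d', r', δ', hda', hdc', hr', T'⟩ := T₁.swap.exists_of_shared T₃ hc hp h6 hn hne'
  rw [← add_assoc, add_self_zmod_two, zero_add] at T'
  have hdd : d' = d := by
    have := T.eq_or_of_ne T' hc hp h6 (fun h => T₁.t_ne (right_eq_add.1 h))
    have := T₁.ab
    grind
  subst hdd
  have mv : plane φ χ v ≤ plane φ χ v ⊔ plane φ χ d' ⊔ Submodule.span (ZMod 2) {s₁} :=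
    le_sup_left.trans le_sup_left
  have md : plane φ χ d' ≤ plane φ χ v ⊔ plane φ χ d' ⊔ Submodule.span (ZMod 2) {s₁} :=
    le_sup_right.trans le_sup_left
  have ms : s₁ ∈ plane φ χ v ⊔ plane φ χ d' ⊔ Submodule.span (ZMod 2) {s₁} :=
    Submodule.mem_sup_right (Submodule.mem_span_singleton_self s₁)
  refine not_four_planes_le (x := v) (y := d') hp h6 s₁ T₁.v_mem T₁.a_mem T₁.b_mem T.b_mem T₁.va
    T₁.vb T.vb T₁.ab T.ab T'.ab ?_
  rintro z (rfl | rfl | rfl | rfl)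
  · exact mv
  · exact plane_le_of_mem T₁.s_mem T.s_mem T₁.s_ne T.s_ne hs'.symm ms
      (T.rot.mem_of (md T.r_mem) (mv T.t_mem))
  · exact plane_le_of_mem T₁.r_mem T'.s_mem T₁.r_ne T'.s_ne hr'.symm
      (T₁.rot.rot.mem_of (mv T₁.t_mem) ms) (T'.rot.mem_of (md T'.r_mem) (mv T'.t_mem))
  · exact md

lemma card_le_two_of_plane_le (hp : IsPrimeConfig S φ χ) (hc : IsConfig S φ χ) {v b : V} {g : L}
    {X Y : Finset V} (hM : MinorSep S φ χ v g X Y) (hv : v ∈ S) (hb : b ∈ Y)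
    (hle : plane φ χ b ≤ planes φ χ (insert v X)) : Y.card ≤ 2 := by
  by_contra! hY
  have hbX : b ∉ insert v X := by
    rw [← hM.compl_insert_eq] at hb
    exact (Finset.mem_sdiff.1 hb).2
  have hbS := hM.symm.subset_S hb
  have hsub : insert v X ⊆ S := Finset.insert_subset hv hM.subset_S
  have h1 := conn_insert_of_le hbX hle
  have h2 := hc.conn_compl hsub
  rw [hM.compl_insert_eq, hM.conn_right] at h2
  have h3 := hp (insert b (insert v X)) (Finset.insert_subset hbS hsub)
    (hM.card_left.trans (Finset.card_le_card fun x hx => by simp [hx]))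
    (by
      have : S \ insert b (insert v X) = Y.erase b := by
        rw [← hM.compl_insert_eq]
        ext x; simp only [Finset.mem_sdiff, Finset.mem_insert, Finset.mem_erase]; tauto
      rw [this, Finset.card_erase_of_mem hb]
      omega)
  omega

lemma Tri.false_of_third {v a b c y : V} {t₁ t₂ s₁ s₂ r₁ r₂ r' τ q : L}
    (T₁ : Tri S φ χ v a b t₁ s₁ r₁) (T₂ : Tri S φ χ v a c t₂ s₂ r₂)
    (T : Tri S φ χ b v y r' τ q) (hc : IsConfig S φ χ) (hp : IsPrimeConfig S φ χ)
    (h6 : 6 ≤ S.card) (hn : NoPrimeMinor S φ χ) (hne : t₁ ≠ t₂) (hr : r' ≠ r₁) (hya : y ≠ a)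
    (hyc : y ≠ c) : False := by
  have hbc := T₁.ne_of_ne T₂ hc hp h6 hne
  have hs := T₁.not_shared T₂ hc hp h6 hn hne
  have hτ₁ : t₁ ≠ τ := T₁.rot.rot.not_shared T hc hp h6 hn hr.symm
  have hτ₂ : τ = t₂ := by
    by_contra hτ
    have := T₂.eq_or_of_ne T.rot hc hp h6 hτ
    have := T₁.ab
    grind
  subst hτ₂
  have hg0 : t₁ + τ ≠ 0 := by
    intro h
    exact hne (by rw [eq_neg_of_add_eq_zero_left h, neg_eq_self_zmod_two])
  have hgv : t₁ + τ ∈ plane φ χ v := Submodule.add_mem _ T₁.t_mem T₂.t_mem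
  obtain ⟨X, Y, hM⟩ := exists_sep hc hp T₁.v_mem hgv hg0 (hn v T₁.v_mem _ hgv hg0)
  have main : ∀ X Y, MinorSep S φ χ v (t₁ + τ) X Y → a ∈ X → False := by
    intro X Y hM haX
    have sep₁ : ¬ t₁ ∈ planes φ χ X := fun h => by
      have := hM.eq_of_mem hp T₁.v_mem hgv hg0 T₁.t_mem T₁.t_ne h
      exact T₂.t_ne (left_eq_add.1 this)
    have sep₂ : ∀ {X Y}, MinorSep S φ χ v (t₁ + τ) X Y → ¬ τ ∈ planes φ χ X := fun hM h => by
      have := hM.eq_of_mem hp T₁.v_mem hgv hg0 T₂.t_mem T₂.t_ne h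
      exact T₁.t_ne (right_eq_add.1 this)
    have hbY : b ∈ Y := by
      rw [hM.mem_iff T₁.b_mem T₁.vb.symm]
      exact fun hb => sep₁ (T₁.mem_planes haX hb)
    have hcY : c ∈ Y := by
      rw [hM.mem_iff T₂.b_mem T₂.vb.symm]
      exact fun hb => sep₂ hM (T₂.mem_planes haX hb)
    have hyX : y ∈ X := by
      rw [hM.symm.mem_iff T.b_mem T.ab.symm]
      exact fun hb => sep₂ hM.symm (T.rot.mem_planes hb hbY)
    have k1 := card_le_two_of_plane_le hp hc hM T₁.v_mem hbY
      (plane_le_of_mem T₁.r_mem T.t_mem T₁.r_ne T.t_ne hr.symm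
        (T₁.rot.rot.mem_planes (by simp) (by simp [haX])) (T.mem_planes (by simp) (by simp [hyX])))
    have k2 := card_le_two_of_plane_le hp hc hM.symm T₁.v_mem haX
      (plane_le_of_mem T₁.s_mem T₂.s_mem T₁.s_ne T₂.s_ne hs
        (T₁.rot.mem_planes (by simp [hbY]) (by simp)) (T₂.rot.mem_planes (by simp [hcY]) (by simp)))
    have := hM.card_eq T₁.v_mem
    omega
  by_cases haX : a ∈ X
  · exact main X Y hM haX
  · exact main Y X hM.symm ((hM.mem_iff T₁.a_mem T₁.va.symm).2 haX)

lemma exists_mem_plane_ne (hp : IsPrimeConfig S φ χ) (h4 : 4 ≤ S.card) {v : V} (hv : v ∈ S)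
    (t : L) : ∃ t' ∈ plane φ χ v, t' ≠ 0 ∧ t' ≠ t := by
  by_cases h : φ v = t
  · exact ⟨χ v, right_mem_plane v, hp.right_ne_zero h4 hv,
      fun h' => hp.left_ne_right h4 hv (h.trans h'.symm)⟩
  · exact ⟨φ v, left_mem_plane v, hp.left_ne_zero h4 hv, h⟩

/-- A prime configuration with at least six planes has a prime minor with one plane less. -/
theorem exists_prime_minor (hc : IsConfig S φ χ) (hp : IsPrimeConfig S φ χ) (h6 : 6 ≤ S.card) :
    ∃ v ∈ S, ∃ t ∈ plane φ χ v, t ≠ 0 ∧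
      IsPrimeConfig (S.erase v) (modVec t ∘ φ) (modVec t ∘ χ) := by
  by_contra hcon
  have hn : NoPrimeMinor S φ χ := by
    intro v hv t ht h0 hP
    exact hcon ⟨v, hv, t, ht, h0, hP⟩
  obtain ⟨v₀, hv₀⟩ : S.Nonempty := Finset.card_pos.1 (by omega)
  obtain ⟨t₁, a, b, s₁, r₁, -, T₁⟩ := exists_tri_of_ne hc hp (by omega) hn hv₀ 0
  have main : ∀ {v a b c : V} {t₁ t₂ s₁ s₂ r₁ r₂ : L}, Tri S φ χ v a b t₁ s₁ r₁ →
      Tri S φ χ v a c t₂ s₂ r₂ → t₁ ≠ t₂ → False := by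
    intro v a b c t₁ t₂ s₁ s₂ r₁ r₂ T₁ T₂ hne
    have hbc := T₁.ne_of_ne T₂ hc hp h6 hne
    have hs := T₁.not_shared T₂ hc hp h6 hn hne
    obtain ⟨y, r', τ, q, hyb, hyv, hya, hr', hT⟩ := T₁.rot.rot.exists_next hc hp h6 hn
    have hyc : y ≠ c := by
      rintro rfl
      obtain ⟨q', hq', hq0, hqr⟩ := exists_mem_plane_ne hp (by omega) T₂.b_mem r₂
      set P := plane φ χ v ⊔ plane φ χ a ⊔ Submodule.span (ZMod 2) {q'} with hP
      have mv : plane φ χ v ≤ P := le_sup_left.trans le_sup_left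
      have ma : plane φ χ a ≤ P := le_sup_right.trans le_sup_left
      have mq : q' ∈ P := Submodule.mem_sup_right (Submodule.mem_span_singleton_self q')
      have mc : plane φ χ y ≤ P := plane_le_of_mem hq' T₂.r_mem hq0 T₂.r_ne hqr mq
        (T₂.rot.rot.mem_of (mv T₂.t_mem) (ma T₂.s_mem))
      have mr : r₁ ∈ P := T₁.rot.rot.mem_of (mv T₁.t_mem) (ma T₁.s_mem)
      have mb : plane φ χ b ≤ P := by
        rcases hT with hT | hT
        · exact plane_le_of_mem T₁.r_mem hT.t_mem T₁.r_ne hT.t_ne hr'.symm mr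
            (hT.mem_of (mv hT.s_mem) (mc hT.r_mem))
        · exact plane_le_of_mem T₁.r_mem hT.t_mem T₁.r_ne hT.t_ne hr'.symm mr
            (hT.mem_of (ma hT.s_mem) (mc hT.r_mem))
      refine not_four_planes_le (x := v) (y := a) hp h6 q' T₁.v_mem T₁.a_mem T₁.b_mem T₂.b_mem
        T₁.va T₁.vb T₂.vb T₁.ab T₂.ab hbc ?_
      rintro z (rfl | rfl | rfl | rfl) <;> assumption
    rcases hT with hT | hT
    · exact T₁.false_of_third T₂ hT hc hp h6 hn hne hr' hya hyc
    · exact T₁.swap.rot.rot.false_of_third T₂.swap.rot.rot hT hc hp h6 hn hs hr' hyv hyc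
  obtain ⟨y, t', σ, q, -, -, -, hne, hT | hT⟩ := T₁.exists_next hc hp h6 hn
  · exact main T₁ hT hne.symm
  · exact main T₁.swap hT hne.symm

end Chain

section Uniqueness

variable {V : Type*} [DecidableEq V] {L : Type*} [AddCommGroup L] [Module (ZMod 2) L]
  {S : Finset V} {φ χ : V → L}

lemma exists_dual_eq_one {P : Submodule (ZMod 2) L} {x : L} (hx : x ∉ P) :
    ∃ ξ : Module.Dual (ZMod 2) L, (∀ y ∈ P, ξ y = 0) ∧ ξ x = 1 := by
  obtain ⟨f, hf, hP⟩ := Submodule.exists_le_ker_of_notMem hx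
  exact ⟨f, fun y hy => hP hy, (zmod_two_cases _).resolve_left hf⟩

lemma eq_of_forall_dual {x y : L} (h : ∀ ξ : Module.Dual (ZMod 2) L, ξ x = ξ y) : x = y := by
  by_contra hxy
  have : x - y ∉ (⊥ : Submodule (ZMod 2) L) := by simpa [sub_eq_zero] using hxy
  obtain ⟨ξ, -, hξ⟩ := exists_dual_eq_one this
  rw [map_sub, h, sub_self] at hξ
  exact zero_ne_one hξ

lemma mem_sup_span_singleton {P : Submodule (ZMod 2) L} {x t : L} :
    x ∈ P ⊔ Submodule.span (ZMod 2) {t} ↔ x ∈ P ∨ x + t ∈ P := by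
  constructor
  · intro h
    obtain ⟨y, hy, z, hz, rfl⟩ := Submodule.mem_sup.1 h
    obtain ⟨a, rfl⟩ := Submodule.mem_span_singleton.1 hz
    rcases zmod_two_cases a with rfl | rfl
    · left; simpa using hy
    · right; rw [one_smul, add_assoc, add_self_zmod_two, add_zero]; exact hy
  · rintro (h | h)
    · exact Submodule.mem_sup_left h
    · have h1 : x = x + t + t := by rw [add_assoc, add_self_zmod_two, add_zero]
      rw [h1]
      exact Submodule.add_mem _ (Submodule.mem_sup_left h)
        (Submodule.mem_sup_right (Submodule.mem_span_singleton_self t))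

/-- The alternating form given by the bivector `φ v ∧ χ v`. -/
def wedge (φ χ : V → L) (ξ η : Module.Dual (ZMod 2) L) (v : V) : ZMod 2 :=
  ξ (φ v) * η (χ v) + ξ (χ v) * η (φ v)

/-- The trilinear form given by the trivector `φ v ∧ χ v ∧ x`. -/
def vol (φ χ : V → L) (ξ η ζ : Module.Dual (ZMod 2) L) (v : V) (x : L) : ZMod 2 :=
  wedge φ χ ξ η v * ζ x + wedge φ χ η ζ v * ξ x + wedge φ χ ζ ξ v * η x

/-- The sum of the trivectors `φ v ∧ χ v ∧ h v` vanishes. -/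
def IsClosedField (S : Finset V) (φ χ h : V → L) : Prop :=
  ∀ ξ η ζ : Module.Dual (ZMod 2) L, ∑ v ∈ S, vol φ χ ξ η ζ v (h v) = 0

lemma vol_add (ξ η ζ : Module.Dual (ZMod 2) L) (v : V) (x y : L) :
    vol φ χ ξ η ζ v (x + y) = vol φ χ ξ η ζ v x + vol φ χ ξ η ζ v y := by
  simp only [vol, map_add]; ring

lemma vol_eq_zero (ξ η ζ : Module.Dual (ZMod 2) L) {v : V} {x : L} (hx : x ∈ plane φ χ v) :
    vol φ χ ξ η ζ v x = 0 := by
  have h : ∀ a b c a' b' c' : ZMod 2, (a * b' + a' * b) * c + (b * c' + b' * c) * a +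
      (c * a' + c' * a) * b = 0 ∧ (a * b' + a' * b) * c' + (b * c' + b' * c) * a' +
      (c * a' + c' * a) * b' = 0 := by decide
  obtain ⟨h1, h2⟩ := h (ξ (φ v)) (η (φ v)) (ζ (φ v)) (ξ (χ v)) (η (χ v)) (ζ (χ v))
  rcases mem_plane_iff.1 hx with rfl | rfl | rfl | rfl
  · simp [vol]
  · exact h1
  · exact h2
  · rw [vol_add]
    unfold vol wedge
    rw [h1, h2, add_zero]

lemma vol_congr (ξ η ζ : Module.Dual (ZMod 2) L) {v : V} {x y : L} (h : x + y ∈ plane φ χ v) :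
    vol φ χ ξ η ζ v x = vol φ χ ξ η ζ v y := by
  have h1 : x = (x + y) + y := by rw [add_assoc, add_self_zmod_two, add_zero]
  rw [h1, vol_add, vol_eq_zero _ _ _ h, zero_add]

lemma sum_wedge_eq_zero (hc : IsConfig S φ χ) (ξ η : Module.Dual (ZMod 2) L) :
    ∑ v ∈ S, wedge φ χ ξ η v = 0 := by
  have h := congrArg η (hc.isotropic ξ)
  rw [map_sum, map_zero] at h
  rw [← h]
  exact Finset.sum_congr rfl fun v _ => by simp [wedge]

lemma IsClosedField.translate (hc : IsConfig S φ χ) {h : V → L} (hh : IsClosedField S φ χ h)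
    (l : L) : IsClosedField S φ χ fun v => h v + l := by
  intro ξ η ζ
  simp only [vol_add]
  rw [Finset.sum_add_distrib, hh, zero_add]
  simp only [vol, Finset.sum_add_distrib, ← Finset.sum_mul, sum_wedge_eq_zero hc]
  simp

lemma wedge_eq_zero_of_mem {ξ η : Module.Dual (ZMod 2) L} {v : V} {t : L} (ht : t ∈ plane φ χ v)
    (h0 : t ≠ 0) (hξ : ξ t = 0) (hη : η t = 0) : wedge φ χ ξ η v = 0 := by
  have e : ∀ a b : ZMod 2, a + b = 0 → a = b := by decide
  rcases mem_plane_iff.1 ht with rfl | rfl | rfl | rfl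
  · exact absurd rfl h0
  · simp [wedge, hξ, hη]
  · simp [wedge, hξ, hη]
  · rw [map_add] at hξ hη
    rw [wedge, e _ _ hξ, e _ _ hη]
    exact CharTwo.add_self_eq_zero _

lemma exists_wedge_of_mem {v : V} {t : L} (ht : t ∈ plane φ χ v) (h0 : t ≠ 0) :
    ∃ s ∈ plane φ χ v, plane φ χ v = Submodule.span (ZMod 2) {t} ⊔ Submodule.span (ZMod 2) {s} ∧
      ∀ ξ η : Module.Dual (ZMod 2) L, wedge φ χ ξ η v = ξ t * η s + ξ s * η t := by
  rcases mem_plane_iff.1 ht with rfl | rfl | rfl | rfl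
  · exact absurd rfl h0
  · refine ⟨χ v, right_mem_plane v, ?_, fun ξ η => rfl⟩
    rw [plane, ← Submodule.span_union, Set.singleton_union]
  · refine ⟨φ v, left_mem_plane v, ?_, fun ξ η => ?_⟩
    · rw [plane, ← Submodule.span_union, Set.singleton_union, Set.pair_comm]
    · rw [wedge, add_comm]
  · refine ⟨φ v, left_mem_plane v, le_antisymm ?_ (sup_le ?_ ?_), fun ξ η => ?_⟩
    · rw [plane, Submodule.span_le]
      rintro x (rfl | rfl)
      · exact Submodule.mem_sup_right (Submodule.mem_span_singleton_self _)
      · have : χ v = (φ v + χ v) + φ v := by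
          rw [add_comm (φ v) (χ v), add_assoc, add_self_zmod_two, add_zero]
        nth_rewrite 2 [this]
        exact Submodule.add_mem _ (Submodule.mem_sup_left (Submodule.mem_span_singleton_self _))
          (Submodule.mem_sup_right (Submodule.mem_span_singleton_self _))
    · rwa [Submodule.span_singleton_le_iff_mem]
    · rw [Submodule.span_singleton_le_iff_mem]; exact left_mem_plane v
    · have e : ∀ a b c d : ZMod 2, a * b + c * d = (a + c) * d + a * (d + b) := by decide
      rw [wedge, map_add, map_add, e]

variable [FiniteDimensional (ZMod 2) L]

lemma conn_le_one_of_wedge {X : Finset V} {s r : L}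
    (h : ∀ ξ η : Module.Dual (ZMod 2) L, ∑ u ∈ X, wedge φ χ ξ η u = ξ s * η r + ξ r * η s) :
    conn φ χ X ≤ 1 := by
  let T : Module.Dual (ZMod 2) L →ₗ[ZMod 2] ((X → ZMod 2) × (X → ZMod 2)) :=
    { toFun := fun ξ => (fun v => ξ (χ v), fun v => ξ (φ v))
      map_add' := fun ξ η => rfl
      map_smul' := fun a ξ => rfl }
  have hker : LinearMap.ker T = (planes φ χ X).dualAnnihilator := by
    ext ξ
    rw [LinearMap.mem_ker, Submodule.mem_dualAnnihilator]
    constructor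
    · intro h'
      exact dual_eq_zero_of_planes fun v hv =>
        ⟨congrFun (congrArg Prod.snd h') ⟨v, hv⟩, congrFun (congrArg Prod.fst h') ⟨v, hv⟩⟩
    · intro h'
      refine Prod.ext (funext fun v => ?_) (funext fun v => ?_)
      · exact h' _ (plane_le_planes v.2 (right_mem_plane _))
      · exact h' _ (plane_le_planes v.2 (left_mem_plane _))
  have hT : ∀ ξ, combo φ χ X (T ξ) = ξ s • r + ξ r • s := by
    intro ξ
    apply eq_of_forall_dual
    intro η
    have := h ξ η
    rw [← Finset.sum_coe_sort X] at this
    simp only [combo, LinearMap.coe_mk, AddHom.coe_mk, T, map_sum, map_add, map_smul,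
      smul_eq_mul]
    rw [← this]
    exact Finset.sum_congr rfl fun v _ => add_comm _ _
  let R := LinearMap.range T
  let f := (combo φ χ X).domRestrict R
  have h1 := LinearMap.finrank_range_add_finrank_ker f
  have h2 : Module.finrank (ZMod 2) (LinearMap.range f) ≤ 2 := by
    have hle : LinearMap.range f ≤ Submodule.span (ZMod 2) {r, s} := by
      rintro _ ⟨⟨_, ξ, rfl⟩, rfl⟩
      rw [LinearMap.domRestrict_apply, hT]
      exact Submodule.mem_span_pair.2 ⟨_, _, rfl⟩
    refine (Submodule.finrank_mono hle).trans ?_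
    classical
    have h := finrank_span_finset_le_card (R := ZMod 2) ({r, s} : Finset L)
    rw [Finset.coe_insert, Finset.coe_singleton] at h
    exact h.trans Finset.card_le_two
  have h3 : Module.finrank (ZMod 2) (LinearMap.ker f) ≤
      Module.finrank (ZMod 2) (LinearMap.ker (combo φ χ X)) := by
    let g : LinearMap.ker f →ₗ[ZMod 2] LinearMap.ker (combo φ χ X) :=
      (R.subtype).restrict fun x hx => hx
    refine LinearMap.finrank_le_finrank_of_injective (f := g) fun x y hxy => ?_
    exact Subtype.ext (Subtype.ext (congrArg (LinearMap.ker (combo φ χ X)).subtype hxy))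
  have h4 := LinearMap.finrank_range_add_finrank_ker T
  have h5 := Subspace.finrank_add_finrank_dualAnnihilator_eq (planes φ χ X)
  rw [hker, Subspace.dual_finrank_eq] at h4
  have h6 := LinearMap.finrank_range_add_finrank_ker (combo φ χ X)
  rw [range_combo, Module.finrank_prod, Module.finrank_fintype_fun_eq_card,
    Fintype.card_coe] at h6
  unfold conn
  change _ = Module.finrank (ZMod 2) (LinearMap.range T) at h1
  omega

/-- A field that is closed and trivial modulo `t` away from `v`, up to at most one exception,
is trivial. -/
lemma mem_plane_of_closed_of_card_le_one (hp : IsPrimeConfig S φ χ)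
    (h4 : 4 ≤ S.card) {v : V} (hv : v ∈ S) {t : L} (ht : t ∈ plane φ χ v) (h0 : t ≠ 0)
    {h : V → L} (hh : IsClosedField S φ χ h) {X : Finset V} (hX : X ⊆ S.erase v)
    (h1 : ∀ u ∈ X, h u + t ∈ plane φ χ u)
    (h2 : ∀ u ∈ S.erase v, u ∉ X → h u ∈ plane φ χ u) (hcard : X.card ≤ 1) :
    ∀ u ∈ S, h u ∈ plane φ χ u := by
  obtain ⟨s, hs, hplane, hw⟩ := exists_wedge_of_mem ht h0
  have key : ∀ ξ η ζ : Module.Dual (ZMod 2) L, ξ t = 0 → η t = 0 → ζ t = 1 →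
      ∑ u ∈ X, wedge φ χ ξ η u = ξ s * η (h v) + ξ (h v) * η s := by
    intro ξ η ζ hξ hη hζ
    have e := hh ξ η ζ
    rw [← Finset.add_sum_erase S _ hv, ← Finset.sum_sdiff hX, Finset.sum_eq_zero, zero_add] at e
    · have e1 : ∑ u ∈ X, vol φ χ ξ η ζ u (h u) = ∑ u ∈ X, wedge φ χ ξ η u := by
        refine Finset.sum_congr rfl fun u hu => ?_
        rw [vol_congr ξ η ζ (h1 u hu)]
        simp [vol, hξ, hη, hζ]
      rw [e1] at e
      simp only [vol, hw, hξ, hη, hζ] at e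
      have e2 : ∀ a b : ZMod 2, a + b = 0 → b = a := by decide
      rw [e2 _ _ e]
      ring
    · intro u hu
      rw [Finset.mem_sdiff] at hu
      exact vol_eq_zero _ _ _ (h2 u hu.1 hu.2)
  obtain ⟨ζ, -, hζ⟩ := exists_dual_eq_one (P := (⊥ : Submodule (ZMod 2) L)) (x := t) (by simpa)
  have hXe : X = ∅ := by
    by_contra hne
    obtain ⟨u, rfl⟩ := Finset.card_eq_one.1
      (le_antisymm hcard (Finset.card_pos.2 (Finset.nonempty_iff_ne_empty.2 hne)))
    have hu := Finset.mem_erase.1 (hX (Finset.mem_singleton_self u))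
    have n1 : φ u ∉ plane φ χ v ⊔ Submodule.span (ZMod 2) {χ u} := by
      rw [mem_sup_span_singleton]
      rintro (h' | h')
      · exact hp.left_ne_zero h4 hu.2
          (hp.disjoint_plane h4 hu.2 hv hu.1 (left_mem_plane u) h')
      · refine hp.left_ne_right h4 hu.2 ?_
        have := hp.disjoint_plane h4 hu.2 hv hu.1
          (Submodule.add_mem _ (left_mem_plane u) (right_mem_plane u)) h'
        rwa [← sub_eq_add_zmod_two, sub_eq_zero] at this
    have n2 : χ u ∉ plane φ χ v := fun h' => hp.right_ne_zero h4 hu.2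
      (hp.disjoint_plane h4 hu.2 hv hu.1 (right_mem_plane u) h')
    obtain ⟨ξ, hξ, hξ'⟩ := exists_dual_eq_one n1
    obtain ⟨η, hη, hη'⟩ := exists_dual_eq_one n2
    have e := key ξ η ζ (hξ _ (Submodule.mem_sup_left ht)) (hη _ ht) hζ
    rw [Finset.sum_singleton, wedge, hξ', hη',
      hξ _ (Submodule.mem_sup_right (Submodule.mem_span_singleton_self _)),
      hξ _ (Submodule.mem_sup_left hs), hη _ hs] at e
    simp at e
  subst hXe
  intro u hu
  by_cases huv : u = v
  · subst huv
    by_contra hcon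
    have hs' : s ∉ Submodule.span (ZMod 2) {t} := by
      intro h'
      have := hp.finrank_plane h4 hv
      rw [hplane, sup_eq_left.2 ((Submodule.span_singleton_le_iff_mem _ _).2 h')] at this
      have := finrank_span_singleton_le_one t
      omega
    obtain ⟨ξ, hξ, hξ'⟩ := exists_dual_eq_one hcon
    obtain ⟨η, hη, hη'⟩ := exists_dual_eq_one hs'
    have e := key ξ η ζ (hξ _ ht) (hη _ (Submodule.mem_span_singleton_self _)) hζ
    rw [Finset.sum_empty, hξ _ hs, hξ', hη'] at e
    simp at e
  · exact h2 u (Finset.mem_erase.2 ⟨huv, hu⟩) (Finset.notMem_empty u)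

/-- The inductive step: triviality of closed fields lifts from a prime minor. -/
lemma exists_translate_of_minor (hc : IsConfig S φ χ) (hp : IsPrimeConfig S φ χ)
    (h4 : 4 ≤ S.card) {v : V} (hv : v ∈ S) {t : L} (ht : t ∈ plane φ χ v) (h0 : t ≠ 0)
    (hp' : IsPrimeConfig (S.erase v) (modVec t ∘ φ) (modVec t ∘ χ))
    {h : V → L} (hh : IsClosedField S φ χ h)
    (ih : ∃ l, ∀ u ∈ S.erase v, (modVec t ∘ h) u + l ∈ plane (modVec t ∘ φ) (modVec t ∘ χ) u) :
    ∃ l, ∀ u ∈ S, h u + l ∈ plane φ χ u := by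
  classical
  obtain ⟨l', hl'⟩ := ih
  obtain ⟨l, rfl⟩ := Submodule.mkQ_surjective _ l'
  have hl : ∀ u ∈ S.erase v, h u + l ∈ plane φ χ u ∨ h u + l + t ∈ plane φ χ u := by
    intro u hu
    have := hl' u hu
    rw [plane_map, Function.comp_apply, ← map_add] at this
    obtain ⟨y, hy, hyx⟩ := Submodule.mem_map.1 this
    have e : modVec t (y + (h u + l)) = 0 := by
      rw [map_add, hyx, ← sub_eq_add_zmod_two, sub_self]
    rcases modVec_eq_zero_iff.1 e with e | e
    · left
      rw [← sub_eq_add_zmod_two, sub_eq_zero] at e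
      rwa [← e]
    · right
      have : h u + l + t = y := by
        rw [← e, add_comm y, ← add_assoc, add_self_zmod_two, zero_add]
      rwa [this]
  set X := (S.erase v).filter fun u => h u + l ∉ plane φ χ u with hXdef
  have hX : X ⊆ S.erase v := Finset.filter_subset _ _
  have hX1 : ∀ u ∈ X, h u + l + t ∈ plane φ χ u := fun u hu =>
    (hl u (hX hu)).resolve_left (Finset.mem_filter.1 hu).2
  have hX2 : ∀ u ∈ S.erase v, u ∉ X → h u + l ∈ plane φ χ u := fun u hu hu' => by
    by_contra hcon
    exact hu' (Finset.mem_filter.2 ⟨hu, hcon⟩)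
  have hh1 := hh.translate hc l
  have hconn : conn (modVec t ∘ φ) (modVec t ∘ χ) X ≤ 1 := by
    obtain ⟨s, hs, hplane, hw⟩ := exists_wedge_of_mem ht h0
    obtain ⟨ζ, -, hζ⟩ := exists_dual_eq_one (P := (⊥ : Submodule (ZMod 2) L)) (x := t) (by simpa)
    apply conn_le_one_of_wedge (s := modVec t s) (r := modVec t (h v + l))
    intro ξ' η'
    set ξ := ξ' ∘ₗ modVec t with hξdef
    set η := η' ∘ₗ modVec t with hηdef
    have hξ : ξ t = 0 := by rw [hξdef, LinearMap.comp_apply, modVec_self, map_zero]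
    have hη : η t = 0 := by rw [hηdef, LinearMap.comp_apply, modVec_self, map_zero]
    change ∑ u ∈ X, wedge φ χ ξ η u = ξ s * η (h v + l) + ξ (h v + l) * η s
    have e := hh1 ξ η ζ
    rw [← Finset.add_sum_erase S _ hv, ← Finset.sum_sdiff hX, Finset.sum_eq_zero, zero_add] at e
    · have e1 : ∑ u ∈ X, vol φ χ ξ η ζ u (h u + l) = ∑ u ∈ X, wedge φ χ ξ η u := by
        refine Finset.sum_congr rfl fun u hu => ?_
        rw [vol_congr ξ η ζ (hX1 u hu)]
        simp [vol, hξ, hη, hζ]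
      rw [e1] at e
      simp only [vol, hw, hξ, hη, hζ] at e
      have e2 : ∀ a b : ZMod 2, a + b = 0 → b = a := by decide
      rw [e2 _ _ e]
      ring
    · intro u hu
      rw [Finset.mem_sdiff] at hu
      exact vol_eq_zero _ _ _ (hX2 u hu.1 hu.2)
  by_cases hcard : X.card ≤ 1
  · exact ⟨l, mem_plane_of_closed_of_card_le_one hp h4 hv ht h0 hh1 hX hX1 hX2 hcard⟩
  · have hcard' : (S.erase v \ X).card ≤ 1 := by
      by_contra hcon
      have := hp' X hX (by omega) (by omega)
      omega
    refine ⟨l + t, ?_⟩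
    have hh2 := hh.translate hc (l + t)
    refine mem_plane_of_closed_of_card_le_one hp h4 hv ht h0 hh2 (X := S.erase v \ X)
      Finset.sdiff_subset (fun u hu => ?_) (fun u hu hu' => ?_) hcard'
    · rw [Finset.mem_sdiff] at hu
      have : h u + (l + t) + t = h u + l := by
        rw [add_assoc, add_assoc, add_self_zmod_two, add_zero]
      rw [this]
      exact hX2 u hu.1 hu.2
    · rw [← add_assoc]
      exact hX1 u (by simpa [hu] using hu')

lemma IsClosedField.minor {v : V} (hv : v ∈ S) {t : L} (ht : t ∈ plane φ χ v) (h0 : t ≠ 0)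
    {h : V → L} (hh : IsClosedField S φ χ h) :
    IsClosedField (S.erase v) (modVec t ∘ φ) (modVec t ∘ χ) (modVec t ∘ h) := by
  intro ξ η ζ
  have e := hh (ξ ∘ₗ modVec t) (η ∘ₗ modVec t) (ζ ∘ₗ modVec t)
  have hz : ∀ ξ : Module.Dual (ZMod 2) (L ⧸ Submodule.span (ZMod 2) {t}),
      (ξ ∘ₗ modVec t) t = 0 := fun ξ => by rw [LinearMap.comp_apply, modVec_self, map_zero]
  rw [← Finset.add_sum_erase S _ hv] at e
  simp only [vol, wedge_eq_zero_of_mem ht h0 (hz _) (hz _), zero_mul, add_zero, zero_add] at e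
  exact e

end Uniqueness

section Five

variable {V : Type*} [DecidableEq V] {L : Type*} [AddCommGroup L] [Module (ZMod 2) L]
  {S : Finset V} {φ χ : V → L}

/-- The contraction of `φ u ∧ χ u` with a functional. -/
def tvec (φ χ : V → L) (g : Module.Dual (ZMod 2) L) (u : V) : L := g (φ u) • χ u + g (χ u) • φ u

lemma tvec_mem (g : Module.Dual (ZMod 2) L) (u : V) : tvec φ χ g u ∈ plane φ χ u :=
  Submodule.add_mem _ (Submodule.smul_mem _ _ (right_mem_plane u))
    (Submodule.smul_mem _ _ (left_mem_plane u))

lemma wedge_tvec (ξ g : Module.Dual (ZMod 2) L) (u : V) :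
    wedge φ χ ξ g u = ξ (tvec φ χ g u) := by
  simp only [tvec, wedge, map_add, map_smul, smul_eq_mul]; ring

lemma tvec_wedge (ξ g : Module.Dual (ZMod 2) L) (u : V) :
    wedge φ χ g ξ u = ξ (tvec φ χ g u) := by
  simp only [tvec, wedge, map_add, map_smul, smul_eq_mul]

lemma eq_zero_or_eq_tvec {g : Module.Dual (ZMod 2) L} {u : V} {x y : L} (hx : x ∈ plane φ χ u)
    (hgx : g x = 1) (hy : y ∈ plane φ χ u) (hgy : g y = 0) : y = 0 ∨ y = tvec φ χ g u := by
  unfold tvec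
  have e : ∀ a b : ZMod 2, a + b = 0 → a = b := by decide
  rcases mem_plane_iff.1 hy with rfl | rfl | rfl | rfl
  · left; rfl
  · right
    have : g (χ u) = 1 := by
      rcases mem_plane_iff.1 hx with rfl | rfl | rfl | rfl <;> simp_all
    simp [hgy, this]
  · right
    have : g (φ u) = 1 := by
      rcases mem_plane_iff.1 hx with rfl | rfl | rfl | rfl <;> simp_all
    simp [hgy, this]
  · right
    rw [map_add] at hgy
    have h1 := e _ _ hgy
    have : g (φ u) = 1 := by
      rcases mem_plane_iff.1 hx with rfl | rfl | rfl | rfl <;> simp_all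
    rw [← h1, this, one_smul, one_smul, add_comm]

variable [FiniteDimensional (ZMod 2) L]

lemma tvec_ne_zero (hp : IsPrimeConfig S φ χ) (h4 : 4 ≤ S.card) {g : Module.Dual (ZMod 2) L}
    {u : V} (hu : u ∈ S) {x : L} (hx : x ∈ plane φ χ u) (hgx : g x = 1) : tvec φ χ g u ≠ 0 := by
  have h1 := hp.left_ne_zero h4 hu
  have h2 := hp.right_ne_zero h4 hu
  have h3 := hp.left_ne_right h4 hu
  have h4 : φ u + χ u ≠ 0 := by
    rwa [← sub_eq_add_zmod_two, Ne, sub_eq_zero]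
  unfold tvec
  rcases zmod_two_cases (g (φ u)) with e1 | e1 <;> rcases zmod_two_cases (g (χ u)) with e2 | e2
  · exfalso
    rcases mem_plane_iff.1 hx with rfl | rfl | rfl | rfl <;> simp_all
  · simpa [e1, e2]
  · simpa [e1, e2]
  · simpa [e1, e2, add_comm]

/-- In a prime configuration of five planes, the functional vanishing on two of them. -/
lemma exists_five_frame (hc : IsConfig S φ χ) (hp : IsPrimeConfig S φ χ) (h5 : S.card = 5)
    {a b e : V} (ha : a ∈ S) (hb : b ∈ S) (he : e ∈ S) (hab : a ≠ b) (hea : e ≠ a) (heb : e ≠ b) :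
    ∃ c d, ∃ g : Module.Dual (ZMod 2) L, c ∈ S ∧ d ∈ S ∧ c ≠ a ∧ c ≠ b ∧ c ≠ e ∧ d ≠ a ∧ d ≠ b ∧
      d ≠ e ∧ (∀ f : V → ZMod 2, ∑ u ∈ S, f u = f a + f b + (f c + f d + f e)) ∧
      (∀ x, g x = 0 ↔ x ∈ plane φ χ a ⊔ plane φ χ b) ∧
      (∀ u ∈ S, u ≠ a → u ≠ b → ∃ y ∈ plane φ χ u, g y = 1) ∧
      tvec φ χ g c + tvec φ χ g d = tvec φ χ g e := by
  have hsub : ({a, b, e} : Finset V) ⊆ S := by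
    intro x hx; simp at hx; rcases hx with rfl | rfl | rfl <;> assumption
  have hcard3 : ({a, b, e} : Finset V).card = 3 := by
    rw [Finset.card_insert_of_notMem (by simp [hab, hea.symm]), Finset.card_pair heb.symm]
  obtain ⟨c, d, hcd, hcdS⟩ := Finset.card_eq_two.1
    (show (S \ {a, b, e}).card = 2 by rw [Finset.card_sdiff_of_subset hsub, hcard3, h5])
  have hcS : c ∈ S \ {a, b, e} := by rw [hcdS]; simp
  have hdS : d ∈ S \ {a, b, e} := by rw [hcdS]; simp
  simp only [Finset.mem_sdiff, Finset.mem_insert, Finset.mem_singleton, not_or] at hcS hdS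
  have hM : Module.finrank (ZMod 2) ↥(plane φ χ a ⊔ plane φ χ b) = 4 := by
    have h1 := hp.two_le_conn_pair (by omega) ha hb hab
    have h2 := conn_pair_le (φ := φ) (χ := χ) hab
    rw [conn, planes_pair, Finset.card_pair hab] at h1 h2
    omega
  have hL : Module.finrank (ZMod 2) L = 5 := by rw [hc.finrank_eq, h5]
  obtain ⟨x₀, hx₀⟩ : ∃ x, x ∉ plane φ χ a ⊔ plane φ χ b := by
    by_contra hcon
    push Not at hcon
    rw [(Submodule.eq_top_iff').2 hcon, finrank_top] at hM
    omega
  obtain ⟨g, hg, hgx⟩ := exists_dual_eq_one hx₀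
  have hker : plane φ χ a ⊔ plane φ χ b = LinearMap.ker g := by
    apply Submodule.eq_of_le_of_finrank_eq (fun x hx => hg x hx)
    have h1 := LinearMap.finrank_range_add_finrank_ker g
    have h2 : LinearMap.range g = ⊤ := LinearMap.range_eq_top.2 fun z => ⟨z • x₀, by simp [hgx]⟩
    rw [h2, finrank_top, Module.finrank_self] at h1
    omega
  have hga : ∀ x ∈ plane φ χ a, g x = 0 := fun x hx => hg x (Submodule.mem_sup_left hx)
  have hgb : ∀ x ∈ plane φ χ b, g x = 0 := fun x hx => hg x (Submodule.mem_sup_right hx)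
  have hsum : ∀ f : V → ZMod 2, ∑ u ∈ S, f u = f a + f b + (f c + f d + f e) := fun f => by
    rw [← Finset.sum_sdiff hsub, hcdS, Finset.sum_pair hcd,
      Finset.sum_insert (by simp [hab, hea.symm]), Finset.sum_pair heb.symm]
    abel
  have hsumL : ∀ f : V → L, ∑ u ∈ S, f u = f a + f b + (f c + f d + f e) := fun f => by
    rw [← Finset.sum_sdiff hsub, hcdS, Finset.sum_pair hcd,
      Finset.sum_insert (by simp [hab, hea.symm]), Finset.sum_pair heb.symm]
    abel
  refine ⟨c, d, g, hcS.1, hdS.1, hcS.2.1, hcS.2.2.1, hcS.2.2.2, hdS.2.1, hdS.2.2.1, hdS.2.2.2,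
    hsum, fun x => by rw [hker, LinearMap.mem_ker], ?_, ?_⟩
  · intro u hu hua hub
    by_contra hcon
    push Not at hcon
    have hgu : ∀ x ∈ plane φ χ u, g x = 0 := fun x hx =>
      (zmod_two_cases _).resolve_right (hcon x hx)
    have hsub' : ({u, a, b} : Finset V) ⊆ S := by
      intro x hx; simp at hx; rcases hx with rfl | rfl | rfl <;> assumption
    have hcard' : ({u, a, b} : Finset V).card = 3 := by
      rw [Finset.card_insert_of_notMem (by simp [hua, hub]), Finset.card_pair hab]
    have h1 := hp _ hsub' (by omega) (by rw [Finset.card_sdiff_of_subset hsub', hcard']; omega)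
    rw [conn, planes_insert, planes_pair, hcard'] at h1
    have h2 : plane φ χ u ⊔ (plane φ χ a ⊔ plane φ χ b) ≤ plane φ χ a ⊔ plane φ χ b := by
      refine sup_le (fun x hx => ?_) le_rfl
      rw [hker]
      exact hgu x hx
    have := Submodule.finrank_mono h2
    omega
  · have h1 := hc.isotropic g
    rw [hsumL] at h1
    simp only [hga _ (left_mem_plane a), hga _ (right_mem_plane a), hgb _ (left_mem_plane b),
      hgb _ (right_mem_plane b), zero_smul, add_zero, zero_add] at h1
    change tvec φ χ g c + tvec φ χ g d + tvec φ χ g e = 0 at h1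
    rwa [← sub_eq_add_zmod_two, sub_eq_zero] at h1

lemma tvec_eq_zero {g : Module.Dual (ZMod 2) L} {u : V} (h : ∀ x ∈ plane φ χ u, g x = 0) :
    tvec φ χ g u = 0 := by
  rw [tvec, h _ (left_mem_plane u), h _ (right_mem_plane u), zero_smul, zero_smul, add_zero]

lemma exists_rep {g : Module.Dual (ZMod 2) L} {u : V} (h : ∃ y ∈ plane φ χ u, g y = 1) (x : L) :
    ∃ z, x + z ∈ plane φ χ u ∧ g z = 0 := by
  obtain ⟨y, hy, hgy⟩ := h
  rcases zmod_two_cases (g x) with h0 | h1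
  · exact ⟨x, by rw [add_self_zmod_two]; exact Submodule.zero_mem _, h0⟩
  · refine ⟨x + y, ?_, ?_⟩
    · rwa [← add_assoc, add_self_zmod_two, zero_add]
    · rw [map_add, h1, hgy]; rfl

lemma vol_of_apply_eq_zero {ξ η g : Module.Dual (ZMod 2) L} {u : V} {x z : L}
    (hz : x + z ∈ plane φ χ u) (hg : g z = 0) :
    vol φ χ ξ η g u x = η (tvec φ χ g u) * ξ z + ξ (tvec φ χ g u) * η z := by
  rw [vol_congr ξ η g hz, vol, hg, wedge_tvec η g, tvec_wedge ξ g, mul_zero, zero_add]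

lemma wedge_ne_zero_of_five (hp : IsPrimeConfig S φ χ) (h4 : 4 ≤ S.card)
    {b : V} (hb : b ∈ S) {s t : L} (hs : ∀ x ∈ plane φ χ b, x = s → x = 0)
    (ht : ∀ x ∈ plane φ χ b, x = t → x = 0) (hst : ∀ x ∈ plane φ χ b, x = s + t → x = 0) :
    ∃ ξ η : Module.Dual (ZMod 2) L, ξ s = 0 ∧ ξ t = 0 ∧ η s = 0 ∧ η t = 0 ∧
      wedge φ χ ξ η b = 1 := by
  have key : ∀ x ∈ plane φ χ b,
      x ∈ Submodule.span (ZMod 2) {s} ⊔ Submodule.span (ZMod 2) {t} → x = 0 := by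
    intro x hx h'
    rw [mem_sup_span_singleton, Submodule.mem_span_singleton, Submodule.mem_span_singleton] at h'
    rcases h' with ⟨a, h'⟩ | ⟨a, h'⟩ <;> rcases zmod_two_cases a with rfl | rfl
    · rw [← h', zero_smul]
    · rw [one_smul] at h'; exact hs x hx h'.symm
    · rw [zero_smul, ← sub_eq_add_zmod_two, eq_comm, sub_eq_zero] at h'; exact ht x hx h'
    · rw [one_smul] at h'
      refine hst x hx ?_
      rw [h', add_assoc, add_self_zmod_two, add_zero]
  have n1 : φ b ∉ (Submodule.span (ZMod 2) {s} ⊔ Submodule.span (ZMod 2) {t}) ⊔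
      Submodule.span (ZMod 2) {χ b} := by
    rw [mem_sup_span_singleton]
    rintro (h' | h')
    · exact hp.left_ne_zero h4 hb (key _ (left_mem_plane b) h')
    · refine hp.left_ne_right h4 hb ?_
      have := key _ (Submodule.add_mem _ (left_mem_plane b) (right_mem_plane b)) h'
      rwa [← sub_eq_add_zmod_two, sub_eq_zero] at this
  have n2 : χ b ∉ Submodule.span (ZMod 2) {s} ⊔ Submodule.span (ZMod 2) {t} := fun h' =>
    hp.right_ne_zero h4 hb (key _ (right_mem_plane b) h')
  obtain ⟨ξ, hξ, hξ'⟩ := exists_dual_eq_one n1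
  obtain ⟨η, hη, hη'⟩ := exists_dual_eq_one n2
  have ms : s ∈ Submodule.span (ZMod 2) {s} ⊔ Submodule.span (ZMod 2) {t} :=
    Submodule.mem_sup_left (Submodule.mem_span_singleton_self _)
  have mt : t ∈ Submodule.span (ZMod 2) {s} ⊔ Submodule.span (ZMod 2) {t} :=
    Submodule.mem_sup_right (Submodule.mem_span_singleton_self _)
  refine ⟨ξ, η, hξ _ (Submodule.mem_sup_left ms), hξ _ (Submodule.mem_sup_left mt), hη _ ms,
    hη _ mt, ?_⟩
  rw [wedge, hξ', hη', hξ _ (Submodule.mem_sup_right (Submodule.mem_span_singleton_self _))]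
  simp

lemma add_mem_of_closed_five (hc : IsConfig S φ χ) (hp : IsPrimeConfig S φ χ) (h5 : S.card = 5)
    {h : V → L} (hh : IsClosedField S φ χ h) {a b : V} (ha : a ∈ S) (hb : b ∈ S) (hab : a ≠ b) :
    h a + h b ∈ plane φ χ a ⊔ plane φ χ b := by
  have h4 : 4 ≤ S.card := by omega
  obtain ⟨e, he⟩ : (S \ {a, b}).Nonempty := by
    rw [← Finset.card_pos, Finset.card_sdiff_of_subset (by
      intro x hx; simp at hx; rcases hx with rfl | rfl <;> assumption), Finset.card_pair hab]
    omega
  simp only [Finset.mem_sdiff, Finset.mem_insert, Finset.mem_singleton, not_or] at he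
  obtain ⟨he, hea, heb⟩ := he
  obtain ⟨c, d, g, hcS, hdS, hca, hcb, hce, hda, hdb, hde, hsum, hg, hy, ht⟩ :=
    exists_five_frame hc hp h5 ha hb he hab hea heb
  have hga : ∀ x ∈ plane φ χ a, g x = 0 := fun x hx => (hg x).2 (Submodule.mem_sup_left hx)
  have hgb : ∀ x ∈ plane φ χ b, g x = 0 := fun x hx => (hg x).2 (Submodule.mem_sup_right hx)
  obtain ⟨zc, hzc, hgc⟩ := exists_rep (hy c hcS hca hcb) (h c)
  obtain ⟨zd, hzd, hgd⟩ := exists_rep (hy d hdS hda hdb) (h d)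
  obtain ⟨ze, hze, hge⟩ := exists_rep (hy e he hea heb) (h e)
  have key : ∀ ξ η : Module.Dual (ZMod 2) L, ξ (tvec φ χ g c) = 0 → ξ (tvec φ χ g d) = 0 →
      η (tvec φ χ g c) = 0 → η (tvec φ χ g d) = 0 →
      wedge φ χ ξ η a * g (h a) + wedge φ χ ξ η b * g (h b) = 0 := by
    intro ξ η h1 h2 h3 h4
    have h5 : ξ (tvec φ χ g e) = 0 := by rw [← ht, map_add, h1, h2, add_zero]
    have h6 : η (tvec φ χ g e) = 0 := by rw [← ht, map_add, h3, h4, add_zero]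
    have e := hh ξ η g
    rw [hsum, vol_of_apply_eq_zero hzc hgc, vol_of_apply_eq_zero hzd hgd,
      vol_of_apply_eq_zero hze hge, h1, h2, h3, h4, h5, h6, vol, vol, wedge_tvec η g,
      tvec_wedge ξ g, wedge_tvec η g, tvec_wedge ξ g, tvec_eq_zero hga, tvec_eq_zero hgb] at e
    simpa using e
  have hdis : ∀ w ∈ S, w = a ∨ w = b → ∃ ξ η : Module.Dual (ZMod 2) L,
      ξ (tvec φ χ g c) = 0 ∧ ξ (tvec φ χ g d) = 0 ∧ η (tvec φ χ g c) = 0 ∧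
        η (tvec φ χ g d) = 0 ∧ wedge φ χ ξ η w = 1 := by
    intro w hw hwab
    have hwc : w ≠ c := by rintro rfl; tauto
    have hwd : w ≠ d := by rintro rfl; tauto
    have hwe : w ≠ e := by rintro rfl; tauto
    apply wedge_ne_zero_of_five hp h4 hw
    · rintro x hx rfl
      exact hp.disjoint_plane h4 hw hcS hwc hx (tvec_mem _ _)
    · rintro x hx rfl
      exact hp.disjoint_plane h4 hw hdS hwd hx (tvec_mem _ _)
    · rintro x hx rfl
      rw [ht] at hx ⊢
      exact hp.disjoint_plane h4 hw he hwe hx (tvec_mem _ _)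
  rw [← hg, map_add]
  rcases zmod_two_cases (g (h a)) with ea | ea <;> rcases zmod_two_cases (g (h b)) with eb | eb
  · rw [ea, eb, add_zero]
  · obtain ⟨ξ, η, k1, k2, k3, k4, k5⟩ := hdis b hb (Or.inr rfl)
    have := key ξ η k1 k2 k3 k4
    rw [ea, eb, k5] at this
    simp at this
  · obtain ⟨ξ, η, k1, k2, k3, k4, k5⟩ := hdis a ha (Or.inl rfl)
    have := key ξ η k1 k2 k3 k4
    rw [ea, eb, k5] at this
    simp at this
  · rw [ea, eb]; rfl

lemma mem_plane_of_closed_five (hc : IsConfig S φ χ) (hp : IsPrimeConfig S φ χ) (h5 : S.card = 5)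
    {h : V → L} (hh : IsClosedField S φ χ h) {a b e : V} (ha : a ∈ S) (hb : b ∈ S) (he : e ∈ S)
    (hab : a ≠ b) (hea : e ≠ a) (heb : e ≠ b) (h1 : h a ∈ plane φ χ a) (h2 : h b ∈ plane φ χ b) :
    h e ∈ plane φ χ e := by
  have h4 : 4 ≤ S.card := by omega
  obtain ⟨c, d, g, hcS, hdS, hca, hcb, hce, hda, hdb, hde, hsum, hg, hy, ht⟩ :=
    exists_five_frame hc hp h5 ha hb he hab hea heb
  have hga : ∀ x ∈ plane φ χ a, g x = 0 := fun x hx => (hg x).2 (Submodule.mem_sup_left hx)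
  have hgb : ∀ x ∈ plane φ χ b, g x = 0 := fun x hx => (hg x).2 (Submodule.mem_sup_right hx)
  -- a representative modulo its plane, lying in the plane of `w` up to a multiple of `tvec`
  have hrep : ∀ u ∈ S, u ≠ a → u ≠ b → ∀ w ∈ S, w ≠ u → h w ∈ plane φ χ w →
      (∀ x ∈ plane φ χ w, g x = 0) →
      ∀ z, h u + z ∈ plane φ χ u → g z = 0 →
        z ∈ plane φ χ w ∨ z + tvec φ χ g u ∈ plane φ χ w := by
    intro u hu hua hub w hw hwu hhw hgw z hz hgz
    obtain ⟨x, hx, y, hy', hxy⟩ := Submodule.mem_sup.1 (add_mem_of_closed_five hc hp h5 hh hw hu hwu)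
    set y' := y + (h u + z) with hydef
    have hy'' : y' ∈ plane φ χ u := Submodule.add_mem _ hy' hz
    have hzeq : z = (x + h w) + y' := by
      have e1 : (x + h w) + y' = (x + y) + h w + h u + z := by rw [hydef]; abel
      rw [e1, hxy]
      have e2 : h w + h u + h w + h u + z = (h w + h w) + (h u + h u) + z := by abel
      rw [e2, add_self_zmod_two, add_self_zmod_two, zero_add, zero_add]
    have hxw : x + h w ∈ plane φ χ w := Submodule.add_mem _ hx hhw
    have hgy' : g y' = 0 := by
      rw [hzeq, map_add, hgw _ hxw, zero_add] at hgz
      exact hgz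
    obtain ⟨yu, hyu, hgyu⟩ := hy u hu hua hub
    rcases eq_zero_or_eq_tvec hyu hgyu hy'' hgy' with e | e
    · left; rw [hzeq, e, add_zero]; exact hxw
    · right; rw [hzeq, e, add_assoc, add_self_zmod_two, add_zero]; exact hxw
  obtain ⟨zc, hzc, hgc⟩ := exists_rep (hy c hcS hca hcb) (h c)
  obtain ⟨zd, hzd, hgd⟩ := exists_rep (hy d hdS hda hdb) (h d)
  obtain ⟨ze, hze, hge⟩ := exists_rep (hy e he hea heb) (h e)
  have tne : ∀ u ∈ S, u ≠ a → u ≠ b → ∀ w ∈ S, u ≠ w → tvec φ χ g u ∉ plane φ χ w := by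
    intro u hu hua hub w hw huw hmem
    obtain ⟨y, hy', hgy⟩ := hy u hu hua hub
    exact tvec_ne_zero hp h4 hu hy' hgy (hp.disjoint_plane h4 hu hw huw (tvec_mem _ _) hmem)
  obtain ⟨ξ, hξ, hξc⟩ := exists_dual_eq_one
    (P := plane φ χ b ⊔ Submodule.span (ZMod 2) {tvec φ χ g d}) (x := tvec φ χ g c) (by
      rw [mem_sup_span_singleton, not_or, ht]
      exact ⟨tne c hcS hca hcb b hb hcb, tne e he hea heb b hb heb⟩)
  obtain ⟨η, hη, hηd⟩ := exists_dual_eq_one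
    (P := plane φ χ a ⊔ Submodule.span (ZMod 2) {tvec φ χ g c}) (x := tvec φ χ g d) (by
      rw [mem_sup_span_singleton, not_or, add_comm, ht]
      exact ⟨tne d hdS hda hdb a ha hda, tne e he hea heb a ha hea⟩)
  have hξd : ξ (tvec φ χ g d) = 0 :=
    hξ _ (Submodule.mem_sup_right (Submodule.mem_span_singleton_self _))
  have hηc : η (tvec φ χ g c) = 0 :=
    hη _ (Submodule.mem_sup_right (Submodule.mem_span_singleton_self _))
  have hξb : ∀ x ∈ plane φ χ b, ξ x = 0 := fun x hx => hξ x (Submodule.mem_sup_left hx)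
  have hηa : ∀ x ∈ plane φ χ a, η x = 0 := fun x hx => hη x (Submodule.mem_sup_left hx)
  have hξe : ξ (tvec φ χ g e) = 1 := by rw [← ht, map_add, hξc, hξd, add_zero]
  have hηe : η (tvec φ χ g e) = 1 := by rw [← ht, map_add, hηc, hηd, zero_add]
  have zc0 : η zc = 0 := by
    rcases hrep c hcS hca hcb a ha hca.symm h1 hga zc hzc hgc with k | k
    · exact hηa _ k
    · have := hηa _ k
      rwa [map_add, hηc, add_zero] at this
  have zd0 : ξ zd = 0 := by
    rcases hrep d hdS hda hdb b hb hdb.symm h2 hgb zd hzd hgd with k | k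
    · exact hξb _ k
    · have := hξb _ k
      rwa [map_add, hξd, add_zero] at this
  have eq := hh ξ η g
  rw [hsum, vol_eq_zero _ _ _ h1, vol_eq_zero _ _ _ h2, vol_of_apply_eq_zero hzc hgc,
    vol_of_apply_eq_zero hzd hgd, vol_of_apply_eq_zero hze hge, hξe, hηe, hξc, hξd, hηc, hηd,
    zc0, zd0] at eq
  simp only [zero_mul, mul_zero, add_zero, zero_add, one_mul] at eq
  have done : ∀ x ∈ plane φ χ e, ze + x ∈ plane φ χ a → ze + x ∈ plane φ χ b →
      h e ∈ plane φ χ e := by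
    intro x hx k1 k2
    have k := hp.disjoint_plane h4 ha hb hab k1 k2
    have : h e = (h e + ze) + x := by
      rw [add_assoc, k, add_zero]
    rw [this]
    exact Submodule.add_mem _ hze hx
  rcases hrep e he hea heb a ha hea.symm h1 hga ze hze hge with ka | ka <;>
    rcases hrep e he hea heb b hb heb.symm h2 hgb ze hze hge with kb | kb
  · exact done 0 (Submodule.zero_mem _) (by rwa [add_zero]) (by rwa [add_zero])
  · exfalso
    have j1 := hηa _ ka
    have j2 := hξb _ kb
    rw [map_add, hξe] at j2
    rw [j1, add_zero] at eq
    rw [eq] at j2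
    simp at j2
  · exfalso
    have j1 := hηa _ ka
    have j2 := hξb _ kb
    rw [map_add, hηe] at j1
    rw [j2, zero_add] at eq
    rw [eq] at j1
    simp at j1
  · exact done _ (tvec_mem _ _) ka kb

end Five

section Uniqueness

/-- Closed fields on a prime configuration of at least five planes are constant modulo the
planes. -/
theorem IsClosedField.exists_translate {V : Type*} [DecidableEq V] (n : ℕ) :
    ∀ {L : Type*} [AddCommGroup L] [Module (ZMod 2) L] [FiniteDimensional (ZMod 2) L]
      {S : Finset V} {φ χ : V → L}, IsConfig S φ χ → IsPrimeConfig S φ χ → S.card = n + 5 →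
      ∀ {h : V → L}, IsClosedField S φ χ h → ∃ l, ∀ u ∈ S, h u + l ∈ plane φ χ u := by
  induction n with
  | zero =>
    intro L _ _ _ S φ χ hc hp h5 h hh
    obtain ⟨a, ha, b, hb, hab⟩ := Finset.one_lt_card.1 (by omega : 1 < S.card)
    obtain ⟨x, hx, y, hy, hxy⟩ :=
      Submodule.mem_sup.1 (add_mem_of_closed_five hc hp (by omega) hh ha hb hab)
    refine ⟨h a + x, ?_⟩
    have hh' := hh.translate hc (h a + x)
    have k1 : h a + (h a + x) ∈ plane φ χ a := by
      rwa [← add_assoc, add_self_zmod_two, zero_add]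
    have k2 : h b + (h a + x) ∈ plane φ χ b := by
      have : h b + (h a + x) = y := by
        have : h b + (h a + x) = (h a + h b) + x := by abel
        rw [this, ← hxy, add_comm x y, add_assoc, add_self_zmod_two, add_zero]
      rwa [this]
    intro u hu
    by_cases hua : u = a
    · rw [hua]; exact k1
    by_cases hub : u = b
    · rw [hub]; exact k2
    exact mem_plane_of_closed_five hc hp (by omega) hh' ha hb hu hab hua hub k1 k2
  | succ n ih =>
    intro L _ _ _ S φ χ hc hp hn h hh
    obtain ⟨v, hv, t, ht, h0, hp'⟩ := exists_prime_minor hc hp (by omega)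
    refine exists_translate_of_minor hc hp (by omega) hv ht h0 hp' hh ?_
    exact ih (hc.minor hv h0 ht) hp' (by rw [Finset.card_erase_of_mem hv]; omega)
      (hh.minor hv ht h0)

end Uniqueness

section PlaneSum

variable {V : Type*} [DecidableEq V] {L : Type*} [AddCommGroup L] [Module (ZMod 2) L]
  {S : Finset V} {φ χ p : V → L}

lemma planeSum_add (f g : L → ZMod 2) :
    planeSum S φ χ p (fun x => f x + g x) = planeSum S φ χ p f + planeSum S φ χ p g := by
  unfold planeSum
  rw [← Finset.sum_add_distrib]
  exact Finset.sum_congr rfl fun u _ => by ring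

lemma planeSum_mul_left (a : ZMod 2) (f : L → ZMod 2) :
    planeSum S φ χ p (fun x => a * f x) = a * planeSum S φ χ p f := by
  unfold planeSum
  rw [Finset.mul_sum]
  exact Finset.sum_congr rfl fun u _ => by ring

lemma planeSum_zero : planeSum S φ χ p (fun _ => 0) = 0 := by
  simp [planeSum]

lemma planeSum_sum {ι : Type*} (I : Finset ι) (f : ι → L → ZMod 2) :
    planeSum S φ χ p (fun x => ∑ i ∈ I, f i x) = ∑ i ∈ I, planeSum S φ χ p (f i) := by
  classical
  induction I using Finset.induction_on with
  | empty => simp [planeSum_zero]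
  | insert i I hi ih =>
    simp only [Finset.sum_insert hi]
    rw [planeSum_add, ih]

lemma planeSum_map {M : Type*} [AddCommGroup M] [Module (ZMod 2) M] (g : L →ₗ[ZMod 2] M)
    (f : M → ZMod 2) : planeSum S (g ∘ φ) (g ∘ χ) (g ∘ p) f = planeSum S φ χ p (f ∘ g) := by
  simp [planeSum]

/-- The subspace of periods of a function. -/
def periods (f : L → ZMod 2) : Submodule (ZMod 2) L where
  carrier := {s | ∀ x, f (x + s) = f x}
  add_mem' := fun {a b} ha hb x => by rw [← add_assoc, hb, ha]
  zero_mem' := fun x => by rw [add_zero]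
  smul_mem' := fun a s hs x => by
    rcases zmod_two_cases a with rfl | rfl
    · rw [zero_smul, add_zero]
    · rw [one_smul]; exact hs x

lemma corner_sum_eq_zero {f : L → ZMod 2} {v : V} {t : L} (ht : t ∈ plane φ χ v) (h0 : t ≠ 0)
    (hf : t ∈ periods f) :
    f (p v) + f (p v + φ v) + f (p v + χ v) + f (p v + φ v + χ v) = 0 := by
  have e : ∀ a b : ZMod 2, a + a + b + b = 0 ∧ a + b + a + b = 0 ∧ a + b + b + a = 0 := by decide
  have hf' : ∀ x, f (x + t) = f x := hf
  rcases mem_plane_iff.1 ht with rfl | rfl | rfl | rfl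
  · exact absurd rfl h0
  · rw [hf', add_right_comm (p v) (φ v) (χ v), hf']; exact (e _ _).1
  · rw [hf', hf']; exact (e _ _).2.1
  · have h1 : f (p v + χ v) = f (p v + φ v) := by
      rw [← hf' (p v + χ v)]
      congr 1
      rw [add_assoc, add_left_comm (χ v), add_self_zmod_two, add_zero]
    rw [h1, add_assoc (p v), hf']; exact (e _ _).2.2

lemma planeSum_erase {f : L → ZMod 2} {v : V} (hv : v ∈ S) {t : L} (ht : t ∈ plane φ χ v)
    (h0 : t ≠ 0) (hf : t ∈ periods f) :
    planeSum (S.erase v) φ χ p f = planeSum S φ χ p f := by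
  unfold planeSum
  rw [← Finset.add_sum_erase S _ hv, corner_sum_eq_zero ht h0 hf, zero_add]

lemma planeSum_minor [FiniteDimensional (ZMod 2) L] {v : V} (hv : v ∈ S) {t : L} (ht : t ∈ plane φ χ v) (h0 : t ≠ 0)
    (f : (L ⧸ Submodule.span (ZMod 2) {t}) → ZMod 2) :
    planeSum (S.erase v) (modVec t ∘ φ) (modVec t ∘ χ) (modVec t ∘ p) f =
      planeSum S φ χ p (f ∘ modVec t) := by
  rw [planeSum_map, planeSum_erase hv ht h0]
  intro x
  rw [Function.comp_apply, Function.comp_apply, map_add, modVec_self, add_zero]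

/-- The functional kills all products of three affine functions. -/
def KillsCubics (S : Finset V) (φ χ p : V → L) : Prop :=
  ∀ (ξ η ζ : Module.Dual (ZMod 2) L) (a b c : ZMod 2),
    planeSum S φ χ p (fun x => (ξ x + a) * (η x + b) * (ζ x + c)) = 0

lemma KillsCubics.minor [FiniteDimensional (ZMod 2) L] (h : KillsCubics S φ χ p) {v : V} (hv : v ∈ S) {t : L}
    (ht : t ∈ plane φ χ v) (h0 : t ≠ 0) :
    KillsCubics (S.erase v) (modVec t ∘ φ) (modVec t ∘ χ) (modVec t ∘ p) := by
  intro ξ η ζ a b c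
  rw [planeSum_minor hv ht h0]
  exact h (ξ ∘ₗ modVec t) (η ∘ₗ modVec t) (ζ ∘ₗ modVec t) a b c

/-- The corners of the affine planes `p u + ⟨φ u, χ u⟩`. -/
def corner (φ χ p : V → L) (x : V × ZMod 2 × ZMod 2) : L := p x.1 + x.2.1 • φ x.1 + x.2.2 • χ x.1

lemma exists_corner_of_planeSum_ne_zero [DecidableEq L] {y : L}
    (h : planeSum S φ χ p (fun x => if x = y then 1 else 0) ≠ 0) :
    ∃ x : S × ZMod 2 × ZMod 2, corner φ χ p (x.1, x.2) = y := by
  by_contra hcon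
  push Not at hcon
  apply h
  refine Finset.sum_eq_zero fun u hu => ?_
  have h1 := hcon (⟨u, hu⟩, 0, 0)
  have h2 := hcon (⟨u, hu⟩, 1, 0)
  have h3 := hcon (⟨u, hu⟩, 0, 1)
  have h4 := hcon (⟨u, hu⟩, 1, 1)
  simp only [corner, zero_smul, one_smul, add_zero] at h1 h2 h3 h4
  simp only [if_neg h1, if_neg h2, if_neg h3, if_neg h4, add_zero]

lemma corner_surjective [DecidableEq L]
    (h : ∀ y, planeSum S φ χ p (fun x => if x = y then 1 else 0) ≠ 0) :
    Function.Surjective fun x : S × ZMod 2 × ZMod 2 => corner φ χ p (x.1, x.2) :=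
  fun y => exists_corner_of_planeSum_ne_zero (h y)

lemma card_corner (S : Finset V) : Fintype.card (S × ZMod 2 × ZMod 2) = 4 * S.card := by
  rw [Fintype.card_prod, Fintype.card_prod, Fintype.card_coe, ZMod.card]
  ring

/-- A point indicator splits off: moving the point along a line changes the functional by a
product of three affine functions, in dimension four. -/
lemma exists_three_dual [FiniteDimensional (ZMod 2) L] (h4 : Module.finrank (ZMod 2) L = 4)
    {w : L} (hw : w ≠ 0) :
    ∃ ξ η ζ : Module.Dual (ZMod 2) L, ∀ x, (ξ x = 0 ∧ η x = 0 ∧ ζ x = 0) ↔ (x = 0 ∨ x = w) := by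
  have h3 : Module.finrank (ZMod 2) (L ⧸ Submodule.span (ZMod 2) {w}) = 3 := by
    have h := Submodule.finrank_quotient_add_finrank (Submodule.span (ZMod 2) {w})
    rw [finrank_span_singleton hw] at h
    omega
  let B := Module.finBasisOfFinrankEq (ZMod 2) _ h3
  refine ⟨B.coord 0 ∘ₗ modVec w, B.coord 1 ∘ₗ modVec w, B.coord 2 ∘ₗ modVec w, fun x => ?_⟩
  rw [← modVec_eq_zero_iff]
  constructor
  · rintro ⟨h0, h1, h2⟩
    apply B.ext_elem
    intro i
    rw [map_zero]
    fin_cases i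
    · exact h0
    · exact h1
    · exact h2
  · intro h
    simp only [LinearMap.comp_apply, h, map_zero, and_self]

lemma planeSum_eq_zero_of_card_four [FiniteDimensional (ZMod 2) L] (hc : IsConfig S φ χ)
    (h4 : S.card = 4) {a c : V}
    (ha : a ∈ S) (hcS : c ∈ S) (hac : a ≠ c) (hconn : 2 ≤ conn φ χ {a, c})
    (hk : KillsCubics S φ χ p) (f : L → ZMod 2) : planeSum S φ χ p f = 0 := by
  classical
  have : Finite L := Module.finite_of_finite (ZMod 2)
  have : Fintype L := Fintype.ofFinite L
  have hL : Module.finrank (ZMod 2) L = 4 := by rw [hc.finrank_eq, h4]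
  by_contra hf
  have hfsum : f = fun x => ∑ y : L, f y * (if x = y then 1 else 0) := by
    funext x; simp
  obtain ⟨y, hy⟩ : ∃ y, planeSum S φ χ p (fun x => if x = y then 1 else 0) ≠ 0 := by
    by_contra hcon
    push Not at hcon
    apply hf
    rw [hfsum, planeSum_sum]
    exact Finset.sum_eq_zero fun y _ => by rw [planeSum_mul_left, hcon, mul_zero]
  have hall : ∀ z, planeSum S φ χ p (fun x => if x = z then 1 else 0) ≠ 0 := by
    intro z
    by_cases hz : z = y
    · rw [hz]; exact hy
    have hw : y + z ≠ 0 := by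
      rw [← sub_eq_add_zmod_two, Ne, sub_eq_zero]; exact fun h => hz h.symm
    obtain ⟨ξ, η, ζ, hx⟩ := exists_three_dual hL hw
    have h := hk ξ η ζ (ξ y + 1) (η y + 1) (ζ y + 1)
    have hfun : (fun x => (ξ x + (ξ y + 1)) * (η x + (η y + 1)) * (ζ x + (ζ y + 1))) =
        fun x => (if x = y then 1 else 0) + (if x = z then (1 : ZMod 2) else 0) := by
      funext x
      have hx' := hx (x + y)
      have e1 : x + y = 0 ↔ x = y := by rw [← sub_eq_add_zmod_two, sub_eq_zero]
      have e2 : x + y = y + z ↔ x = z := by rw [add_comm x y]; exact add_right_inj y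
      rw [e1, e2, map_add, map_add, map_add] at hx'
      have e3 : ∀ A B C : ZMod 2, (A + 1) * (B + 1) * (C + 1) =
        if A = 0 ∧ B = 0 ∧ C = 0 then 1 else 0 := by decide
      rw [← add_assoc, ← add_assoc, ← add_assoc, e3, if_congr hx' rfl rfl]
      by_cases h1 : x = y
      · have h2 : x ≠ z := fun h => hz (h.symm.trans h1)
        rw [if_pos (Or.inl h1), if_pos h1, if_neg h2, add_zero]
      · by_cases h2 : x = z
        · rw [if_pos (Or.inr h2), if_pos h2, if_neg h1, zero_add]
        · rw [if_neg (by tauto), if_neg h1, if_neg h2, add_zero]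
    rw [hfun, planeSum_add] at h
    intro h'
    rw [h', add_zero] at h
    exact hy h
  have hsurj := corner_surjective hall
  have hbij := (Fintype.bijective_iff_surjective_and_card _).2 ⟨hsurj, by
    rw [card_corner, h4, Module.card_eq_pow_finrank (K := ZMod 2), hL, ZMod.card]; norm_num⟩
  have htop : plane φ χ a ⊔ plane φ χ c = ⊤ := by
    apply Submodule.eq_top_of_finrank_eq
    rw [conn, planes_pair, Finset.card_pair hac] at hconn
    have := Submodule.finrank_le (plane φ χ a ⊔ plane φ χ c)
    omega
  obtain ⟨x, hx, y, hy, hxy⟩ := Submodule.mem_sup.1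
    (show p a + p c ∈ plane φ χ a ⊔ plane φ χ c by rw [htop]; trivial)
  have hcorner : ∀ (u : S) (x : L), x ∈ plane φ χ u → ∃ i j, corner φ χ p (u, i, j) = p u + x := by
    intro u x hx
    obtain ⟨i, j, rfl⟩ := Submodule.mem_span_pair.1 hx
    exact ⟨i, j, by rw [corner, add_assoc]⟩
  obtain ⟨i, j, h1⟩ := hcorner ⟨a, ha⟩ x hx
  obtain ⟨i', j', h2⟩ := hcorner ⟨c, hcS⟩ y hy
  have heq : p a + x = p c + y := by
    rw [← sub_eq_zero, sub_eq_add_zmod_two]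
    have : p a + x + (p c + y) = (p a + p c) + (x + y) := by abel
    rw [this, hxy, add_self_zmod_two]
  have := hbij.1 (a₁ := (⟨a, ha⟩, i, j)) (a₂ := (⟨c, hcS⟩, i', j')) (by
    change corner φ χ p _ = corner φ χ p _
    rw [h1, h2]; exact heq)
  exact hac (congrArg (fun z => (z.1 : V)) this)

end PlaneSum

section Linking

/-- `t` lies outside `R` and some function with periods `R` and `t` is not killed. -/
def Detects {V L : Type*} [AddCommGroup L] [Module (ZMod 2) L] (S : Finset V) (φ χ p : V → L)
    (R : Submodule (ZMod 2) L) (t : L) : Prop :=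
  t ∉ R ∧ ∃ f, R ≤ periods f ∧ t ∈ periods f ∧ planeSum S φ χ p f ≠ 0

lemma detects_or {V L : Type*} [AddCommGroup L] [Module (ZMod 2) L] {S : Finset V} {φ χ p : V → L}
    {R : Submodule (ZMod 2) L} {t : L} (h : Detects S φ χ p R t) (s : L) :
    Detects S φ χ p R s ∨ Detects S φ χ p R (t + s) := by
  classical
  obtain ⟨ht, f, hR, htf, hD⟩ := h
  by_cases hs : s ∈ R
  · right
    refine ⟨fun h => ht ?_, f, hR, (periods f).add_mem htf (hR hs), hD⟩
    have := R.add_mem h hs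
    rwa [add_assoc, add_self_zmod_two, add_zero] at this
  by_cases hts : t + s ∈ R
  · left
    refine ⟨hs, f, hR, ?_, hD⟩
    have := (periods f).add_mem htf (hR hts)
    rwa [← add_assoc, add_self_zmod_two, zero_add] at this
  obtain ⟨ξ, hξ, hξt⟩ := exists_dual_eq_one (P := R ⊔ Submodule.span (ZMod 2) {s}) (x := t) (by
    rw [mem_sup_span_singleton]; tauto)
  obtain ⟨η, hη, hηs⟩ := exists_dual_eq_one (P := R ⊔ Submodule.span (ZMod 2) {t}) (x := s) (by
    rw [mem_sup_span_singleton, add_comm s]; tauto)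
  have hξR : ∀ y ∈ R, ξ y = 0 := fun y hy => hξ y (Submodule.mem_sup_left hy)
  have hηR : ∀ y ∈ R, η y = 0 := fun y hy => hη y (Submodule.mem_sup_left hy)
  have hξs : ξ s = 0 := hξ s (Submodule.mem_sup_right (Submodule.mem_span_singleton_self s))
  have hηt : η t = 0 := hη t (Submodule.mem_sup_right (Submodule.mem_span_singleton_self t))
  set f₁ : L → ZMod 2 := fun x => f x + f (x + s) with hf₁
  set f₀ : L → ZMod 2 := fun x => if η x = 0 then f x else f (x + s) with hf₀
  have h₁R : ∀ y ∈ R, ∀ x, f₁ (x + y) = f₁ x := fun y hy x => by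
    simp only [hf₁]
    rw [hR hy x, add_right_comm, hR hy (x + s)]
  have h₁t : ∀ x, f₁ (x + t) = f₁ x := fun x => by
    simp only [hf₁]
    rw [htf x, add_right_comm, htf (x + s)]
  have h₁s : ∀ x, f₁ (x + s) = f₁ x := fun x => by
    simp only [hf₁]
    rw [add_assoc x, add_self_zmod_two, add_zero, add_comm]
  have hsplit : f = fun x => f₀ x + (ξ x * f₁ x + (ξ x + η x) * f₁ x) := by
    funext x
    simp only [hf₀, hf₁]
    rcases zmod_two_cases (η x) with h | h
    · rw [h, if_pos rfl, add_zero, add_self_zmod_two, add_zero]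
    · rw [h, if_neg one_ne_zero]
      generalize f x = a
      generalize f (x + s) = b
      generalize ξ x = c
      revert a b c; decide
  by_cases h0 : planeSum S φ χ p f₀ = 0
  · by_cases h2 : planeSum S φ χ p (fun x => ξ x * f₁ x) = 0
    · right
      refine ⟨hts, fun x => (ξ x + η x) * f₁ x, fun y hy x => ?_, fun x => ?_, fun h3 => hD ?_⟩
      · change (ξ (x + y) + η (x + y)) * f₁ (x + y) = (ξ x + η x) * f₁ x
        rw [map_add, map_add, hξR y hy, hηR y hy, h₁R y hy, add_zero, add_zero]
      · change (ξ (x + (t + s)) + η (x + (t + s))) * f₁ (x + (t + s)) = (ξ x + η x) * f₁ x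
        rw [← add_assoc, h₁s, h₁t, map_add, map_add, map_add, map_add, hξt, hξs, hηt, hηs]
        generalize f₁ x = a
        generalize ξ x = b
        generalize η x = c
        revert a b c; decide
      · rw [hsplit, planeSum_add, planeSum_add, h0, h2, h3]; decide
    · left
      refine ⟨hs, fun x => ξ x * f₁ x, fun y hy x => ?_, fun x => ?_, h2⟩
      · change ξ (x + y) * f₁ (x + y) = ξ x * f₁ x
        rw [map_add, hξR y hy, h₁R y hy, add_zero]
      · change ξ (x + s) * f₁ (x + s) = ξ x * f₁ x
        rw [map_add, hξs, h₁s, add_zero]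
  · left
    refine ⟨hs, f₀, fun y hy x => ?_, fun x => ?_, h0⟩
    · simp only [hf₀]
      rw [map_add, hηR y hy, add_zero, add_right_comm, hR hy, hR hy]
    · simp only [hf₀]
      rw [map_add, hηs, add_assoc, add_self_zmod_two, add_zero]
      rcases zmod_two_cases (η x) with h | h
      · rw [h, zero_add, if_neg one_ne_zero, if_pos rfl]
      · rw [h, if_pos (by decide), if_neg one_ne_zero]

theorem planeSum_eq_zero_of_linked {V : Type*} [DecidableEq V] {Q : Finset V} (hQ : Q.card = 4)
    {a c : V} (ha : a ∈ Q) (hc : c ∈ Q) (hac : a ≠ c) (n : ℕ) :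
    ∀ {L : Type} [AddCommGroup L] [Module (ZMod 2) L] [FiniteDimensional (ZMod 2) L]
      {S : Finset V} {φ χ p : V → L} (f : L → ZMod 2) (s : V → L),
      (S \ Q).card = n → Q ⊆ S → IsConfig S φ χ →
      (∀ Z ⊆ S, a ∈ Z → c ∈ Z → (∀ z ∈ Z, z ∈ Q → z = a ∨ z = c) → 2 ≤ conn φ χ Z) →
      KillsCubics S φ χ p → (∀ u ∈ S \ Q, s u ∈ plane φ χ u) →
      LinearIndepOn (ZMod 2) s (S \ Q : Finset V) → (∀ u ∈ S \ Q, s u ∈ periods f) →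
      planeSum S φ χ p f = 0 := by
  classical
  induction n with
  | zero =>
    intro L _ _ _ S φ χ p f s hn hQS hcfg hκ hk hs hli hf
    have hS : S = Q := by
      rw [Finset.card_eq_zero, Finset.sdiff_eq_empty_iff_subset] at hn
      exact hn.antisymm hQS
    subst hS
    refine planeSum_eq_zero_of_card_four hcfg hQ ha hc hac (hκ {a, c} ?_ (by simp) (by simp) ?_) hk f
    · intro x hx
      rcases Finset.mem_insert.1 hx with rfl | hx
      · exact ha
      · rw [Finset.mem_singleton.1 hx]; exact hc
    · intro z hz _
      simpa using hz
  | succ n ih =>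
    intro L _ _ _ S φ χ p f s hn hQS hcfg hκ hk hs hli hf
    by_contra hD
    obtain ⟨v, hv⟩ : (S \ Q).Nonempty := by rw [← Finset.card_pos]; omega
    have hvS : v ∈ S := (Finset.mem_sdiff.1 hv).1
    have hvQ : v ∉ Q := (Finset.mem_sdiff.1 hv).2
    set R := Submodule.span (ZMod 2) (s '' ((S \ Q).erase v : Finset V)) with hRdef
    have hli' : LinearIndepOn (ZMod 2) s ((S \ Q).erase v : Finset V) ∧ s v ∉ R := by
      rw [hRdef, ← linearIndepOn_insert (by simp), ← Finset.coe_insert, Finset.insert_erase hv]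
      exact hli
    have hsv0 : s v ≠ 0 := fun h => hli'.2 (h ▸ R.zero_mem)
    have hdet : Detects S φ χ p R (s v) := by
      refine ⟨hli'.2, f, ?_, hf v hv, hD⟩
      rw [hRdef, Submodule.span_le]
      rintro _ ⟨u, hu, rfl⟩
      exact hf u (Finset.mem_of_mem_erase hu)
    obtain ⟨r, hr, hplane, -⟩ := exists_wedge_of_mem (hs v hv) hsv0
    let Bad : L → Prop := fun t => ∃ X ⊆ S.erase v, a ∈ X ∧ c ∈ X ∧
      (∀ z ∈ X, z ∈ Q → z = a ∨ z = c) ∧ conn φ χ X ≤ 2 ∧ t ∈ planes φ χ X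
    have hbad : ∀ t t', Bad t → Bad t' → (∀ P : Submodule (ZMod 2) L, t ∈ P → t' ∈ P →
        s v ∈ P ∧ r ∈ P) → False := by
      rintro t t' ⟨X, hXS, haX, hcX, hX, hconn, htX⟩ ⟨X', hXS', haX', hcX', hX', hconn', htX'⟩ hgen
      have hvX : v ∉ X ∪ X' := by
        rw [Finset.mem_union]
        rintro (h | h)
        · exact Finset.notMem_erase v S (hXS h)
        · exact Finset.notMem_erase v S (hXS' h)
      have hle : plane φ χ v ≤ planes φ χ (X ∪ X') := by
        obtain ⟨h1, h2⟩ := hgen (planes φ χ (X ∪ X')) (planes_mono Finset.subset_union_left htX)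
          (planes_mono Finset.subset_union_right htX')
        rw [hplane, sup_le_iff, Submodule.span_singleton_le_iff_mem,
          Submodule.span_singleton_le_iff_mem]
        exact ⟨h1, h2⟩
      have e1 := conn_insert_of_le hvX hle
      have e2 := conn_union_add_conn_inter_le (φ := φ) (χ := χ) X X'
      have e3 := hκ (X ∩ X') ((Finset.inter_subset_left.trans hXS).trans (Finset.erase_subset _ _))
        (Finset.mem_inter.2 ⟨haX, haX'⟩) (Finset.mem_inter.2 ⟨hcX, hcX'⟩)
        (fun z hz => hX z (Finset.mem_inter.1 hz).1)
      have e4 := hκ (insert v (X ∪ X')) (Finset.insert_subset hvS (Finset.union_subset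
        (hXS.trans (Finset.erase_subset _ _)) (hXS'.trans (Finset.erase_subset _ _))))
        (by simp [haX]) (by simp [hcX]) (by
          intro z hz hzQ
          rcases Finset.mem_insert.1 hz with rfl | hz
          · exact absurd hzQ hvQ
          · rcases Finset.mem_union.1 hz with h | h
            · exact hX z h hzQ
            · exact hX' z h hzQ)
      omega
    obtain ⟨t, htv, ⟨htR, g, hgR, hgt, hgD⟩, htbad⟩ : ∃ t ∈ plane φ χ v,
        Detects S φ χ p R t ∧ ¬ Bad t := by
      by_cases hb : Bad (s v)
      · rcases detects_or hdet r with h | h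
        · exact ⟨r, hr, h, fun h' => hbad _ _ hb h' fun P h1 h2 => ⟨h1, h2⟩⟩
        · refine ⟨s v + r, Submodule.add_mem _ (hs v hv) hr, h, fun h' => hbad _ _ hb h' ?_⟩
          intro P h1 h2
          exact ⟨h1, (P.add_mem_iff_right h1).1 h2⟩
      · exact ⟨s v, hs v hv, hdet, hb⟩
    have ht0 : t ≠ 0 := fun h => htR (h ▸ R.zero_mem)
    have hgf : ∃ g' : (L ⧸ Submodule.span (ZMod 2) {t}) → ZMod 2, g' ∘ modVec t = g := by
      refine ⟨fun q => g (Function.surjInv (Submodule.mkQ_surjective _) q), ?_⟩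
      funext x
      have h1 : modVec t (Function.surjInv (Submodule.mkQ_surjective (Submodule.span (ZMod 2) {t}))
          (modVec t x)) = modVec t x := Function.surjInv_eq _ _
      change g (Function.surjInv (Submodule.mkQ_surjective (Submodule.span (ZMod 2) {t}))
          (modVec t x)) = g x
      rw [← sub_eq_zero, ← map_sub, modVec_eq_zero_iff, sub_eq_zero, sub_eq_iff_eq_add'] at h1
      rcases h1 with h1 | h1
      · rw [h1]
      · rw [h1]; exact hgt x
    obtain ⟨g', hg'⟩ := hgf
    have her : S.erase v \ Q = (S \ Q).erase v := Finset.erase_sdiff_comm S Q v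
    apply hgD
    rw [← hg', ← planeSum_minor hvS htv ht0]
    refine ih g' (modVec t ∘ s) ?_ ?_ (hcfg.minor hvS ht0 htv) ?_ (hk.minor hvS htv ht0) ?_ ?_ ?_
    · rw [her, Finset.card_erase_of_mem hv, hn]; rfl
    · exact Finset.subset_erase.2 ⟨hQS, hvQ⟩
    · intro Z hZ haZ hcZ hZQ
      rw [conn_modVec ht0]
      have h2 := hκ Z (hZ.trans (Finset.erase_subset _ _)) haZ hcZ hZQ
      split_ifs with h
      · by_contra hcon
        exact htbad ⟨Z, hZ, haZ, hcZ, hZQ, by omega, h⟩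
      · omega
    · intro u hu
      rw [her] at hu
      rw [plane_map]
      exact Submodule.mem_map_of_mem (hs u (Finset.mem_of_mem_erase hu))
    · rw [her]
      refine LinearIndependent.map hli'.1 ?_
      rw [Submodule.disjoint_def]
      intro x hx hx'
      rcases modVec_eq_zero_iff.1 (LinearMap.mem_ker.1 hx') with h | h
      · exact h
      · refine absurd ?_ htR
        rw [← h, hRdef, Set.image_eq_range]
        exact hx
    · intro u hu x
      rw [her] at hu
      obtain ⟨x, rfl⟩ := Submodule.mkQ_surjective _ x
      have := hgR (Submodule.subset_span ⟨u, hu, rfl⟩) x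
      rw [← hg'] at this
      simpa using this

end Linking

section Coordinates

variable {V : Type} [Fintype V] [DecidableEq V] {A : Matrix V V (ZMod 2)}
  {p : V → V → ZMod 2}

/-- The standard basis vectors. -/
def unitVec (u : V) : V → ZMod 2 := Pi.single u 1

/-- The rows of the adjacency matrix. -/
def adjVec (A : Matrix V V (ZMod 2)) (u : V) : V → ZMod 2 := fun i => A u i

/-- The sum over the affine planes `p u + ⟨e u, A u⟩`. -/
def coverSum (A : Matrix V V (ZMod 2)) (p : V → V → ZMod 2) (f : (V → ZMod 2) → ZMod 2) : ZMod 2 :=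
  planeSum Finset.univ unitVec (adjVec A) p f

lemma unitVec_apply (u i : V) : unitVec u i = if i = u then 1 else 0 := by
  rw [unitVec, Pi.single_apply]

lemma isConfig_adj (hsym : A.IsSymm) : IsConfig Finset.univ (unitVec (V := V)) (adjVec A) where
  finrank_eq := by rw [Module.finrank_fintype_fun_eq_card, Finset.card_univ]
  span_eq := by
    rw [eq_top_iff]
    intro x _
    have : x = ∑ u, x u • unitVec u := by
      funext i
      simp [unitVec_apply]
    rw [this]
    exact Submodule.sum_mem _ fun u _ => Submodule.smul_mem _ _
      (plane_le_planes (Finset.mem_univ u) (left_mem_plane u))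
  isotropic := by
    intro ξ
    funext w
    have hξ : ∀ x, ξ x = ∑ v, x v * ξ (unitVec v) := by
      intro x
      have : x = ∑ u, x u • unitVec u := by
        funext i
        simp [unitVec_apply]
      conv_lhs => rw [this]
      rw [map_sum]
      exact Finset.sum_congr rfl fun u _ => by rw [map_smul, smul_eq_mul]
    rw [Finset.sum_apply, Pi.zero_apply]
    simp only [Pi.add_apply, Pi.smul_apply, smul_eq_mul, unitVec_apply, mul_ite, mul_one, mul_zero]
    rw [Finset.sum_add_distrib, Finset.sum_ite_eq, if_pos (Finset.mem_univ w), hξ (adjVec A w),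
      ← Finset.sum_add_distrib]
    refine Finset.sum_eq_zero fun v _ => ?_
    rw [adjVec, adjVec, ← hsym.apply v w, mul_comm, add_self_zmod_two]

/-- Squarefree monomials. -/
def monomialFun (S : Finset V) (x : V → ZMod 2) : ZMod 2 := ∏ i ∈ S, x i

lemma monomialFun_mul (S T : Finset V) (x : V → ZMod 2) :
    monomialFun S x * monomialFun T x = monomialFun (S ∪ T) x := by
  have hsq : ∀ a : ZMod 2, a * a = a := by decide
  have key : ∀ T : Finset V, (∏ i ∈ T, x i) * (∏ i ∈ T, x i) = ∏ i ∈ T, x i := fun T => hsq _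
  unfold monomialFun
  rw [← Finset.prod_union_inter, ← Finset.union_sdiff_of_subset
    (Finset.inter_subset_left.trans Finset.subset_union_left : S ∩ T ⊆ S ∪ T),
    Finset.prod_union Finset.disjoint_sdiff, mul_right_comm, key]

lemma unitVec_mem_periods {f : (V → ZMod 2) → ZMod 2} {S : Finset V} {u : V} (hu : u ∉ S)
    (hf : ∀ x y : V → ZMod 2, (∀ i ∈ S, x i = y i) → f x = f y) : unitVec u ∈ periods f := by
  intro x
  refine hf _ _ fun i hi => ?_
  rw [Pi.add_apply, unitVec_apply, if_neg (ne_of_mem_of_not_mem hi hu), add_zero]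

lemma unitVec_ne_zero (u : V) : unitVec u ≠ 0 := fun h => by
  have := congrFun h u
  simp [unitVec_apply] at this

lemma coverSum_eq_planeSum {f : (V → ZMod 2) → ZMod 2} {S : Finset V}
    (hf : ∀ x y : V → ZMod 2, (∀ i ∈ S, x i = y i) → f x = f y) :
    coverSum A p f = planeSum S unitVec (adjVec A) p f := by
  unfold coverSum planeSum
  symm
  apply Finset.sum_subset (Finset.subset_univ S)
  intro u _ hu
  exact corner_sum_eq_zero (left_mem_plane u) (unitVec_ne_zero u) (unitVec_mem_periods hu hf)

lemma monomialFun_congr (S : Finset V) (x y : V → ZMod 2) (h : ∀ i ∈ S, x i = y i) :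
    monomialFun S x = monomialFun S y := Finset.prod_congr rfl h

lemma coverSum_monomialFun (hdiag : ∀ v, A v v = 0) (S : Finset V) :
    coverSum A p (monomialFun S) =
      ∑ u ∈ S, (∏ i ∈ S.erase u, p u i + ∏ i ∈ S.erase u, (p u i + A u i)) := by
  rw [coverSum_eq_planeSum (monomialFun_congr S)]
  refine Finset.sum_congr rfl fun u hu => ?_
  have h1 : ∀ x : V → ZMod 2, monomialFun S x = x u * ∏ i ∈ S.erase u, x i := fun x =>
    (Finset.mul_prod_erase S x hu).symm
  have h2 : ∀ x : V → ZMod 2, ∏ i ∈ S.erase u, (x + unitVec u) i = ∏ i ∈ S.erase u, x i := fun x =>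
    Finset.prod_congr rfl fun i hi => by
      rw [Pi.add_apply, unitVec_apply, if_neg (Finset.ne_of_mem_erase hi), add_zero]
  rw [h1, h1, h1, h1, h2, add_right_comm (p u) (unitVec u) (adjVec A u), h2]
  simp only [Pi.add_apply, unitVec_apply, if_true, adjVec, hdiag, add_zero]
  have h2 : (2 : ZMod 2) = 0 := by decide
  linear_combination h2 * p u u * (∏ i ∈ S.erase u, p u i + ∏ i ∈ S.erase u, (p u i + A u i))

/-- The sign version of Naji's equations. -/
def SignSystem (A : Matrix V V (ZMod 2)) (p : V → V → ZMod 2) : Prop :=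
  ∀ a b c, a ≠ b → a ≠ c → b ≠ c →
    A a b * (p a c + p b c) + A a c * (p a b + p c b) + A b c * (p b a + p c a)
      + A a b * A a c + A a b * A b c + A a c * A b c = 0

lemma SignSystem.coverSum_monomialFun (hsym : A.IsSymm) (hdiag : ∀ v, A v v = 0)
    (hp : SignSystem A p) {S : Finset V} (hS : S.card ≤ 3) :
    coverSum A p (monomialFun S) = 0 := by
  rw [_root_.coverSum_monomialFun hdiag]
  have h : S.card = 0 ∨ S.card = 1 ∨ S.card = 2 ∨ S.card = 3 := by omega
  rcases h with h | h | h | h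
  · rw [Finset.card_eq_zero.1 h]; rfl
  · obtain ⟨a, rfl⟩ := Finset.card_eq_one.1 h
    simp only [Finset.sum_singleton, Finset.erase_singleton, Finset.prod_empty]
    decide
  · obtain ⟨a, b, hab, rfl⟩ := Finset.card_eq_two.1 h
    have e1 : ({a, b} : Finset V).erase a = {b} := by
      ext x; simp only [Finset.mem_erase, Finset.mem_insert, Finset.mem_singleton]; grind
    have e2 : ({a, b} : Finset V).erase b = {a} := by
      ext x; simp only [Finset.mem_erase, Finset.mem_insert, Finset.mem_singleton]; grind
    rw [Finset.sum_pair hab, e1, e2, Finset.prod_singleton, Finset.prod_singleton,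
      Finset.prod_singleton, Finset.prod_singleton, hsym.apply a b]
    generalize p a b = x
    generalize p b a = y
    generalize A a b = z
    revert x y z; decide
  · obtain ⟨a, b, c, hab, hac, hbc, rfl⟩ := Finset.card_eq_three.1 h
    have e1 : ({a, b, c} : Finset V).erase a = {b, c} := by
      ext x; simp only [Finset.mem_erase, Finset.mem_insert, Finset.mem_singleton]; grind
    have e2 : ({a, b, c} : Finset V).erase b = {a, c} := by
      ext x; simp only [Finset.mem_erase, Finset.mem_insert, Finset.mem_singleton]; grind
    have e3 : ({a, b, c} : Finset V).erase c = {a, b} := by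
      ext x; simp only [Finset.mem_erase, Finset.mem_insert, Finset.mem_singleton]; grind
    rw [Finset.sum_insert (by simp [hab, hac]), Finset.sum_pair hbc, e1, e2, e3,
      Finset.prod_pair hbc, Finset.prod_pair hbc, Finset.prod_pair hac, Finset.prod_pair hac,
      Finset.prod_pair hab, Finset.prod_pair hab, ← hsym.apply b a, ← hsym.apply c a,
      ← hsym.apply c b]
    have e := hp a b c hab hac hbc
    have h2 : (2 : ZMod 2) = 0 := by decide
    linear_combination e + h2 * (p a b * p a c + p b a * p b c + p c a * p c b)

/-- Affine coordinates, including the constant one. -/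
lemma dual_add_eq_sum (ξ : Module.Dual (ZMod 2) (V → ZMod 2)) (a : ZMod 2) :
    ∃ c : Option V → ZMod 2, ∀ x, ξ x + a = ∑ i, c i * monomialFun i.toFinset x := by
  refine ⟨fun i => i.elim a fun u => ξ (unitVec u), fun x => ?_⟩
  have hx : x = ∑ u, x u • unitVec u := by
    funext i
    simp [unitVec_apply]
  rw [Fintype.sum_option]
  conv_lhs => rw [hx]
  simp only [map_sum, map_smul, smul_eq_mul, Option.elim, monomialFun, Option.toFinset_none,
    Option.toFinset_some, Finset.prod_empty, Finset.prod_singleton, mul_one]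
  rw [add_comm]
  congr 1
  exact Finset.sum_congr rfl fun u _ => mul_comm _ _

lemma SignSystem.killsCubics (hsym : A.IsSymm) (hdiag : ∀ v, A v v = 0) (hp : SignSystem A p) :
    KillsCubics Finset.univ unitVec (adjVec A) p := by
  intro ξ η ζ a b c
  obtain ⟨f, hf⟩ := dual_add_eq_sum ξ a
  obtain ⟨g, hg⟩ := dual_add_eq_sum η b
  obtain ⟨h, hh⟩ := dual_add_eq_sum ζ c
  have e : (fun x => (ξ x + a) * (η x + b) * (ζ x + c)) = fun x => ∑ i, ∑ j, ∑ k,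
      (f i * g j * h k) * monomialFun (i.toFinset ∪ j.toFinset ∪ k.toFinset) x := by
    funext x
    rw [hf, hg, hh, Finset.sum_mul_sum, Finset.sum_mul]
    refine Finset.sum_congr rfl fun i _ => ?_
    rw [Finset.sum_mul_sum]
    refine Finset.sum_congr rfl fun j _ => Finset.sum_congr rfl fun k _ => ?_
    rw [← monomialFun_mul, ← monomialFun_mul]
    ring
  rw [e, planeSum_sum]
  refine Finset.sum_eq_zero fun i _ => ?_
  rw [planeSum_sum]
  refine Finset.sum_eq_zero fun j _ => ?_
  rw [planeSum_sum]
  refine Finset.sum_eq_zero fun k _ => ?_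
  rw [planeSum_mul_left]
  have hcard : ∀ i : Option V, i.toFinset.card ≤ 1 := fun i => by
    cases i <;> simp
  have h0 : coverSum A p (monomialFun (i.toFinset ∪ j.toFinset ∪ k.toFinset)) = 0 := by
    apply hp.coverSum_monomialFun hsym hdiag
    have h1 := Finset.card_union_le (i.toFinset ∪ j.toFinset) k.toFinset
    have h2 := Finset.card_union_le i.toFinset j.toFinset
    have := hcard i
    have := hcard j
    have := hcard k
    omega
  exact (congrArg _ h0).trans (mul_zero _)

lemma prod_add_add_one (S : Finset V) (x y : V → ZMod 2) :
    ∏ i ∈ S, (x i + (y i + 1)) = if ∀ i ∈ S, x i = y i then 1 else 0 := by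
  split_ifs with h
  · refine Finset.prod_eq_one fun i hi => ?_
    rw [h i hi, ← add_assoc, add_self_zmod_two, zero_add]
  · push Not at h
    obtain ⟨i, hi, hxy⟩ := h
    apply Finset.prod_eq_zero hi
    revert hxy
    generalize x i = a
    generalize y i = b
    revert a b; decide

lemma coverSum_prod_add_one {S : Finset V}
    (h : ∀ T, T ⊂ S → coverSum A p (monomialFun T) = 0) (y : V → ZMod 2) :
    coverSum A p (fun x => if ∀ i ∈ S, x i = y i then 1 else 0) =
      coverSum A p (monomialFun S) := by
  have e : (fun x : V → ZMod 2 => if ∀ i ∈ S, x i = y i then (1 : ZMod 2) else 0) =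
      fun x => ∑ T ∈ S.powerset, (∏ i ∈ S \ T, (y i + 1)) * monomialFun T x := by
    funext x
    rw [← prod_add_add_one, Finset.prod_add]
    exact Finset.sum_congr rfl fun T _ => mul_comm _ _
  rw [e, coverSum, planeSum_sum, Finset.sum_eq_single_of_mem S (Finset.mem_powerset_self S)]
  · rw [planeSum_mul_left, Finset.sdiff_self, Finset.prod_empty, one_mul]; rfl
  · intro T hT hTS
    rw [planeSum_mul_left]
    have := h T ((Finset.mem_powerset.1 hT).ssubset_of_ne hTS)
    exact (congrArg _ this).trans (mul_zero _)

lemma hasEvenCover_of_monomials (h : ∀ S, coverSum A p (monomialFun S) = 0) : HasEvenCover A := by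
  refine ⟨p, fun f => ?_⟩
  have e : f = fun x => ∑ y, f y * (if ∀ i ∈ Finset.univ, x i = y i then 1 else 0) := by
    funext x
    rw [Finset.sum_eq_single_of_mem x (Finset.mem_univ x)]
    · simp
    · intro y _ hy
      rw [if_neg, mul_zero]
      intro h'
      exact hy (funext fun i => (h' i (Finset.mem_univ i)).symm)
  change coverSum A p f = 0
  rw [e, coverSum, planeSum_sum]
  refine Finset.sum_eq_zero fun y _ => ?_
  rw [planeSum_mul_left]
  exact (congrArg _ ((coverSum_prod_add_one (fun T _ => h T) y).trans (h _))).trans (mul_zero _)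

lemma coverSum_monomialFun_eq_zero_of_five_le {S : Finset V} (hS : 5 ≤ S.card)
    (h : ∀ T, T ⊂ S → coverSum A p (monomialFun T) = 0) : coverSum A p (monomialFun S) = 0 := by
  classical
  by_contra hne
  let g : (V → ZMod 2) →ₗ[ZMod 2] (S → ZMod 2) := LinearMap.funLeft (ZMod 2) (ZMod 2) Subtype.val
  have hsurj := corner_surjective (S := S) (φ := g ∘ unitVec) (χ := g ∘ adjVec A) (p := g ∘ p) (by
    intro y
    let y' : V → ZMod 2 := fun i => if hi : i ∈ S then y ⟨i, hi⟩ else 0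
    rw [planeSum_map]
    have e : ((fun x => if x = y then (1 : ZMod 2) else 0) ∘ g) =
        fun x => if ∀ i ∈ S, x i = y' i then 1 else 0 := by
      funext x
      apply if_congr _ rfl rfl
      rw [funext_iff]
      constructor
      · intro hx i hi
        have := hx ⟨i, hi⟩
        simp only [y', dif_pos hi]
        exact this
      · intro hx i
        have := hx i i.2
        simp only [y', dif_pos i.2] at this
        exact this
    rw [e, ← coverSum_eq_planeSum (A := A) (p := p), coverSum_prod_add_one h]
    · exact hne
    · intro x z hxz
      apply if_congr _ rfl rfl
      exact forall₂_congr fun i hi => by rw [hxz i hi])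
  have hcard := Fintype.card_le_of_surjective _ hsurj
  rw [card_corner, Fintype.card_fun, ZMod.card, Fintype.card_coe] at hcard
  have : ∀ n, 5 ≤ n → 4 * n < 2 ^ n := by
    intro n hn
    induction n, hn using Nat.le_induction with
    | base => norm_num
    | succ n hn ih => rw [pow_succ]; omega
  exact absurd hcard (this _ hS).not_ge

theorem SignSystem.hasEvenCover (hsym : A.IsSymm) (hdiag : ∀ v, A v v = 0) (hp : SignSystem A p)
    (hprime : IsPrimeConfig Finset.univ (unitVec (V := V)) (adjVec A)) : HasEvenCover A := by
  apply hasEvenCover_of_monomials (p := p)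
  intro S
  induction S using Finset.strongInduction with
  | H S ih =>
    by_cases h3 : S.card ≤ 3
    · exact hp.coverSum_monomialFun hsym hdiag h3
    by_cases h5 : 5 ≤ S.card
    · exact coverSum_monomialFun_eq_zero_of_five_le h5 ih
    have h4 : S.card = 4 := by omega
    obtain ⟨a, ha, c, hc, hac⟩ := Finset.one_lt_card.1 (by omega : 1 < S.card)
    refine planeSum_eq_zero_of_linked h4 ha hc hac _ (monomialFun S) unitVec rfl
      (Finset.subset_univ S) (isConfig_adj hsym) ?_ (hp.killsCubics hsym hdiag) ?_ ?_ ?_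
    · intro Z hZ haZ hcZ hZS
      refine hprime Z hZ (Finset.one_lt_card.2 ⟨a, haZ, c, hcZ, hac⟩) ?_
      have hsub : (S.erase a).erase c ⊆ Finset.univ \ Z := by
        intro x hx
        rw [Finset.mem_erase, Finset.mem_erase] at hx
        rw [Finset.mem_sdiff]
        refine ⟨Finset.mem_univ x, fun hxZ => ?_⟩
        rcases hZS x hxZ hx.2.2 with h | h
        · exact hx.2.1 h
        · exact hx.1 h
      have := Finset.card_le_card hsub
      rw [Finset.card_erase_of_mem (Finset.mem_erase.2 ⟨hac.symm, hc⟩),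
        Finset.card_erase_of_mem ha] at this
      omega
    · exact fun u _ => left_mem_plane u
    · exact (LinearIndependent.linearIndepOn (Pi.basisFun (ZMod 2) V).linearIndependent _).congr
        fun u _ => by simp [unitVec]
    · intro u hu
      exact unitVec_mem_periods (Finset.mem_sdiff.1 hu).2 (monomialFun_congr S)

end Coordinates

section Splits

variable {V : Type} [Fintype V] [DecidableEq V] {A : Matrix V V (ZMod 2)}

/-- A cut of rank at most one with both sides of size at least two. -/
def HasSplit (A : Matrix V V (ZMod 2)) : Prop :=
  ∃ X : Finset V, 2 ≤ X.card ∧ 2 ≤ Xᶜ.card ∧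
    ∃ a b : V → ZMod 2, ∀ x ∈ X, ∀ y ∉ X, A x y = a x * b y

/-- The vector `x` with its coordinates outside `X` set to zero. -/
def restrictVec (X : Finset V) (x : V → ZMod 2) : V → ZMod 2 := fun i => if i ∈ X then x i else 0

lemma restrictVec_eq_sum (X : Finset V) (x : V → ZMod 2) :
    restrictVec X x = ∑ w ∈ X, x w • unitVec w := by
  funext i
  simp [restrictVec, unitVec_apply]

lemma restrictVec_add_compl (X : Finset V) (x : V → ZMod 2) :
    restrictVec X x + restrictVec Xᶜ x = x := by
  funext i
  by_cases h : i ∈ X <;> simp [restrictVec, h]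

lemma linearIndependent_unitVec : LinearIndependent (ZMod 2) (unitVec : V → V → ZMod 2) := by
  have := (Pi.basisFun (ZMod 2) V).linearIndependent
  convert this using 1
  funext u
  simp [unitVec]

lemma isPrimeConfig_of_not_hasSplit (h : ¬ HasSplit A) :
    IsPrimeConfig Finset.univ (unitVec (V := V)) (adjVec A) := by
  intro X _ hX hX'
  by_contra hconn
  apply h
  refine ⟨X, hX, by rwa [Finset.compl_eq_univ_sdiff], ?_⟩
  set U := Submodule.span (ZMod 2) ((fun u => restrictVec Xᶜ (adjVec A u)) '' (X : Set V)) with hU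
  set E := Submodule.span (ZMod 2) (unitVec '' (X : Set V)) with hE
  have hEle : E ≤ planes unitVec (adjVec A) X := by
    rw [hE, Submodule.span_le]
    rintro _ ⟨u, hu, rfl⟩
    exact plane_le_planes hu (left_mem_plane u)
  have hUle : U ≤ planes unitVec (adjVec A) X := by
    rw [hU, Submodule.span_le]
    rintro _ ⟨u, hu, rfl⟩
    have h1 : restrictVec X (adjVec A u) ∈ planes unitVec (adjVec A) X := by
      rw [restrictVec_eq_sum]
      exact Submodule.sum_mem _ fun w hw => Submodule.smul_mem _ _
        (plane_le_planes hw (left_mem_plane w))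
    have h2 : adjVec A u ∈ planes unitVec (adjVec A) X := plane_le_planes hu (right_mem_plane u)
    rw [← restrictVec_add_compl X (adjVec A u)] at h2
    exact (Submodule.add_mem_iff_right _ h1).1 h2
  have hdisj : Disjoint U E := by
    rw [Submodule.disjoint_def]
    intro x hxU hxE
    funext i
    by_cases hi : i ∈ X
    · have : U ≤ LinearMap.ker (LinearMap.proj (R := ZMod 2) (φ := fun _ : V => ZMod 2) i) := by
        rw [hU, Submodule.span_le]
        rintro _ ⟨u, hu, rfl⟩
        simp [restrictVec, hi]
      exact this hxU
    · have : E ≤ LinearMap.ker (LinearMap.proj (R := ZMod 2) (φ := fun _ : V => ZMod 2) i) := by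
        rw [hE, Submodule.span_le]
        rintro _ ⟨u, hu, rfl⟩
        simp only [SetLike.mem_coe, LinearMap.mem_ker, LinearMap.proj_apply, unitVec_apply]
        exact if_neg (ne_of_mem_of_not_mem hu hi).symm
      exact this hxE
  have hcard : Module.finrank (ZMod 2) E = X.card := by
    have := finrank_span_set_eq_card (R := ZMod 2) (s := unitVec '' (X : Set V))
      (linearIndependent_unitVec.linearIndepOn (X : Set V)).id_image
    rw [hE, this, Set.toFinset_image, Finset.toFinset_coe,
      Finset.card_image_of_injective _ linearIndependent_unitVec.injective]
  have hsum := Submodule.finrank_sup_add_finrank_inf_eq U E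
  rw [hdisj.eq_bot, finrank_bot] at hsum
  have hle := Submodule.finrank_mono (sup_le hUle hEle)
  have hU1 : Module.finrank (ZMod 2) U ≤ 1 := by
    rw [conn] at hconn
    omega
  obtain ⟨b, hb⟩ := finrank_le_one_iff.1 hU1
  have hc : ∀ u : V, ∃ c : ZMod 2, u ∈ X → c • (b : V → ZMod 2) = restrictVec Xᶜ (adjVec A u) := by
    intro u
    by_cases hu : u ∈ X
    · obtain ⟨c, hc⟩ := hb ⟨_, Submodule.subset_span ⟨u, hu, rfl⟩⟩
      exact ⟨c, fun _ => congrArg Subtype.val hc⟩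
    · exact ⟨0, fun h => absurd h hu⟩
  choose a ha using hc
  refine ⟨a, b, fun x hx y hy => ?_⟩
  have := congrFun (ha x hx) y
  simp only [restrictVec, Finset.mem_compl, hy, not_false_eq_true, if_true, adjVec, Pi.smul_apply,
    smul_eq_mul] at this
  exact this.symm

lemma HasEvenCover.exists_planeSum_eq_zero {T : Finset V}
    (h : HasEvenCover (A.submatrix (Subtype.val : T → V) Subtype.val))
    {L : Type} [AddCommGroup L] [Module (ZMod 2) L] (E : V → L) :
    ∃ p : V → L, ∀ f, planeSum T E (fun u => ∑ w ∈ T, A u w • E w) p f = 0 := by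
  obtain ⟨p₀, hp₀⟩ := h
  let j : (T → ZMod 2) →ₗ[ZMod 2] L := Fintype.linearCombination (ZMod 2) fun u : T => E u
  refine ⟨fun u => if hu : u ∈ T then j (p₀ ⟨u, hu⟩) else 0, fun f => ?_⟩
  rw [← hp₀ (f ∘ j)]
  unfold planeSum
  rw [← Finset.sum_coe_sort T]
  refine Finset.sum_congr rfl fun u _ => ?_
  have h1 : j (Pi.single u 1) = E u := by simp [j, Fintype.linearCombination_apply_single]
  have h2 : j ((A.submatrix (Subtype.val : T → V) Subtype.val) u) = ∑ w ∈ T, A u w • E w := by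
    rw [← Finset.sum_coe_sort T]
    rfl
  simp only [Function.comp_apply, map_add, h1, h2, Subtype.coe_eta, dif_pos u.2]

lemma HasEvenCover.exists_planeSum_eq_corner (hsym : A.IsSymm) {X : Finset V} {y₀ : V}
    (hy₀ : y₀ ∉ X)
    (h : HasEvenCover (A.submatrix (Subtype.val : ↥(insert y₀ X) → V) Subtype.val))
    {a b : V → ZMod 2} (hab : ∀ x ∈ X, ∀ y ∉ X, A x y = a x * b y) (hb : b y₀ = 1) :
    ∃ p : V → V → ZMod 2, ∀ f : (V → ZMod 2) → ZMod 2, planeSum X unitVec (adjVec A) p f =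
        f (p y₀) + f (p y₀ + restrictVec X a) + f (p y₀ + restrictVec Xᶜ b) +
          f (p y₀ + restrictVec X a + restrictVec Xᶜ b) := by
  obtain ⟨p, hp⟩ :=
    h.exists_planeSum_eq_zero (fun u => if u ∈ X then unitVec u else restrictVec Xᶜ b)
  refine ⟨p, fun f => ?_⟩
  have hsum : ∀ u, ∑ w ∈ insert y₀ X, A u w • (if w ∈ X then unitVec w else restrictVec Xᶜ b) =
      A u y₀ • restrictVec Xᶜ b + restrictVec X (adjVec A u) := by
    intro u
    rw [Finset.sum_insert hy₀, if_neg hy₀, restrictVec_eq_sum X]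
    congr 1
    exact Finset.sum_congr rfl fun w hw => by rw [if_pos hw, adjVec]
  have hy : A y₀ y₀ • restrictVec Xᶜ b + restrictVec X (adjVec A y₀) =
      A y₀ y₀ • restrictVec Xᶜ b + restrictVec X a := by
    congr 1
    funext i
    by_cases hi : i ∈ X
    · simp only [restrictVec, hi, if_true, adjVec]
      rw [← hsym.apply, hab i hi y₀ hy₀, hb, mul_one]
    · simp only [restrictVec, hi, if_false]
  have hx : ∀ u ∈ X, A u y₀ • restrictVec Xᶜ b + restrictVec X (adjVec A u) = adjVec A u := by
    intro u hu
    conv_rhs => rw [← restrictVec_add_compl X (adjVec A u), add_comm]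
    congr 1
    funext i
    by_cases hi : i ∈ X
    · simp [restrictVec, hi]
    · simp only [Pi.smul_apply, restrictVec, Finset.mem_compl, hi, not_false_eq_true, if_true,
        smul_eq_mul, adjVec]
      rw [hab u hu y₀ hy₀, hab u hu i hi, hb, mul_one]
  have h0 := hp f
  unfold planeSum at h0 ⊢
  rw [Finset.sum_insert hy₀] at h0
  simp only [hsum, if_neg hy₀] at h0
  rw [hy] at h0
  rw [← sub_eq_zero, sub_eq_add_zmod_two, add_comm, ← h0]
  congr 1
  · rcases zmod_two_cases (A y₀ y₀) with h | h
    · rw [h, zero_smul, zero_add, add_right_comm (p y₀)]; ring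
    · rw [h, one_smul, ← add_assoc (p y₀ + restrictVec Xᶜ b), add_assoc (p y₀) (restrictVec Xᶜ b)
        (restrictVec Xᶜ b), add_self_zmod_two, add_zero,
        add_comm (restrictVec Xᶜ b) (restrictVec X a), add_assoc (p y₀)]
      ring
  · refine Finset.sum_congr rfl fun u hu => ?_
    rw [if_pos hu, hx u hu]

lemma hasEvenCover_of_hasSplit (hsym : A.IsSymm) (h : HasSplit A)
    (ih : ∀ T : Finset V, T.card < Fintype.card V →
      HasEvenCover (A.submatrix (Subtype.val : T → V) Subtype.val)) : HasEvenCover A := by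
  obtain ⟨X, hX, hXc, a, b, hab⟩ := h
  have hcard := Finset.card_add_card_compl X
  by_cases hcross : ∃ x₀ ∈ X, ∃ y₀ ∉ X, A x₀ y₀ = 1
  · obtain ⟨x₀, hx₀, y₀, hy₀, h1⟩ := hcross
    have hb : a x₀ = 1 ∧ b y₀ = 1 := by
      have := hab x₀ hx₀ y₀ hy₀
      rw [h1] at this
      revert this
      generalize a x₀ = c
      generalize b y₀ = d
      revert c d; decide
    have hx₀' : x₀ ∉ Xᶜ := fun h => Finset.mem_compl.1 h hx₀
    obtain ⟨p, hp'⟩ := (ih (insert y₀ X) (by rw [Finset.card_insert_of_notMem hy₀]; omega)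
      ).exists_planeSum_eq_corner hsym hy₀ hab hb.2
    obtain ⟨q, hq'⟩ := (ih (insert x₀ Xᶜ) (by rw [Finset.card_insert_of_notMem hx₀']; omega)
      ).exists_planeSum_eq_corner hsym hx₀' (a := b) (b := a) (fun x hx y hy => by
        rw [← hsym.apply, hab y (by simpa using hy) x (by simpa using hx), mul_comm]) hb.1
    rw [compl_compl] at hq'
    refine ⟨fun u => if u ∈ X then p u else q u + (p y₀ + q x₀), fun f => ?_⟩
    have hsplit : planeSum Finset.univ unitVec (adjVec A)
        (fun u => if u ∈ X then p u else q u + (p y₀ + q x₀)) f =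
        planeSum X unitVec (adjVec A) p f +
          planeSum Xᶜ unitVec (adjVec A) q (fun x => f (x + (p y₀ + q x₀))) := by
      unfold planeSum
      rw [← Finset.sum_add_sum_compl X]
      congr 1
      · exact Finset.sum_congr rfl fun u hu => by simp only [if_pos hu]
      · refine Finset.sum_congr rfl fun u hu => ?_
        simp only [if_neg (Finset.mem_compl.1 hu), add_right_comm _ (p y₀ + q x₀)]
    refine hsplit.trans ?_
    have hshift : ∀ x : V → ZMod 2, q x₀ + x + (p y₀ + q x₀) = p y₀ + x := by
      intro x
      have : q x₀ + x + (p y₀ + q x₀) = p y₀ + x + (q x₀ + q x₀) := by abel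
      rw [this, add_self_zmod_two, add_zero]
    have hshift0 : q x₀ + (p y₀ + q x₀) = p y₀ := by
      have := hshift 0
      rwa [add_zero, add_zero] at this
    rw [hp', hq']
    simp only [add_assoc (q x₀) (restrictVec Xᶜ b) (restrictVec X a), hshift, hshift0]
    rw [add_comm (restrictVec Xᶜ b) (restrictVec X a), ← add_assoc (p y₀)]
    generalize f (p y₀ + restrictVec X a + restrictVec Xᶜ b) = c₁
    generalize f (p y₀ + restrictVec X a) = c₂
    generalize f (p y₀ + restrictVec Xᶜ b) = c₃
    generalize f (p y₀) = c₄
    revert c₁ c₂ c₃ c₄; decide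
  · push Not at hcross
    have h0 : ∀ x ∈ X, ∀ y ∉ X, A x y = 0 := fun x hx y hy =>
      (zmod_two_cases _).resolve_right (hcross x hx y hy)
    obtain ⟨p, hp⟩ := (ih X (by omega)).exists_planeSum_eq_zero (unitVec (V := V))
    obtain ⟨q, hq⟩ := (ih Xᶜ (by omega)).exists_planeSum_eq_zero (unitVec (V := V))
    refine ⟨fun u => if u ∈ X then p u else q u, fun f => ?_⟩
    have hpq := congrArg₂ (· + ·) (hp f) (hq f)
    rw [add_zero] at hpq
    rw [← hpq]
    unfold planeSum
    rw [← Finset.sum_add_sum_compl X]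
    refine congrArg₂ (· + ·) ?_ ?_
    · refine Finset.sum_congr rfl fun u hu => ?_
      have : ∑ w ∈ X, A u w • unitVec w = A u := by
        rw [← restrictVec_eq_sum X (A u)]
        funext i
        by_cases hi : i ∈ X
        · simp [restrictVec, hi]
        · simp [restrictVec, hi, h0 u hu i hi]
      simp only [if_pos hu, this]
      rfl
    · refine Finset.sum_congr rfl fun u hu => ?_
      have hu' := Finset.mem_compl.1 hu
      have : ∑ w ∈ Xᶜ, A u w • unitVec w = A u := by
        rw [← restrictVec_eq_sum Xᶜ (A u)]
        funext i
        by_cases hi : i ∈ X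
        · simp [restrictVec, hi, ← hsym.apply u i, h0 i hi u hu']
        · simp [restrictVec, hi]
      simp only [if_neg hu', this]
      rfl

end Splits

section Naji

variable {V : Type} [Fintype V] [DecidableEq V] {A : Matrix V V (ZMod 2)}

lemma hasSplit_of_mul_eq {a b c d : V} (hac : a ≠ c) (had : a ≠ d) (hbc : b ≠ c) (hbd : b ≠ d)
    (hab : a ≠ b) (hcd : c ≠ d) (huniv : ∀ v, v = a ∨ v = b ∨ v = c ∨ v = d)
    (h : A a c * A b d = A a d * A b c) : HasSplit A := by
  have key : ∀ p q r s : ZMod 2, p * s = q * r → ∃ a₁ a₂ b₁ b₂ : ZMod 2,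
      p = a₁ * b₁ ∧ q = a₁ * b₂ ∧ r = a₂ * b₁ ∧ s = a₂ * b₂ := by decide
  obtain ⟨a₁, a₂, b₁, b₂, h1, h2, h3, h4⟩ := key _ _ _ _ h
  refine ⟨{a, b}, ?_, ?_, fun x => if x = a then a₁ else a₂, fun x => if x = c then b₁ else b₂, ?_⟩
  · rw [Finset.card_pair hab]
  · refine Finset.one_lt_card.2 ⟨c, ?_, d, ?_, hcd⟩
    · simp [hac.symm, hbc.symm]
    · simp [had.symm, hbd.symm]
  · intro x hx y hy
    simp only [Finset.mem_insert, Finset.mem_singleton, not_or] at hx hy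
    have hy' : y = c ∨ y = d := by
      rcases huniv y with h | h | h | h
      · exact absurd h hy.1
      · exact absurd h hy.2
      · exact Or.inl h
      · exact Or.inr h
    rcases hx with rfl | rfl <;> rcases hy' with rfl | rfl
    · simpa using h1
    · simpa [hcd.symm] using h2
    · simpa [hab.symm] using h3
    · simpa [hab.symm, hcd.symm] using h4

lemma hasSplit_of_card_four (hsym : A.IsSymm) (h4 : Fintype.card V = 4) : HasSplit A := by
  rw [← Finset.card_univ, Finset.card_eq_succ] at h4
  obtain ⟨a, t, hat, ht, h3⟩ := h4
  obtain ⟨b, c, d, hbc, hbd, hcd, rfl⟩ := Finset.card_eq_three.1 h3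
  simp only [Finset.mem_insert, Finset.mem_singleton, not_or] at hat
  obtain ⟨hab, hac, had⟩ := hat
  have hu : ∀ v, v = a ∨ v = b ∨ v = c ∨ v = d := fun v => by
    have := Finset.mem_univ v
    rw [← ht] at this
    simpa using this
  have hpig : ∀ x y z : ZMod 2, y = z ∨ x = z ∨ x = y := by decide
  rcases hpig (A a b * A c d) (A a c * A b d) (A a d * A b c) with h | h | h
  · exact hasSplit_of_mul_eq hac had hbc hbd hab hcd hu h
  · refine hasSplit_of_mul_eq hab had hbc.symm hcd hac hbd (fun v => ?_) (?_)
    · rcases hu v with h | h | h | h <;> tauto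
    · rw [h, ← hsym.apply b c]
  · refine hasSplit_of_mul_eq hab hac hbd.symm hcd.symm had hbc (fun v => ?_) (?_)
    · rcases hu v with h | h | h | h <;> tauto
    · rw [hsym.apply c d, h, ← hsym.apply b d]

lemma signSystem_of_three {a b c : V} (hab : a ≠ b) (hac : a ≠ c) (hbc : b ≠ c)
    (hsym : A.IsSymm) (hu : ∀ v, v = a ∨ v = b ∨ v = c) (h : A a b = 1) :
    ∃ p, SignSystem A p := by
  refine ⟨fun u v => if u = a ∧ v = c then
    A a b * A a c + A a b * A b c + A a c * A b c else 0, ?_⟩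
  have e1 : A b a = A a b := hsym.apply a b
  have e2 : A c a = A a c := hsym.apply a c
  have e3 : A c b = A b c := hsym.apply b c
  intro x y z hxy hxz hyz
  rcases hu x with rfl | rfl | rfl <;> rcases hu y with rfl | rfl | rfl <;>
    rcases hu z with rfl | rfl | rfl <;>
    first
    | exact absurd rfl hxy
    | exact absurd rfl hxz
    | exact absurd rfl hyz
    | (simp only [e1, e2, e3, h, hac, hbc, hab.symm, hac.symm, and_self, and_true,
        and_false, if_true, if_false]
       generalize A _ _ = r
       generalize A _ _ = s
       revert r s; decide)

lemma exists_signSystem_of_card_le_three (hsym : A.IsSymm) (h3 : Fintype.card V ≤ 3) :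
    ∃ p, SignSystem A p := by
  by_cases h : Fintype.card V = 3
  · rw [← Finset.card_univ] at h
    obtain ⟨a, b, c, hab, hac, hbc, he⟩ := Finset.card_eq_three.1 h
    have hu : ∀ v, v = a ∨ v = b ∨ v = c := fun v => by
      have := Finset.mem_univ v
      rw [he] at this
      simpa using this
    rcases zmod_two_cases (A a b) with h1 | h1
    · rcases zmod_two_cases (A a c) with h2 | h2
      · rcases zmod_two_cases (A b c) with h3 | h3
        · refine ⟨fun _ _ => 0, ?_⟩
          have e1 : A b a = A a b := hsym.apply a b
          have e2 : A c a = A a c := hsym.apply a c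
          have e3 : A c b = A b c := hsym.apply b c
          intro x y z hxy hxz hyz
          rcases hu x with rfl | rfl | rfl <;> rcases hu y with rfl | rfl | rfl <;>
            rcases hu z with rfl | rfl | rfl <;> simp_all
        · exact signSystem_of_three hbc hab.symm hac.symm hsym (fun v => by have := hu v; tauto) h3
      · exact signSystem_of_three hac hab hbc.symm hsym (fun v => by have := hu v; tauto) h2
    · exact signSystem_of_three hab hac hbc hsym hu h1
  · refine ⟨fun _ _ => 0, fun a b c hab hac hbc => absurd h3 (not_le.2 ?_)⟩
    have h1 : ({a, b, c} : Finset V).card = 3 := Finset.card_eq_three.2 ⟨a, b, c, hab, hac, hbc, rfl⟩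
    have h2 := Finset.card_le_univ ({a, b, c} : Finset V)
    omega

/-- Naji's equations modulo `2 ^ (m + 1)`, with sign `2 ^ m`. -/
structure IsNaji (A : Matrix V V (ZMod 2)) (m : ℕ) (y : V → V → ℤ) : Prop where
  far : ∀ u v w, A u w = 1 → A v u = 0 → A v w = 0 → v ≠ u → v ≠ w →
    (2 ^ (m + 1) : ℤ) ∣ y v u - y v w
  path : ∀ u v w, A v u = 1 → A u w = 1 → A v w = 0 → v ≠ w →
    (2 ^ (m + 1) : ℤ) ∣ y v u + y w v - y w u - y v w - 2 ^ m
  tri : ∀ u v w, A u v = 1 → A v w = 1 → A u w = 1 →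
    (2 ^ (m + 1) : ℤ) ∣ y u v + y v w + y w u - y u w - y w v - y v u - 2 ^ m

lemma cast_eq_zero_of_two_pow_dvd {m : ℕ} {z : ℤ} (h : (2 ^ (m + 1) : ℤ) ∣ z) :
    (z : ZMod 2) = 0 := by
  rw [ZMod.intCast_zmod_eq_zero_iff_dvd]
  exact (dvd_pow_self 2 (Nat.succ_ne_zero m)).trans h

lemma IsNaji.cast_eq (hsym : A.IsSymm) {m : ℕ} {y : V → V → ℤ} (hy : IsNaji A m y) {a b c : V}
    (hab : a ≠ b) (hac : a ≠ c) (hbc : b ≠ c) :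
    A a b * ((y c a : ZMod 2) + y c b) + A a c * (y b a + y b c) + A b c * (y a b + y a c) +
      2 ^ m * (A a b * A a c + A a b * A b c + A a c * A b c) = 0 := by
  have e1 : A b a = A a b := hsym.apply a b
  have e2 : A c a = A a c := hsym.apply a c
  have e3 : A c b = A b c := hsym.apply b c
  have h2 : (2 : ZMod 2) = 0 := by decide
  rcases zmod_two_cases (A a b) with h1 | h1 <;> rcases zmod_two_cases (A a c) with h3 | h3 <;>
    rcases zmod_two_cases (A b c) with h4 | h4 <;> rw [h1, h3, h4]
  · ring
  · have e := cast_eq_zero_of_two_pow_dvd (hy.far b a c h4 h1 h3 hab hac)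
    push_cast at e
    linear_combination e + h2 * y a c
  · have e := cast_eq_zero_of_two_pow_dvd (hy.far a b c h3 (e1.trans h1) h4 hab.symm hbc)
    push_cast at e
    linear_combination e + h2 * y b c
  · have e := cast_eq_zero_of_two_pow_dvd (hy.path c a b h3 (e3.trans h4) h1 hab)
    push_cast at e
    linear_combination e + h2 * (y b c + y a b + 2 ^ m)
  · have e := cast_eq_zero_of_two_pow_dvd (hy.far a c b h1 (e2.trans h3) (e3.trans h4) hac.symm
      hbc.symm)
    push_cast at e
    linear_combination e + h2 * y c b
  · have e := cast_eq_zero_of_two_pow_dvd (hy.path b a c h1 h4 h3 hac)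
    push_cast at e
    linear_combination e + h2 * (y c b + y a c + 2 ^ m)
  · have e := cast_eq_zero_of_two_pow_dvd (hy.path a b c (e1.trans h1) h3 h4 hbc)
    push_cast at e
    linear_combination e + h2 * (y c a + y b c + 2 ^ m)
  · have e := cast_eq_zero_of_two_pow_dvd (hy.tri a b c h1 h4 h3)
    push_cast at e
    linear_combination e + h2 * (y a c + y c b + y b a + 2 * 2 ^ m)

lemma dual_induction {P : Module.Dual (ZMod 2) (V → ZMod 2) → Prop}
    (hzero : P 0) (hadd : ∀ ξ η, P ξ → P η → P (ξ + η)) (hproj : ∀ i, P (LinearMap.proj i))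
    (ξ : Module.Dual (ZMod 2) (V → ZMod 2)) : P ξ := by
  have : ξ = ∑ i, ξ (unitVec i) • LinearMap.proj i := by
    refine LinearMap.ext fun x => ?_
    have hx : x = ∑ u, x u • unitVec u := by
      funext i
      simp [unitVec_apply]
    conv_lhs => rw [hx]
    rw [map_sum, LinearMap.sum_apply]
    exact Finset.sum_congr rfl fun i _ => by simp [mul_comm]
  rw [this]
  refine Finset.sum_induction _ P hadd hzero fun i _ => ?_
  rcases zmod_two_cases (ξ (unitVec i)) with h | h
  · rw [h, zero_smul]; exact hzero
  · rw [h, one_smul]; exact hproj i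

lemma isClosedField_of_coordinates (hsym : A.IsSymm) {h : V → V → ZMod 2}
    (hh : ∀ a b c, a ≠ b → a ≠ c → b ≠ c →
      A a b * (h a c + h b c) + A a c * (h a b + h c b) + A b c * (h b a + h c a) = 0) :
    IsClosedField Finset.univ unitVec (adjVec A) h := by
  have h2 : (2 : ZMod 2) = 0 := by decide
  refine fun ξ => dual_induction (P := fun ξ => ∀ η ζ, ∑ v, vol unitVec (adjVec A) ξ η ζ v (h v) = 0)
    ?_ ?_ ?_ ξ
  · intro η ζ
    simp [vol, wedge]
  · intro ξ ξ' h1 h2 η ζ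
    rw [← add_zero (0 : ZMod 2), ← h1 η ζ]
    conv_rhs => rw [h1 η ζ, zero_add, ← h2 η ζ, ← zero_add (∑ v, _), ← h1 η ζ]
    rw [← Finset.sum_add_distrib]
    refine Finset.sum_congr rfl fun v _ => ?_
    simp only [vol, wedge, LinearMap.add_apply]
    ring
  intro i η
  refine dual_induction (P := fun η => ∀ ζ, ∑ v, vol unitVec (adjVec A) (LinearMap.proj i) η ζ v (h v)
    = 0) ?_ ?_ ?_ η
  · intro ζ
    simp [vol, wedge]
  · intro ξ ξ' h1 h2 ζ
    rw [← add_zero (0 : ZMod 2), ← h1 ζ]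
    conv_rhs => rw [h1 ζ, zero_add, ← h2 ζ, ← zero_add (∑ v, _), ← h1 ζ]
    rw [← Finset.sum_add_distrib]
    refine Finset.sum_congr rfl fun v _ => ?_
    simp only [vol, wedge, LinearMap.add_apply]
    ring
  intro j ζ
  refine dual_induction (P := fun ζ => ∑ v, vol unitVec (adjVec A) (LinearMap.proj i)
    (LinearMap.proj j) ζ v (h v) = 0) ?_ ?_ ?_ ζ
  · simp [vol, wedge]
  · intro ξ ξ' h1 h2
    rw [← add_zero (0 : ZMod 2), ← h1]
    conv_rhs => rw [h1, zero_add, ← h2, ← zero_add (∑ v, _), ← h1]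
    rw [← Finset.sum_add_distrib]
    refine Finset.sum_congr rfl fun v _ => ?_
    simp only [vol, wedge, LinearMap.add_apply]
    ring
  intro k
  by_cases hij : i = j
  · subst hij
    refine Finset.sum_eq_zero fun v _ => ?_
    simp only [vol, wedge, LinearMap.proj_apply]
    generalize unitVec v i = a
    generalize unitVec v k = b
    generalize adjVec A v i = c
    generalize adjVec A v k = d
    generalize h v i = e
    generalize h v k = f
    revert a b c d e f; decide
  by_cases hik : i = k
  · subst hik
    refine Finset.sum_eq_zero fun v _ => ?_
    simp only [vol, wedge, LinearMap.proj_apply]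
    linear_combination h2 * (unitVec v i * adjVec A v j * h v i + adjVec A v i * unitVec v j * h v i +
      unitVec v i * adjVec A v i * h v j)
  by_cases hjk : j = k
  · subst hjk
    refine Finset.sum_eq_zero fun v _ => ?_
    simp only [vol, wedge, LinearMap.proj_apply]
    linear_combination h2 * (unitVec v i * adjVec A v j * h v j + adjVec A v i * unitVec v j * h v j +
      unitVec v j * adjVec A v j * h v i)
  have hw : ∀ a b c : V, ∑ v, wedge unitVec (adjVec A) (LinearMap.proj a) (LinearMap.proj b) v * h v c
      = A a b * h a c + A b a * h b c := by
    intro a b c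
    simp only [wedge, LinearMap.proj_apply, unitVec_apply, adjVec, ite_mul, mul_ite, one_mul, mul_one,
      zero_mul, mul_zero, add_mul, Finset.sum_add_distrib, Finset.sum_ite_eq, Finset.mem_univ, if_true]
  simp only [vol, Finset.sum_add_distrib]
  have e := hh i j k hij hik hjk
  have w1 := hw i j k
  have w2 := hw j k i
  have w3 := hw k i j
  simp only [LinearMap.proj_apply] at w1 w2 w3 ⊢
  rw [w1, w2, w3, hsym.apply i j, hsym.apply j k, hsym.apply i k]
  linear_combination e

lemma IsNaji.exists_signSystem (hsym : A.IsSymm) (hdiag : ∀ v, A v v = 0)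
    (hprime : IsPrimeConfig Finset.univ (unitVec (V := V)) (adjVec A)) {n : ℕ}
    (hcard : Fintype.card V = n + 5) (m : ℕ) {y : V → V → ℤ} (hy : IsNaji A m y) :
    ∃ p, SignSystem A p := by
  induction m generalizing y with
  | zero =>
    refine ⟨fun u v => (y v u : ZMod 2), fun a b c hab hac hbc => ?_⟩
    have := hy.cast_eq hsym hab hac hbc
    linear_combination this
  | succ m ih =>
    have hcl : IsClosedField Finset.univ unitVec (adjVec A) (fun u v => (y v u : ZMod 2)) := by
      refine isClosedField_of_coordinates hsym fun a b c hab hac hbc => ?_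
      have := hy.cast_eq hsym hab hac hbc
      have h2 : (2 : ZMod 2) = 0 := by decide
      rw [h2, zero_pow (Nat.succ_ne_zero m)] at this
      linear_combination this
    obtain ⟨l, hl⟩ := hcl.exists_translate n (isConfig_adj hsym) hprime hcard
    have hκ : ∀ u, ∃ κ : ZMod 2, ∀ w, w ≠ u → (y w u : ZMod 2) = l w + κ * A w u := by
      intro u
      obtain ⟨α, κ, h⟩ := Submodule.mem_span_pair.1 (hl u (Finset.mem_univ u))
      refine ⟨κ, fun w hw => ?_⟩
      have hw' := congrFun h w
      simp only [Pi.add_apply, Pi.smul_apply, unitVec_apply, if_neg hw, adjVec, smul_eq_mul, mul_zero,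
        zero_add] at hw'
      rw [hsym.apply u w, hw', add_comm (y w u : ZMod 2), ← add_assoc, add_self_zmod_two, zero_add]
    choose κ hκ using hκ
    have hz : ∀ w u, ∃ z : ℤ, w ≠ u → 2 * z = y w u - (l w).val - (κ u).val * (A w u).val := by
      intro w u
      by_cases hw : w = u
      · exact ⟨0, fun h => absurd hw h⟩
      have hd : (2 : ℤ) ∣ y w u - (l w).val - (κ u).val * (A w u).val := by
        rw [← Nat.cast_two, ← ZMod.intCast_zmod_eq_zero_iff_dvd]
        push_cast
        rw [ZMod.natCast_zmod_val, ZMod.natCast_zmod_val, ZMod.natCast_zmod_val, hκ u w hw]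
        ring
      obtain ⟨z, hz⟩ := hd
      exact ⟨z, fun _ => hz.symm⟩
    choose z hz using hz
    have hdvd : ∀ a : ℤ, (2 ^ (m + 1 + 1) : ℤ) ∣ 2 * a → (2 ^ (m + 1) : ℤ) ∣ a := by
      intro a ha
      rw [pow_succ, mul_comm] at ha
      exact Int.dvd_of_mul_dvd_mul_left two_ne_zero ha
    have hne : ∀ u v, A u v = 1 → u ≠ v := by
      rintro u v h rfl
      rw [hdiag] at h
      exact absurd h (by decide)
    have hs : ∀ u v, A u v = A v u := fun u v => hsym.apply v u
    have v1 : ((1 : ZMod 2).val : ℤ) = 1 := rfl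
    have v0 : ((0 : ZMod 2).val : ℤ) = 0 := rfl
    refine ih (y := z) ⟨?_, ?_, ?_⟩
    · intro u v w h1 h2 h3 h4 h5
      apply hdvd
      rw [mul_sub, hz v u h4, hz v w h5, h2, h3, v0]
      convert hy.far u v w h1 h2 h3 h4 h5 using 1
      ring
    · intro u v w h1 h2 h3 h4
      apply hdvd
      have e : 2 * (z v u + z w v - z w u - z v w - 2 ^ m) =
          y v u + y w v - y w u - y v w - 2 ^ (m + 1) := by
        have a1 := hz v u (hne _ _ h1)
        have a2 := hz w v h4.symm
        have a3 := hz w u (hne _ _ h2).symm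
        have a4 := hz v w h4
        rw [h1, v1] at a1
        rw [hs, h3, v0] at a2
        rw [hs, h2, v1] at a3
        rw [h3, v0] at a4
        rw [pow_succ]
        linear_combination a1 + a2 - a3 - a4
      rw [e]
      exact hy.path u v w h1 h2 h3 h4
    · intro u v w h1 h2 h3
      apply hdvd
      have e : 2 * (z u v + z v w + z w u - z u w - z w v - z v u - 2 ^ m) =
          y u v + y v w + y w u - y u w - y w v - y v u - 2 ^ (m + 1) := by
        have a1 := hz u v (hne _ _ h1)
        have a2 := hz v w (hne _ _ h2)
        have a3 := hz w u (hne _ _ h3).symm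
        have a4 := hz u w (hne _ _ h3)
        have a5 := hz w v (hne _ _ h2).symm
        have a6 := hz v u (hne _ _ h1).symm
        rw [h1, v1] at a1
        rw [h2, v1] at a2
        rw [hs, h3, v1] at a3
        rw [h3, v1] at a4
        rw [hs, h2, v1] at a5
        rw [hs, h1, v1] at a6
        rw [pow_succ]
        linear_combination a1 + a2 + a3 - a4 - a5 - a6
      rw [e]
      exact hy.tri u v w h1 h2 h3

end Naji

theorem IsNaji.hasEvenCover {m : ℕ} (n : ℕ) : ∀ {V : Type} [Fintype V] [DecidableEq V]
    {A : Matrix V V (ZMod 2)} {y : V → V → ℤ}, Fintype.card V = n → A.IsSymm → (∀ v, A v v = 0) →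
    IsNaji A m y → HasEvenCover A := by
  induction n using Nat.strong_induction_on with
  | _ n ih =>
    intro V _ _ A y hn hsym hdiag hy
    by_cases h3 : Fintype.card V ≤ 3
    · obtain ⟨p, hp⟩ := exists_signSystem_of_card_le_three hsym h3
      exact hasEvenCover_of_monomials fun S =>
        hp.coverSum_monomialFun hsym hdiag ((Finset.card_le_univ S).trans h3)
    by_cases hsplit : HasSplit A
    · refine hasEvenCover_of_hasSplit hsym hsplit fun T hT => ?_
      refine ih T.card (hn ▸ hT) (y := fun u v => y u v) (Fintype.card_coe T) (hsym.submatrix _)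
        (fun v => hdiag v) ⟨?_, ?_, ?_⟩
      · intro u v w h1 h2 h3 h4 h5
        exact hy.far u v w h1 h2 h3 (fun h => h4 (Subtype.ext h)) fun h => h5 (Subtype.ext h)
      · intro u v w h1 h2 h3 h4
        exact hy.path u v w h1 h2 h3 fun h => h4 (Subtype.ext h)
      · intro u v w h1 h2 h3
        exact hy.tri u v w h1 h2 h3
    have h4 : Fintype.card V ≠ 4 := fun h => hsplit (hasSplit_of_card_four hsym h)
    have hprime := isPrimeConfig_of_not_hasSplit hsplit
    obtain ⟨k, hk⟩ := Nat.exists_eq_add_of_le (by omega : 5 ≤ Fintype.card V)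
    obtain ⟨p, hp⟩ := hy.exists_signSystem hsym hdiag hprime (n := k) (by omega) m
    exact hp.hasEvenCover hsym hdiag hprime

section MulNaji

variable {V : Type} [Fintype V] [DecidableEq V] {A : Matrix V V (ZMod 2)} {F : Type} [Field F]

/-- Naji's equations in multiplicative form over a field. -/
structure IsMulNaji (A : Matrix V V (ZMod 2)) (x : V → V → Fˣ) : Prop where
  far : ∀ u v w, A u w = 1 → A v u = 0 → A v w = 0 → v ≠ u → v ≠ w → x v u = x v w
  path : ∀ u v w, A v u = 1 → A u w = 1 → A v w = 0 → v ≠ w →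
    x v u * x w v = -1 * (x w u * x v w)
  tri : ∀ u v w, A u v = 1 → A v w = 1 → A u w = 1 →
    x u v * x v w * x w u = -1 * (x u w * x w v * x v u)

lemma exists_character_neg_one (h2 : (2 : F) ≠ 0) :
    ∃ c : Additive Fˣ →+ AddCircle (1 : ℚ), c (Additive.ofMul (-1)) = ((1 / 2 : ℚ) : AddCircle (1 : ℚ)) := by
  have hne : Additive.ofMul (-1 : Fˣ) ≠ 0 := by
    intro h
    have h1 : (-1 : Fˣ) = 1 := h
    have h3 : (-1 : F) = 1 := by
      have := congrArg Units.val h1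
      simpa using this
    apply h2
    linear_combination -h3
  obtain ⟨c, hc⟩ := CharacterModule.exists_character_apply_ne_zero_of_ne_zero hne
  refine ⟨c, ?_⟩
  have hc2 : c (Additive.ofMul (-1 : Fˣ)) + c (Additive.ofMul (-1 : Fˣ)) = 0 := by
    rw [← map_add, ← ofMul_mul, neg_mul_neg, one_mul, ofMul_one, map_zero]
  obtain ⟨q, hq⟩ := QuotientAddGroup.mk_surjective (c (Additive.ofMul (-1 : Fˣ)))
  change ((q : ℚ) : AddCircle (1 : ℚ)) = _ at hq
  change c (Additive.ofMul (-1 : Fˣ)) = _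
  rw [← hq, ← AddCircle.coe_add, AddCircle.coe_eq_zero_iff] at hc2
  obtain ⟨n, hn⟩ := hc2
  rw [zsmul_eq_mul, mul_one] at hn
  rcases Int.even_or_odd' n with ⟨k, rfl | rfl⟩
  · exfalso
    apply hc
    rw [← hq, AddCircle.coe_eq_zero_iff]
    refine ⟨k, ?_⟩
    rw [zsmul_eq_mul, mul_one]
    push_cast at hn
    linarith
  · rw [← hq, ← sub_eq_zero, ← AddCircle.coe_sub, AddCircle.coe_eq_zero_iff]
    refine ⟨k, ?_⟩
    rw [zsmul_eq_mul, mul_one]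
    push_cast at hn
    linarith

lemma IsMulNaji.exists_isNaji (h2 : (2 : F) ≠ 0) {x : V → V → Fˣ} (hx : IsMulNaji A x) :
    ∃ m y, IsNaji A m y := by
  obtain ⟨c, hc⟩ := exists_character_neg_one h2
  have hq : ∀ v u, ∃ q : ℚ, (q : AddCircle (1 : ℚ)) = c (Additive.ofMul (x v u)) := fun v u =>
    QuotientAddGroup.mk_surjective _
  choose q hq using hq
  set N : ℕ := ∏ v, ∏ u, (q v u).den with hN
  have hN0 : N ≠ 0 := Finset.prod_ne_zero_iff.2 fun v _ => Finset.prod_ne_zero_iff.2 fun u _ =>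
    (q v u).den_ne_zero
  have ha : ∀ v u, ∃ a : ℤ, (a : ℚ) = N * q v u := by
    intro v u
    have hd : (q v u).den ∣ N := (Finset.dvd_prod_of_mem (fun u => (q v u).den) (Finset.mem_univ u)).trans
      (Finset.dvd_prod_of_mem (fun v => ∏ u, (q v u).den) (Finset.mem_univ v))
    obtain ⟨k, hk⟩ := hd
    refine ⟨k * (q v u).num, ?_⟩
    rw [hk]
    push_cast
    rw [mul_comm ((q v u).den : ℚ), mul_assoc, Rat.den_mul_eq_num]
  choose a ha using ha
  obtain ⟨m, r, hr, hNr⟩ := Nat.exists_eq_two_pow_mul_odd hN0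
  obtain ⟨s, rfl⟩ := hr
  have hNz : (N : ℤ) = 2 ^ m * (2 * s + 1) := by rw [hNr]; push_cast; ring
  have hzero : ∀ t : ℚ, (t : AddCircle (1 : ℚ)) = 0 → ∃ n : ℤ, (n : ℚ) = t := by
    intro t ht
    obtain ⟨n, hn⟩ := (AddCircle.coe_eq_zero_iff (1 : ℚ)).1 ht
    exact ⟨n, by rw [← hn, zsmul_eq_mul, mul_one]⟩
  have hfinish : ∀ (b : ℤ) (t : ℚ), (b : ℚ) = N * t → (t : AddCircle (1 : ℚ)) = ((1 / 2 : ℚ) : AddCircle (1 : ℚ)) →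
      (2 ^ (m + 1) : ℤ) ∣ 2 * b - 2 ^ m := by
    intro b t hb ht
    rw [← sub_eq_zero, ← AddCircle.coe_sub] at ht
    obtain ⟨n, hn⟩ := hzero _ ht
    have e : 2 * b = 2 ^ m * (2 * s + 1) * (2 * n + 1) := by
      rw [← hNz]
      have : (2 * b : ℚ) = N * (2 * n + 1) := by rw [hb, hn]; ring
      exact_mod_cast this
    rw [e]
    exact ⟨2 * s * n + s + n, by ring⟩
  refine ⟨m, fun v u => 2 * a v u, ⟨?_, ?_, ?_⟩⟩
  · intro u v w h1 h2 h3 h4 h5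
    have e := hx.far u v w h1 h2 h3 h4 h5
    have ht : ((q v u - q v w : ℚ) : AddCircle (1 : ℚ)) = 0 := by
      rw [AddCircle.coe_sub, hq, hq, e, sub_self]
    obtain ⟨n, hn⟩ := hzero _ ht
    have e : a v u - a v w = 2 ^ m * (2 * s + 1) * n := by
      rw [← hNz]
      have : (a v u - a v w : ℚ) = N * n := by rw [ha, ha, hn]; ring
      exact_mod_cast this
    rw [← mul_sub, e]
    exact ⟨(2 * s + 1) * n, by ring⟩
  · intro u v w h1 h2 h3 h4
    have e := congrArg (fun z => c (Additive.ofMul z)) (hx.path u v w h1 h2 h3 h4)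
    simp only [ofMul_mul, map_add, hc, ← hq] at e
    have := hfinish (a v u + a w v - a w u - a v w) (q v u + q w v - q w u - q v w)
      (by push_cast; rw [ha, ha, ha, ha]; ring) (by
        rw [AddCircle.coe_sub, AddCircle.coe_sub, AddCircle.coe_add, e]
        abel)
    convert this using 1
    ring
  · intro u v w h1 h2 h3
    have e := congrArg (fun z => c (Additive.ofMul z)) (hx.tri u v w h1 h2 h3)
    simp only [ofMul_mul, map_add, hc, ← hq] at e
    have := hfinish (a u v + a v w + a w u - a u w - a w v - a v u)
      (q u v + q v w + q w u - q u w - q w v - q v u)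
      (by push_cast; rw [ha, ha, ha, ha, ha, ha]; ring) (by
        rw [AddCircle.coe_sub, AddCircle.coe_sub, AddCircle.coe_sub, AddCircle.coe_add,
          AddCircle.coe_add, e]
        abel)
    convert this using 1
    ring

theorem IsMulNaji.isCircleGraph (h2 : (2 : F) ≠ 0) (hsym : A.IsSymm) (hdiag : ∀ v, A v v = 0)
    {x : V → V → Fˣ} (hx : IsMulNaji A x) : IsCircleGraph A := by
  obtain ⟨m, y, hy⟩ := hx.exists_isNaji h2
  exact isCircleGraph_of_hasEvenCover A hsym hdiag (hy.hasEvenCover _ rfl hsym hdiag)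

end MulNaji

section Shelter

variable {V : Type} [Fintype V] [DecidableEq V] {A : Matrix V V (ZMod 2)} {F : Type} [Field F]
  {E : Type} [AddCommGroup E] [Module F E]

/-- The column of `IAS(G)` with a given label. -/
def iasCol (A : Matrix V V (ZMod 2)) (j : V × Fin 3) : V → ZMod 2 := fun z => IASmat A z j

/-- The span of the `ψ`-vectors in `X`, the `χ`-vectors in `Y` and the `φ`-vectors in `T`. -/
def labelSpan (F : Type) [Field F] {E : Type} [AddCommGroup E] [Module F E] (p : V × Fin 3 → E)
    (X Y T : Set V) : Submodule F E :=
  Submodule.span F ((fun v => p (v, 2)) '' X) ⊔ Submodule.span F ((fun v => p (v, 1)) '' Y) ⊔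
    Submodule.span F (Set.image (fun v => p (v, 0)) T)

/-- The vectors `p` have the same dependencies as `IAS(G)` within subtransversals. -/
def Shelters (F : Type) [Field F] {E : Type} [AddCommGroup E] [Module F E]
    (A : Matrix V V (ZMod 2)) (p : V × Fin 3 → E) : Prop :=
  ∀ (i : V × Fin 3) (S : Set (V × Fin 3)), Subtransversal3 (insert i S) →
    (p i ∈ Submodule.span F (p '' S) ↔
      iasCol A i ∈ Submodule.span (ZMod 2) (iasCol A '' S))

lemma mem_span_image_iff_colSpanRank {m n : Type} [Fintype m] (M : Matrix m n F) (i : n)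
    (S : Set n) : (fun a => M a i) ∈ Submodule.span F ((fun j a => M a j) '' S) ↔
      colSpanRank F M (insert i S) = colSpanRank F M S := by
  unfold colSpanRank
  rw [Set.image_insert_eq]
  constructor
  · intro h
    rw [Submodule.span_insert_eq_span h]
  · intro h
    have hle := Submodule.span_mono (R := F)
      (Set.subset_insert (fun a => M a i) ((fun j a => M a j) '' S))
    rw [Submodule.eq_of_le_of_finrank_eq hle h.symm]
    exact Submodule.subset_span (Set.mem_insert _ _)

lemma Z3Rep.exists_shelters (h : Z3Rep F A) :
    ∃ (k : ℕ) (p : V × Fin 3 → (Fin k → F)), Shelters F A p := by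
  obtain ⟨k, P, hP⟩ := h
  refine ⟨k, fun j a => P a j, fun i S hS => ?_⟩
  have hS' : Subtransversal3 S := fun v a b ha hb =>
    hS v a b (Set.mem_insert_of_mem _ ha) (Set.mem_insert_of_mem _ hb)
  rw [mem_span_image_iff_colSpanRank P, hP _ hS, hP _ hS']
  exact (mem_span_image_iff_colSpanRank (IASmat A) i S).symm

lemma Shelters.mem_labelSpan_iff {p : V × Fin 3 → E} (hp : Shelters F A p) {u : V} (a : Fin 3)
    {X Y T : Set V} (huX : u ∉ X) (huY : u ∉ Y) (huT : u ∉ T) (hXY : ∀ v ∈ X, v ∉ Y)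
    (hXT : ∀ v ∈ X, v ∉ T) (hYT : ∀ v ∈ Y, v ∉ T) :
    p (u, a) ∈ labelSpan F p X Y T ↔
      iasCol A (u, a) ∈ labelSpan (ZMod 2) (iasCol A) X Y T := by
  have key := hp (u, a) ((fun v => (v, 2)) '' X ∪ (fun v => (v, 1)) '' Y ∪ (fun v => (v, 0)) '' T) (by
    intro v i j hi hj
    simp only [Set.mem_insert_iff, Set.mem_union, Set.mem_image, Prod.mk.injEq] at hi hj
    grind)
  unfold labelSpan
  simp only [Set.image_union, Set.image_image, Submodule.span_union] at key
  exact key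

@[simp] lemma iasCol_zero (v z : V) : iasCol A (v, 0) z = if z = v then 1 else 0 := by
  simp [iasCol, IASmat]

@[simp] lemma iasCol_one (v z : V) : iasCol A (v, 1) z = A z v := by
  simp [iasCol, IASmat]

@[simp] lemma iasCol_two (v z : V) :
    iasCol A (v, 2) z = (if z = v then 1 else 0) + A z v := by
  simp [iasCol, IASmat]

lemma mem_span_iasCol_zero {T : Set V} {x : V → ZMod 2} (hx : ∀ z, z ∉ T → x z = 0) :
    x ∈ Submodule.span (ZMod 2) ((fun v => iasCol A (v, 0)) '' T) := by
  have e : x = ∑ v, x v • iasCol A (v, 0) := by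
    funext z
    simp [Finset.sum_apply]
  rw [e]
  refine Submodule.sum_mem _ fun v _ => ?_
  by_cases hv : v ∈ T
  · exact Submodule.smul_mem _ _ (Submodule.subset_span ⟨v, hv, rfl⟩)
  · rw [hx v hv, zero_smul]
    exact Submodule.zero_mem _

lemma notMem_labelSpan {K : Type} [Field K] {E : Type} [AddCommGroup E] [Module K E]
    {p : V × Fin 3 → E} {X Y T : Set V} {x : E} (f : E →ₗ[K] K)
    (hX : ∀ v ∈ X, f (p (v, 2)) = 0) (hY : ∀ v ∈ Y, f (p (v, 1)) = 0)
    (hT : ∀ v ∈ T, f (p (v, 0)) = 0) (hx : f x ≠ 0) : x ∉ labelSpan K p X Y T := by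
  intro h
  have hle : labelSpan K p X Y T ≤ LinearMap.ker f := by
    refine sup_le (sup_le ?_ ?_) ?_ <;> rw [Submodule.span_le] <;> rintro _ ⟨v, hv, rfl⟩
    · exact hX v hv
    · exact hY v hv
    · exact hT v hv
  exact hx (hle h)

lemma mem_labelSpan_iff_exists {K : Type} [Field K] {E : Type} [AddCommGroup E] [Module K E]
    {p : V × Fin 3 → E} {X Y T : Set V} {x : E} :
    x ∈ labelSpan K p X Y T ↔ ∃ a ∈ Submodule.span K ((fun v => p (v, 2)) '' X),
      ∃ b ∈ Submodule.span K ((fun v => p (v, 1)) '' Y),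
      x - a - b ∈ Submodule.span K ((fun v => p (v, 0)) '' T) := by
  unfold labelSpan
  constructor
  · intro h
    obtain ⟨y, hy, t, ht, rfl⟩ := Submodule.mem_sup.1 h
    obtain ⟨a, ha, b, hb, rfl⟩ := Submodule.mem_sup.1 hy
    exact ⟨a, ha, b, hb, by rwa [show a + b + t - a - b = t by abel]⟩
  · rintro ⟨a, ha, b, hb, ht⟩
    refine Submodule.mem_sup.2 ⟨a + b, Submodule.mem_sup.2 ⟨a, ha, b, hb, rfl⟩, _, ht, by abel⟩

/-- Functionals dual to the `φ`-vectors that do not vanish on the matching `ψ`-vectors. -/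
structure IsDual (p : V × Fin 3 → E) (g : V → E →ₗ[F] F) : Prop where
  phi : ∀ z v, g z (p (v, 0)) = if z = v then 1 else 0
  psi : ∀ z, g z (p (z, 2)) ≠ 0

lemma mem_span_phi_iff {p : V × Fin 3 → E} {g : V → E →ₗ[F] F}
    (hg : ∀ z v, g z (p (v, 0)) = if z = v then 1 else 0) {T : Set V} {x : E} :
    x ∈ Submodule.span F ((fun v => p (v, 0)) '' T) ↔
      x ∈ Submodule.span F ((fun v => p (v, 0)) '' Set.univ) ∧ ∀ z, z ∉ T → g z x = 0 := by
  constructor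
  · intro h
    refine ⟨Submodule.span_mono (Set.image_mono (Set.subset_univ T)) h, fun z hz => ?_⟩
    have hle : Submodule.span F ((fun v => p (v, 0)) '' T) ≤ LinearMap.ker (g z) := by
      rw [Submodule.span_le]
      rintro _ ⟨v, hv, rfl⟩
      have : z ≠ v := fun e => hz (e ▸ hv)
      simp [hg, this]
    exact hle h
  · rintro ⟨h, h0⟩
    have e : x = ∑ v, g v x • p (v, 0) := by
      have hle : Submodule.span F ((fun v => p (v, 0)) '' Set.univ) ≤
          LinearMap.eqLocus LinearMap.id (∑ v, (g v).smulRight (p (v, 0))) := by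
        rw [Submodule.span_le]
        rintro _ ⟨v, -, rfl⟩
        simp [LinearMap.mem_eqLocus, hg, LinearMap.sum_apply]
      simpa [LinearMap.sum_apply] using LinearMap.mem_eqLocus.1 (hle h)
    rw [e]
    refine Submodule.sum_mem _ fun v _ => ?_
    by_cases hv : v ∈ T
    · exact Submodule.smul_mem _ _ (Submodule.subset_span ⟨v, hv, rfl⟩)
    · rw [h0 v hv, zero_smul]
      exact Submodule.zero_mem _

lemma Shelters.exists_isDual {p : V × Fin 3 → E} (hp : Shelters F A p) (hdiag : ∀ v, A v v = 0) :
    ∃ g : V → E →ₗ[F] F, IsDual p g := by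
  have hphi : ∀ v, p (v, 0) ∉ labelSpan F p ∅ ∅ {v}ᶜ := by
    intro v
    rw [hp.mem_labelSpan_iff 0 (by simp) (by simp) (by simp) (by simp) (by simp) (by simp)]
    exact notMem_labelSpan (LinearMap.proj v) (by simp) (by simp)
      (by intro z hz; simpa using Ne.symm hz) (by simp)
  have hpsi : ∀ v, p (v, 2) ∉ labelSpan F p ∅ ∅ {v}ᶜ := by
    intro v
    rw [hp.mem_labelSpan_iff 2 (by simp) (by simp) (by simp) (by simp) (by simp) (by simp)]
    exact notMem_labelSpan (LinearMap.proj v) (by simp) (by simp)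
      (by intro z hz; simpa using Ne.symm hz) (by simp [hdiag])
  have hex : ∀ v, ∃ f : E →ₗ[F] F, ∀ z, f (p (z, 0)) = if v = z then 1 else 0 := by
    intro v
    obtain ⟨f, hf, hle⟩ := Submodule.exists_le_ker_of_notMem (hphi v)
    refine ⟨(f (p (v, 0)))⁻¹ • f, fun z => ?_⟩
    by_cases hz : v = z
    · subst hz
      simp [hf]
    · have : p (z, 0) ∈ labelSpan F p ∅ ∅ {v}ᶜ :=
        Submodule.mem_sup_right (Submodule.subset_span ⟨z, Ne.symm hz, rfl⟩)
      have := hle this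
      rw [LinearMap.mem_ker] at this
      simp [hz, this]
  choose g hg using hex
  have hex' : ∀ v, ∃ f : E →ₗ[F] F, (∀ z, f (p (z, 0)) = if v = z then 1 else 0) ∧
      f (p (v, 2)) ≠ 0 := by
    intro v
    by_cases h : g v (p (v, 2)) = 0
    · have hn : p (v, 2) ∉ Submodule.span F ((fun v => p (v, 0)) '' Set.univ) := by
        intro hmem
        refine hpsi v (Submodule.mem_sup_right ((mem_span_phi_iff hg).2 ⟨hmem, fun z hz => ?_⟩))
        rw [Set.notMem_compl_iff] at hz
        rw [hz, h]
      obtain ⟨f, hf, hle⟩ := Submodule.exists_le_ker_of_notMem hn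
      refine ⟨g v + f, fun z => ?_, by simpa [h] using hf⟩
      have := hle (Submodule.subset_span ⟨z, trivial, rfl⟩)
      rw [LinearMap.mem_ker] at this
      simp [hg, this]
    · exact ⟨g v, hg v, h⟩
  choose f hf hf' using hex'
  exact ⟨f, hf, hf'⟩

end Shelter

section ShelterRelations

variable {V : Type} [Fintype V] [DecidableEq V] {A : Matrix V V (ZMod 2)} {F : Type} [Field F]
  {E : Type} [AddCommGroup E] [Module F E] {p : V × Fin 3 → E} {g : V → E →ₗ[F] F}

lemma Shelters.exists_relation (hp : Shelters F A p) (hg : IsDual p g) {u : V} (c : Fin 3)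
    {X Y : Set V} (R : Set V) (hu : u ∈ R) (hX : X ⊆ R) (hY : Y ⊆ R) (huX : u ∉ X) (huY : u ∉ Y)
    (hXY : ∀ v ∈ X, v ∉ Y) {a' b' : V → ZMod 2}
    (ha' : a' ∈ Submodule.span (ZMod 2) ((fun v => iasCol A (v, 2)) '' X))
    (hb' : b' ∈ Submodule.span (ZMod 2) ((fun v => iasCol A (v, 1)) '' Y))
    (h0 : ∀ z ∈ R, (iasCol A (u, c) - a' - b') z = 0) :
    ∃ a ∈ Submodule.span F ((fun v => p (v, 2)) '' X),
      ∃ b ∈ Submodule.span F ((fun v => p (v, 1)) '' Y),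
        p (u, c) - a - b ∈ Submodule.span F ((fun v => p (v, 0)) '' Set.univ) ∧
          ∀ z ∈ R, g z (p (u, c) - a - b) = 0 := by
  have h : p (u, c) ∈ labelSpan F p X Y Rᶜ := by
    rw [hp.mem_labelSpan_iff c huX huY (by simpa using hu) hXY (fun v hv => by simpa using hX hv)
      (fun v hv => by simpa using hY hv), mem_labelSpan_iff_exists]
    exact ⟨a', ha', b', hb', mem_span_iasCol_zero fun z hz => h0 z (by simpa using hz)⟩
  obtain ⟨a, ha, b, hb, hab⟩ := mem_labelSpan_iff_exists.1 h
  rw [mem_span_phi_iff hg.phi] at hab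
  exact ⟨a, ha, b, hb, hab.1, fun z hz => hab.2 z (by simpa using hz)⟩

lemma Shelters.exists_row_ne_zero (hp : Shelters F A p) (hg : IsDual p g) {u : V} (c : Fin 3)
    {X Y : Set V} (R : Set V) (hu : u ∈ R) (hX : X ⊆ R) (hY : Y ⊆ R) (huX : u ∉ X) (huY : u ∉ Y)
    (hXY : ∀ v ∈ X, v ∉ Y) (f : (V → ZMod 2) →ₗ[ZMod 2] ZMod 2)
    (hfX : ∀ v ∈ X, f (iasCol A (v, 2)) = 0) (hfY : ∀ v ∈ Y, f (iasCol A (v, 1)) = 0)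
    (hfR : ∀ v, v ∉ R → f (iasCol A (v, 0)) = 0) (hfu : f (iasCol A (u, c)) ≠ 0) {a b : E}
    (ha : a ∈ Submodule.span F ((fun v => p (v, 2)) '' X))
    (hb : b ∈ Submodule.span F ((fun v => p (v, 1)) '' Y))
    (hab : p (u, c) - a - b ∈ Submodule.span F ((fun v => p (v, 0)) '' Set.univ)) :
    ∃ z ∈ R, g z (p (u, c) - a - b) ≠ 0 := by
  by_contra! h
  have hn := notMem_labelSpan (T := Rᶜ) f hfX hfY (fun v hv => hfR v hv) hfu
  rw [← hp.mem_labelSpan_iff c huX huY (by simpa using hu) hXY (fun v hv => by simpa using hX hv)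
      (fun v hv => by simpa using hY hv), mem_labelSpan_iff_exists] at hn
  exact hn ⟨a, ha, b, hb, (mem_span_phi_iff hg.phi).2 ⟨hab, fun z hz => h z (by simpa using hz)⟩⟩

lemma Shelters.chi_mem (hp : Shelters F A p) (hg : IsDual p g) (hdiag : ∀ v, A v v = 0) (u : V) :
    p (u, 1) ∈ Submodule.span F ((fun v => p (v, 0)) '' Set.univ) ∧
      ∀ z, A z u = 0 → g z (p (u, 1)) = 0 := by
  obtain ⟨a, ha, b, hb, h, h0⟩ := hp.exists_relation hg (u := u) 1 (X := ∅) (Y := ∅)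
    {z | A z u = 0} (hdiag u) (by simp) (by simp) (by simp) (by simp) (by simp)
    (Submodule.zero_mem _) (Submodule.zero_mem _) (by intro z hz; simpa using hz)
  simp only [Set.image_empty, Submodule.span_empty, Submodule.mem_bot] at ha hb
  subst ha hb
  simp only [sub_zero] at h h0
  exact ⟨h, h0⟩

lemma Shelters.chi_ne_zero (hp : Shelters F A p) (hg : IsDual p g) (hdiag : ∀ v, A v v = 0)
    {z u : V} (hzu : A z u = 1) : g z (p (u, 1)) ≠ 0 := by
  obtain ⟨h, h0⟩ := hp.chi_mem hg hdiag u
  obtain ⟨y, hy, hne⟩ := hp.exists_row_ne_zero hg (u := u) 1 (X := ∅) (Y := ∅)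
    (insert z {z | A z u = 0}) (Or.inr (hdiag u)) (by simp) (by simp) (by simp) (by simp) (by simp)
    (LinearMap.proj z) (by simp) (by simp)
    (by
      intro v hv
      have : z ≠ v := fun e => hv (Or.inl e.symm)
      simp [this])
    (by simp [hzu]) (Submodule.zero_mem _) (Submodule.zero_mem _) (by simpa using h)
  simp only [sub_zero] at hne
  rcases hy with rfl | hy
  · exact hne
  · exact absurd (h0 y hy) hne

lemma Shelters.psi_edge (hp : Shelters F A p) (hg : IsDual p g) (hsym : A.IsSymm)
    (hdiag : ∀ v, A v v = 0) {u w : V} (huw : A u w = 1) :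
    ∃ ρ : F, p (u, 2) - ρ • p (w, 2) ∈ Submodule.span F ((fun v => p (v, 0)) '' Set.univ) ∧
      ∀ z, g z (p (u, 2)) = ρ * g z (p (w, 2)) ↔ (z = u ∨ z = w ∨ A z u = A z w) := by
  have hwu : A w u = 1 := by rw [hsym.apply, huw]
  have hne : u ≠ w := by
    rintro rfl
    simp [hdiag] at huw
  obtain ⟨a, ha, b, hb, h, h0⟩ := hp.exists_relation hg (u := u) 2 (X := {w}) (Y := ∅)
    {z | z = u ∨ z = w ∨ A z u = A z w} (Or.inl rfl) (by simp) (by simp) (by simpa using hne)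
    (by simp) (by simp) (Submodule.subset_span ⟨w, rfl, rfl⟩) (Submodule.zero_mem _)
    (by
      rintro z (rfl | rfl | hz)
      · simp [hne, huw, hdiag]
      · simp [hne.symm, hwu, hdiag]
      · by_cases h1 : z = u
        · subst h1
          simp [hne, huw, hdiag]
        · by_cases h2 : z = w
          · subst h2
            simp [hne.symm, hwu, hdiag]
          · simp [h1, h2, hz])
  simp only [Set.image_empty, Submodule.span_empty, Submodule.mem_bot] at hb
  subst hb
  rw [Set.image_singleton, Submodule.mem_span_singleton] at ha
  obtain ⟨ρ, rfl⟩ := ha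
  simp only [sub_zero] at h h0
  have heq : ∀ z, g z (p (u, 2) - ρ • p (w, 2)) = 0 ↔ g z (p (u, 2)) = ρ * g z (p (w, 2)) := by
    intro z
    rw [map_sub, map_smul, smul_eq_mul, sub_eq_zero]
  refine ⟨ρ, h, fun z => ⟨fun hz => ?_, fun hz => (heq z).1 (h0 z hz)⟩⟩
  by_contra hR
  have hR' := hR
  simp only [not_or] at hR'
  obtain ⟨h1, h2, h3⟩ := hR'
  obtain ⟨y, hy, hyne⟩ := hp.exists_row_ne_zero hg (u := u) 2 (X := {w}) (Y := ∅)
    (insert z {z | z = u ∨ z = w ∨ A z u = A z w}) (Or.inr (Or.inl rfl)) (by simp) (by simp)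
    (by simpa using hne) (by simp) (by simp)
    (LinearMap.proj z + (A z w) • LinearMap.proj u) (by simp [h2, hne, huw, CharTwo.add_self_eq_zero]) (by simp)
    (by
      intro v hv
      have e1 : z ≠ v := fun e => hv (Or.inl e.symm)
      have e2 : u ≠ v := fun e => hv (Or.inr (Or.inl e.symm))
      simp [e1, e2])
    (by
      have : ∀ s t : ZMod 2, s ≠ t → s + t ≠ 0 := by decide
      simpa [h1, hdiag] using this _ _ h3)
    (Submodule.subset_span ⟨w, rfl, rfl⟩ |> Submodule.smul_mem _ ρ) (Submodule.zero_mem _)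
    (by simpa using h)
  rw [sub_zero] at hyne
  rcases hy with rfl | hy
  · exact hyne ((heq y).2 hz)
  · exact hyne (h0 y hy)

lemma Shelters.psi_path (hp : Shelters F A p) (hg : IsDual p g) (hsym : A.IsSymm)
    (hdiag : ∀ v, A v v = 0) {v u w : V} (hvu : A v u = 1) (huw : A u w = 1) (hvw : A v w = 0)
    (hne : v ≠ w) : ∃ r κ : F, ∀ z, z = v ∨ z = u ∨ z = w →
      g z (p (v, 2)) = r * g z (p (w, 2)) + κ * g z (p (u, 1)) := by
  have huv : A u v = 1 := by rw [hsym.apply, hvu]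
  have hwu : A w u = 1 := by rw [hsym.apply, huw]
  have hwv : A w v = 0 := by rw [hsym.apply, hvw]
  have n1 : v ≠ u := by
    rintro rfl
    simp [hdiag] at hvu
  have n2 : u ≠ w := by
    rintro rfl
    simp [hdiag] at huw
  obtain ⟨a, ha, b, hb, h, h0⟩ := hp.exists_relation hg (u := v) 2 (X := {w}) (Y := {u})
    {v, u, w} (by simp) (by simp) (by simp) (by simpa using hne) (by simpa using n1)
    (by simpa using n2.symm) (Submodule.subset_span ⟨w, rfl, rfl⟩)
    (Submodule.subset_span ⟨u, rfl, rfl⟩)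
    (by
      rintro z (rfl | rfl | rfl)
      · simp [hdiag, hvu, hvw, hne]
      · simp [hdiag, huv, huw, n1.symm, n2]
      · simp [hdiag, hwu, hwv, hne.symm])
  rw [Set.image_singleton, Submodule.mem_span_singleton] at ha hb
  obtain ⟨r, rfl⟩ := ha
  obtain ⟨κ, rfl⟩ := hb
  refine ⟨r, κ, fun z hz => ?_⟩
  have := h0 z hz
  simp only [map_sub, map_smul, smul_eq_mul] at this
  linear_combination this

lemma Shelters.chi_triangle (hp : Shelters F A p) (hg : IsDual p g) (hsym : A.IsSymm)
    (hdiag : ∀ v, A v v = 0) {u v w : V} (huv : A u v = 1) (hvw : A v w = 1) (huw : A u w = 1) :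
    g u (p (v, 1)) * g v (p (w, 1)) * g w (p (u, 1)) =
      -(g u (p (w, 1)) * g w (p (v, 1)) * g v (p (u, 1))) := by
  have hvu : A v u = 1 := by rw [hsym.apply, huv]
  have hwu : A w u = 1 := by rw [hsym.apply, huw]
  have hwv : A w v = 1 := by rw [hsym.apply, hvw]
  have n1 : u ≠ v := by
    rintro rfl
    simp [hdiag] at huv
  have n2 : u ≠ w := by
    rintro rfl
    simp [hdiag] at huw
  have n3 : v ≠ w := by
    rintro rfl
    simp [hdiag] at hvw
  obtain ⟨a, ha, b, hb, h, h0⟩ := hp.exists_relation hg (u := u) 1 (X := ∅) (Y := {v, w})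
    {u, v, w} (by simp) (by simp) (by simp) (by simp) (by simp [n1, n2]) (by simp)
    (Submodule.zero_mem _)
    (Submodule.add_mem _ (Submodule.subset_span ⟨v, by simp, rfl⟩)
      (Submodule.subset_span ⟨w, by simp, rfl⟩))
    (by
      rintro z (rfl | rfl | rfl)
      · simp [hdiag, huv, huw]
        decide
      · simp [hdiag, hvu, hvw]
      · simp [hdiag, hwu, hwv])
  simp only [Set.image_empty, Submodule.span_empty, Submodule.mem_bot] at ha
  subst ha
  rw [Set.image_pair, Submodule.mem_span_pair] at hb
  obtain ⟨s, t, rfl⟩ := hb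
  have hu := h0 u (by simp)
  have hv := h0 v (by simp)
  have hw := h0 w (by simp)
  simp only [map_sub, map_add, map_smul, smul_eq_mul, sub_zero,
    (hp.chi_mem hg hdiag _).2 _ (hdiag _)] at hu hv hw
  linear_combination (-g v (p (w, 1)) * g w (p (v, 1))) * hu +
    (g u (p (w, 1)) * g w (p (v, 1))) * hv + (g u (p (v, 1)) * g v (p (w, 1))) * hw

end ShelterRelations

section ShelterHoles

variable {V : Type} [Fintype V] [DecidableEq V] {A : Matrix V V (ZMod 2)} {F : Type} [Field F]
  {E : Type} [AddCommGroup E] [Module F E] {p : V × Fin 3 → E} {g : V → E →ₗ[F] F}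

/-- The scaling `l` makes the `ψ`-vectors of the ends of the edge `uw` agree in row `u`. -/
def IsBalancedEdge (p : V × Fin 3 → E) (g : V → E →ₗ[F] F) (l : V → F) (u w : V) : Prop :=
  g u (p (u, 2)) * l w = g u (p (w, 2)) * l u

lemma Shelters.psi_edge_of_isBalancedEdge (hp : Shelters F A p) (hg : IsDual p g) (hsym : A.IsSymm)
    (hdiag : ∀ v, A v v = 0) {l : V → F} (hl : ∀ v, l v ≠ 0) {u w : V} (huw : A u w = 1)
    (hb : IsBalancedEdge p g l u w) :
    (l u)⁻¹ • p (u, 2) - (l w)⁻¹ • p (w, 2) ∈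
      Submodule.span F ((fun v => p (v, 0)) '' Set.univ) ∧
      ∀ z, g z ((l u)⁻¹ • p (u, 2)) = g z ((l w)⁻¹ • p (w, 2)) ↔
        (z = u ∨ z = w ∨ A z u = A z w) := by
  obtain ⟨ρ, h, h0⟩ := hp.psi_edge hg hsym hdiag huw
  have hu := (h0 u).2 (Or.inl rfl)
  have hne := hg.psi u
  have hne' : g u (p (w, 2)) ≠ 0 := by
    intro e
    rw [e, mul_zero] at hu
    exact hne hu
  have hρ : l u = ρ * l w := by
    unfold IsBalancedEdge at hb
    rw [hu] at hb
    apply mul_left_cancel₀ hne'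
    linear_combination -hb
  have hlu := hl u
  have hlw := hl w
  have hρ0 : ρ ≠ 0 := by
    rintro rfl
    exact hlu (by rw [hρ, zero_mul])
  have e : (l w)⁻¹ = (l u)⁻¹ * ρ := by
    rw [hρ]
    field_simp
  refine ⟨?_, fun z => ?_⟩
  · rw [e, mul_smul, ← smul_sub]
    exact Submodule.smul_mem _ _ h
  · rw [e, mul_smul, map_smul, map_smul, map_smul, smul_eq_mul, smul_eq_mul, smul_eq_mul,
      mul_right_inj' (inv_ne_zero hlu), h0]

/-- `c 0, …, c (N + 1)` is an induced path. -/
structure IsInducedPath (A : Matrix V V (ZMod 2)) (c : ℕ → V) (N : ℕ) : Prop where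
  inj : ∀ i j, i ≤ N + 1 → j ≤ N + 1 → c i = c j → i = j
  adj : ∀ i j, i ≤ N + 1 → j ≤ N + 1 → A (c i) (c j) = if i + 1 = j ∨ j + 1 = i then 1 else 0

lemma sum_range_eq_of_eq_zero {M : Type} [AddCommGroup M] (N i : ℕ) (t : ℕ → M)
    (ht : ∀ m, m < N → m ≠ i → m + 2 ≠ i → t m = 0) :
    ∑ m ∈ Finset.range N, t m =
      (if i < N then t i else 0) + (if 2 ≤ i ∧ i ≤ N + 1 then t (i - 2) else 0) := by
  have h : ∀ m ∈ Finset.range N, t m =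
      (if m = i then t i else 0) + (if m = i - 2 then (if 2 ≤ i then t (i - 2) else 0) else 0) := by
    intro m hm
    rw [Finset.mem_range] at hm
    by_cases h1 : m = i
    · subst h1
      rw [if_pos rfl]
      by_cases h2 : m = m - 2
      · rw [if_pos h2, if_neg (by omega), add_zero]
      · rw [if_neg h2, add_zero]
    · by_cases h2 : m + 2 = i
      · subst h2
        simp
      · rw [ht m hm h1 h2, if_neg h1, zero_add]
        split_ifs
        · omega
        · rfl
        · rfl
  rw [Finset.sum_congr rfl h, Finset.sum_add_distrib, Finset.sum_ite_eq', Finset.sum_ite_eq']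
  simp only [Finset.mem_range]
  congr 1
  split_ifs <;> first | rfl | omega

namespace IsInducedPath

variable {c : ℕ → V} {N : ℕ}

lemma psi_ne_combination (hc : IsInducedPath A c N) (hp : Shelters F A p) (hg : IsDual p g)
    {b : E} (hb : b ∈ Submodule.span F ((fun v => p (v, 1)) '' (c '' Set.Ioo 0 (N + 1))))
    (hm : p (c (N + 1), 2) - b ∈ Submodule.span F ((fun v => p (v, 0)) '' Set.univ)) :
    ∃ i ≤ N + 1, g (c i) (p (c (N + 1), 2) - b) ≠ 0 := by
  set e : ℕ → ZMod 2 := fun i => if i % 2 = (N + 1) % 2 then 1 else 0 with he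
  set f : (V → ZMod 2) →ₗ[ZMod 2] ZMod 2 :=
    ∑ i ∈ Finset.range (N + 2), e i • LinearMap.proj (c i) with hf
  have hfx : ∀ x, f x = ∑ i ∈ Finset.range (N + 2), e i * x (c i) := by
    intro x
    simp [hf, LinearMap.sum_apply]
  obtain ⟨z, hz, hne⟩ := hp.exists_row_ne_zero hg (u := c (N + 1)) 2 (X := ∅)
    (Y := c '' Set.Ioo 0 (N + 1)) (c '' Set.Iic (N + 1)) ⟨N + 1, by simp, rfl⟩ (by simp)
    (Set.image_mono fun i hi => hi.2.le) (by simp)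
    (by
      rintro ⟨i, hi, h⟩
      have := hc.inj i (N + 1) hi.2.le le_rfl h
      have := hi.2
      omega)
    (by simp) f (by simp)
    (by
      rintro _ ⟨j, hj, rfl⟩
      obtain ⟨j1, j2⟩ := hj
      obtain ⟨m, rfl⟩ : ∃ m, j = m + 1 := ⟨j - 1, by omega⟩
      rw [hfx, sum_range_eq_of_eq_zero (N + 2) (m + 2)]
      · rw [if_pos (by omega), if_pos (by omega), iasCol_one, iasCol_one, hc.adj _ _ (by omega) (by omega),
          hc.adj _ _ (by omega) (by omega), if_pos (by omega), if_pos (by omega), he]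
        have : (m + 2) % 2 = m % 2 := by omega
        simp only [this, Nat.add_sub_cancel]
        exact CharTwo.add_self_eq_zero _
      · intro i hi h1 h2
        rw [iasCol_one, hc.adj _ _ (by omega) (by omega), if_neg (by omega), mul_zero])
    (by
      intro v hv
      rw [hfx]
      refine Finset.sum_eq_zero fun i hi => ?_
      rw [Finset.mem_range] at hi
      rw [iasCol_zero, if_neg, mul_zero]
      rintro rfl
      exact hv ⟨i, by simp; omega, rfl⟩)
    (by
      rw [hfx, Finset.sum_eq_single (N + 1)]
      · rw [iasCol_two, hc.adj _ _ (by omega) (by omega)]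
        simp [he]
      · intro i hi h1
        rw [Finset.mem_range] at hi
        by_cases h2 : i + 1 = N + 1
        · have : ¬ i % 2 = (N + 1) % 2 := by omega
          simp [he, this]
        · have h3 : c i ≠ c (N + 1) := fun h => h1 (hc.inj _ _ (by omega) (by omega) h)
          rw [iasCol_two, if_neg h3, hc.adj _ _ (by omega) (by omega), if_neg (by omega), add_zero,
            mul_zero]
      · simp)
    (Submodule.zero_mem _) hb (by simpa using hm)
  obtain ⟨i, hi, rfl⟩ := hz
  exact ⟨i, hi, by simpa using hne⟩

/-- The row of `c i` in the rescaled `ψ`-vectors of an induced path, telescoped. -/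
lemma exists_telescope (hc : IsInducedPath A c N) (hp : Shelters F A p) (hg : IsDual p g)
    (hsym : A.IsSymm) (hdiag : ∀ v, A v v = 0) {l : V → F} (hl : ∀ v, l v ≠ 0)
    (hb : ∀ i ≤ N, IsBalancedEdge p g l (c i) (c (i + 1))) :
    ∃ y ∈ Submodule.span F ((fun v => p (v, 1)) '' (c '' Set.Ioo 0 (N + 1))),
      (l (c 0))⁻¹ • p (c 0, 2) - (l (c (N + 1)))⁻¹ • p (c (N + 1), 2) - y ∈
        Submodule.span F ((fun v => p (v, 0)) '' Set.univ) ∧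
      ∀ i ≤ N + 1, g (c i)
        ((l (c 0))⁻¹ • p (c 0, 2) - (l (c (N + 1)))⁻¹ • p (c (N + 1), 2) - y) = 0 := by
  obtain ⟨q, hq⟩ : ∃ q : ℕ → E, ∀ i, q i = (l (c i))⁻¹ • p (c i, 2) := ⟨_, fun _ => rfl⟩
  rw [← hq 0, ← hq (N + 1)]
  have hpq : ∀ i, p (c i, 2) = l (c i) • q i := fun i => by
    rw [hq, smul_smul, mul_inv_cancel₀ (hl _), one_smul]
  have hedge : ∀ i, i ≤ N → q i - q (i + 1) ∈
      Submodule.span F ((fun v => p (v, 0)) '' Set.univ) ∧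
      ∀ z, g z (q i) = g z (q (i + 1)) ↔
        (z = c i ∨ z = c (i + 1) ∨ A z (c i) = A z (c (i + 1))) := by
    intro i hi
    rw [hq i, hq (i + 1)]
    exact hp.psi_edge_of_isBalancedEdge hg hsym hdiag hl
      (by rw [hc.adj _ _ (by omega) (by omega), if_pos (by omega)]) (hb i hi)
  have hstep : ∀ i j, i ≤ N + 1 → j ≤ N → i + 1 ≠ j → i ≠ j + 2 →
      g (c i) (q j) = g (c i) (q (j + 1)) := by
    intro i j hi hj h1 h2
    rw [(hedge j hj).2]
    by_cases h3 : i = j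
    · exact Or.inl (by rw [h3])
    by_cases h4 : i = j + 1
    · exact Or.inr (Or.inl (by rw [h4]))
    right; right
    rw [hc.adj _ _ (by omega) (by omega), hc.adj _ _ (by omega) (by omega), if_neg (by omega),
      if_neg (by omega)]
  have hlow : ∀ i j, i ≤ N + 1 → j + 2 ≤ i → g (c i) (q 0) = g (c i) (q j) := by
    intro i j hi hj
    induction j with
    | zero => rfl
    | succ j ih =>
      rw [ih (by omega)]
      exact hstep i j hi (by omega) (by omega) (by omega)
  have hhigh : ∀ i j, i + 2 ≤ j → j ≤ N + 1 → g (c i) (q (i + 2)) = g (c i) (q j) := by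
    intro i j hij
    induction j, hij using Nat.le_induction with
    | base => intro _; rfl
    | succ j hij ih =>
      intro hj
      rw [ih (by omega)]
      exact hstep i j (by omega) (by omega) (by omega) (by omega)
  have hkap : ∀ m, ∃ κ : F, m < N →
      g (c m) (q m) - g (c m) (q (m + 2)) = κ * g (c m) (p (c (m + 1), 1)) ∧
      g (c (m + 2)) (q m) - g (c (m + 2)) (q (m + 2)) =
        κ * g (c (m + 2)) (p (c (m + 1), 1)) := by
    intro m
    by_cases hm : m < N
    swap
    · exact ⟨0, fun h => absurd h hm⟩
    obtain ⟨r, κ, h⟩ := hp.psi_path hg hsym hdiag (v := c m) (u := c (m + 1)) (w := c (m + 2))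
      (by rw [hc.adj _ _ (by omega) (by omega), if_pos (by omega)])
      (by rw [hc.adj _ _ (by omega) (by omega), if_pos (by omega)])
      (by rw [hc.adj _ _ (by omega) (by omega), if_neg (by omega)])
      (fun e => by have := hc.inj _ _ (by omega) (by omega) e; omega)
    have hu := h (c (m + 1)) (by simp)
    have h1 := h (c m) (by simp)
    have h2 := h (c (m + 2)) (by simp)
    rw [(hp.chi_mem hg hdiag _).2 _ (hdiag _), mul_zero, add_zero, hpq, hpq, map_smul, map_smul,
      smul_eq_mul, smul_eq_mul, hstep (m + 1) m (by omega) (by omega) (by omega) (by omega),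
      ← hstep (m + 1) (m + 1) (by omega) (by omega) (by omega) (by omega), ← mul_assoc] at hu
    have hne : g (c (m + 1)) (q (m + 1)) ≠ 0 := by
      rw [hq, map_smul, smul_eq_mul]
      exact mul_ne_zero (inv_ne_zero (hl _)) (hg.psi _)
    have hr := mul_right_cancel₀ hne hu
    have hlm := hl (c m)
    refine ⟨(l (c m))⁻¹ * κ, fun _ => ⟨?_, ?_⟩⟩
    · rw [hpq, hpq, map_smul, map_smul, smul_eq_mul, smul_eq_mul, ← mul_assoc, ← hr] at h1
      apply mul_left_cancel₀ hlm
      rw [← mul_assoc, ← mul_assoc, mul_inv_cancel₀ hlm]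
      linear_combination h1
    · rw [hpq, hpq, map_smul, map_smul, smul_eq_mul, smul_eq_mul, ← mul_assoc, ← hr] at h2
      apply mul_left_cancel₀ hlm
      rw [← mul_assoc, ← mul_assoc, mul_inv_cancel₀ hlm]
      linear_combination h2
  choose κ hκ using hkap
  refine ⟨∑ m ∈ Finset.range N, κ m • p (c (m + 1), 1), ?_, ?_, ?_⟩
  · refine Submodule.sum_mem _ fun m hm => Submodule.smul_mem _ _ (Submodule.subset_span ?_)
    rw [Finset.mem_range] at hm
    exact ⟨_, ⟨m + 1, ⟨by omega, by omega⟩, rfl⟩, rfl⟩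
  · refine Submodule.sub_mem _ ?_ (Submodule.sum_mem _ fun m _ =>
      Submodule.smul_mem _ _ (hp.chi_mem hg hdiag _).1)
    have : ∀ m, m ≤ N + 1 → q 0 - q m ∈
        Submodule.span F ((fun v => p (v, 0)) '' Set.univ) := by
      intro m
      induction m with
      | zero => intro _; rw [sub_self]; exact Submodule.zero_mem _
      | succ m ih =>
        intro hm
        rw [← sub_add_sub_cancel _ (q m)]
        exact Submodule.add_mem _ (ih (by omega)) (hedge m (by omega)).1
    exact this (N + 1) le_rfl
  · intro i hi
    rw [map_sub, map_sub, map_sum, sum_range_eq_of_eq_zero N i]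
    · have e1 : (if i < N then g (c i) (κ i • p (c (i + 1), 1)) else 0) =
          g (c i) (q i) - g (c i) (q (N + 1)) := by
        split_ifs with h
        · rw [map_smul, smul_eq_mul, ← (hκ i h).1, hhigh i (N + 1) (by omega) le_rfl]
        · rcases (show i = N ∨ i = N + 1 by omega) with rfl | rfl
          · rw [hstep i i (by omega) (by omega) (by omega) (by omega), sub_self]
          · rw [sub_self]
      have e2 : (if 2 ≤ i ∧ i ≤ N + 1 then
          g (c i) (κ (i - 2) • p (c (i - 2 + 1), 1)) else 0) =
          g (c i) (q 0) - g (c i) (q i) := by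
        split_ifs with h
        · obtain ⟨m, rfl⟩ : ∃ m, i = m + 2 := ⟨i - 2, by omega⟩
          rw [Nat.add_sub_cancel, map_smul, smul_eq_mul, ← (hκ m (by omega)).2,
            hlow (m + 2) m hi le_rfl]
        · rcases (show i = 0 ∨ i = 1 by omega) with rfl | rfl
          · rw [sub_self]
          · rw [hstep 1 0 (by omega) (by omega) (by omega) (by omega), sub_self]
      rw [e1, e2]
      ring
    · intro m hm h1 h2
      rw [map_smul, (hp.chi_mem hg hdiag _).2, smul_zero]
      rw [hc.adj _ _ (by omega) (by omega), if_neg (by omega)]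

/-- The rescaled `ψ`-vectors of the ends of an induced path agree in the row of a vertex adjacent
to the two ends only. -/
lemma psi_eq_of_adj_ends (hc : IsInducedPath A c N) (hp : Shelters F A p) (hg : IsDual p g)
    (hsym : A.IsSymm) (hdiag : ∀ v, A v v = 0) {l : V → F} (hl : ∀ v, l v ≠ 0)
    (hb : ∀ i ≤ N, IsBalancedEdge p g l (c i) (c (i + 1))) {v : V} (hv : ∀ i ≤ N + 1, v ≠ c i)
    (hva : ∀ i ≤ N + 1, A v (c i) = if i = 0 ∨ i = N + 1 then 1 else 0) :
    g v (p (c 0, 2)) * l (c (N + 1)) = g v (p (c (N + 1), 2)) * l (c 0) := by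
  obtain ⟨a, ha, b, hbm, hm, h0⟩ := hp.exists_relation hg (u := c 0) 2 (X := {c (N + 1)})
    (Y := c '' Set.Ioo 0 (N + 1)) (insert v (c '' Set.Iic (N + 1)))
    (Or.inr ⟨0, by simp, rfl⟩) (by rintro _ rfl; exact Or.inr ⟨N + 1, by simp, rfl⟩)
    ((Set.image_mono fun i hi => hi.2.le).trans (Set.subset_insert _ _))
    (fun h => by have := hc.inj _ _ (by omega) (by omega) h; omega)
    (by
      rintro ⟨i, hi, h⟩
      obtain ⟨i1, i2⟩ := hi
      have := hc.inj i 0 (by omega) (by omega) h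
      omega)
    (by
      rintro _ rfl ⟨i, hi, h⟩
      obtain ⟨i1, i2⟩ := hi
      have := hc.inj i (N + 1) (by omega) (by omega) h
      omega)
    (Submodule.subset_span ⟨_, rfl, rfl⟩)
    (b' := ∑ m ∈ Finset.range N, iasCol A (c (m + 1), 1))
    (by
      refine Submodule.sum_mem _ fun m hm => Submodule.subset_span ?_
      rw [Finset.mem_range] at hm
      exact ⟨_, ⟨m + 1, ⟨by omega, by omega⟩, rfl⟩, rfl⟩)
    (by
      rintro z (rfl | ⟨i, hi, rfl⟩)
      · simp only [Pi.sub_apply, Finset.sum_apply, iasCol_one, iasCol_two]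
        rw [if_neg (hv 0 (by omega)), if_neg (hv (N + 1) (by omega)), hva 0 (by omega),
          hva (N + 1) (by omega), Finset.sum_eq_zero]
        · simp
        · intro m hm
          rw [Finset.mem_range] at hm
          rw [hva _ (by omega), if_neg (by omega)]
      · rw [Set.mem_Iic] at hi
        simp only [Pi.sub_apply, Finset.sum_apply, iasCol_one, iasCol_two]
        have hceq : ∀ j ≤ N + 1, (c i = c j) = (i = j) := fun j hj =>
          propext ⟨hc.inj i j hi hj, fun e => by rw [e]⟩
        simp only [hceq 0 (by omega), hceq (N + 1) le_rfl]
        rw [sum_range_eq_of_eq_zero N i, hc.adj _ _ hi (by omega), hc.adj _ _ hi (by omega)]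
        · have e1 : (if i < N then A (c i) (c (i + 1)) else 0) = if i < N then 1 else 0 := by
            split_ifs with h
            · rw [hc.adj _ _ hi (by omega), if_pos (by omega)]
            · rfl
          have e2 : (if 2 ≤ i ∧ i ≤ N + 1 then A (c i) (c (i - 2 + 1)) else 0) =
              if 2 ≤ i then 1 else 0 := by
            by_cases h : 2 ≤ i
            · rw [if_pos ⟨h, hi⟩, if_pos h, hc.adj _ _ hi (by omega), if_pos (by omega)]
            · rw [if_neg (fun h' => h h'.1), if_neg h]
          rw [e1, e2]
          split_ifs <;> first | decide | (exfalso; grind)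
        · intro m hm h1 h2
          rw [hc.adj _ _ hi (by omega), if_neg (by omega)])
  rw [Set.image_singleton, Submodule.mem_span_singleton] at ha
  obtain ⟨r, rfl⟩ := ha
  have hgb : g v b = 0 := by
    have hle : Submodule.span F ((fun v => p (v, 1)) '' (c '' Set.Ioo 0 (N + 1))) ≤
        LinearMap.ker (g v) := by
      rw [Submodule.span_le]
      rintro _ ⟨_, ⟨i, ⟨i1, i2⟩, rfl⟩, rfl⟩
      exact (hp.chi_mem hg hdiag _).2 _ (by rw [hva _ i2.le, if_neg (by omega)])
    exact hle hbm
  have hgv := h0 v (Or.inl rfl)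
  rw [map_sub, map_sub, hgb, sub_zero, map_smul, smul_eq_mul, sub_eq_zero] at hgv
  obtain ⟨y, hy, hym, hy0⟩ := hc.exists_telescope hp hg hsym hdiag hl hb
  have hl0 := hl (c 0)
  have hlM := hl (c (N + 1))
  have hr : r * l (c (N + 1)) = l (c 0) := by
    by_contra hne
    set δ : F := l (c 0) * (l (c (N + 1)))⁻¹ - r with hδ
    have hδ0 : δ ≠ 0 := by
      intro e
      apply hne
      rw [hδ, sub_eq_zero] at e
      rw [← e, inv_mul_cancel_right₀ hlM]
    have key : p (c (N + 1), 2) - δ⁻¹ • (b - l (c 0) • y) =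
        δ⁻¹ • ((p (c 0, 2) - r • p (c (N + 1), 2) - b) - l (c 0) •
          ((l (c 0))⁻¹ • p (c 0, 2) - (l (c (N + 1)))⁻¹ • p (c (N + 1), 2) - y)) := by
      have e : p (c (N + 1), 2) = δ⁻¹ • (δ • p (c (N + 1), 2)) := by
        rw [smul_smul, inv_mul_cancel₀ hδ0, one_smul]
      nth_rewrite 1 [e]
      rw [← smul_sub, hδ, smul_sub (l (c 0)), smul_sub (l (c 0)), smul_smul, smul_smul,
        mul_inv_cancel₀ hl0]
      congr 1
      module
    obtain ⟨i, hi, hni⟩ := hc.psi_ne_combination hp hg (b := δ⁻¹ • (b - l (c 0) • y))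
      (Submodule.smul_mem _ _ (Submodule.sub_mem _ hbm (Submodule.smul_mem _ _ hy)))
      (by
        rw [key]
        exact Submodule.smul_mem _ _ (Submodule.sub_mem _ hm (Submodule.smul_mem _ _ hym)))
    rw [key, map_smul, map_sub, map_smul, h0 _ (Or.inr ⟨i, hi, rfl⟩), hy0 i hi] at hni
    simp at hni
  rw [hgv, ← hr]
  ring

end IsInducedPath

end ShelterHoles

section Potential

variable {V : Type} [Fintype V] [DecidableEq V] {A : Matrix V V (ZMod 2)} {F : Type} [Field F]
  {E : Type} [AddCommGroup E] [Module F E] {p : V × Fin 3 → E} {g : V → E →ₗ[F] F}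

lemma ZMod.two_eq_zero_of_ne_one {t : ZMod 2} (h : t ≠ 1) : t = 0 := by
  revert t
  decide

lemma Shelters.psi_ne_zero (hp : Shelters F A p) (hg : IsDual p g) (hsym : A.IsSymm)
    (hdiag : ∀ v, A v v = 0) {v u : V} (hvu : A v u = 1) : g v (p (u, 2)) ≠ 0 := by
  obtain ⟨ρ, -, h⟩ := hp.psi_edge hg hsym hdiag hvu
  have hv := (h v).2 (Or.inl rfl)
  intro e
  rw [e, mul_zero] at hv
  exact hg.psi v hv

lemma Shelters.isBalancedEdge_symm (hp : Shelters F A p) (hg : IsDual p g) (hsym : A.IsSymm)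
    (hdiag : ∀ v, A v v = 0) {l : V → F} {u w : V} (huw : A u w = 1)
    (hb : IsBalancedEdge p g l u w) : IsBalancedEdge p g l w u := by
  obtain ⟨ρ, -, h⟩ := hp.psi_edge hg hsym hdiag huw
  have hu := (h u).2 (Or.inl rfl)
  have hw := (h w).2 (Or.inr (Or.inl rfl))
  unfold IsBalancedEdge at hb ⊢
  rw [hu] at hb
  have hne := hp.psi_ne_zero hg hsym hdiag huw
  have hρ : l u = ρ * l w := by
    apply mul_left_cancel₀ hne
    linear_combination -hb
  rw [hw, hρ]
  ring

/-- The subgraph of edges inside `S`. -/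
def edgesInside (A : Matrix V V (ZMod 2)) (hsym : A.IsSymm) (hdiag : ∀ v, A v v = 0)
    (S : Finset V) : SimpleGraph V where
  Adj u w := u ∈ S ∧ w ∈ S ∧ A u w = 1
  symm := ⟨fun u w h => ⟨h.2.1, h.1, by rw [hsym.apply]; exact h.2.2⟩⟩
  loopless := ⟨fun u h => by
    have := h.2.2
    rw [hdiag] at this
    exact zero_ne_one this⟩

lemma Shelters.psi_eq_of_reachable (hp : Shelters F A p) (hg : IsDual p g) (hsym : A.IsSymm)
    (hdiag : ∀ v, A v v = 0) {l : V → F} (hl : ∀ v, l v ≠ 0) {S : Finset V}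
    (hb : ∀ u ∈ S, ∀ w ∈ S, A u w = 1 → IsBalancedEdge p g l u w) {v : V} (hv : v ∉ S) (n : ℕ) :
    ∀ u w, A v u = 1 → A v w = 1 → (edgesInside A hsym hdiag S).Reachable u w →
      (edgesInside A hsym hdiag S).dist u w = n →
      g v (p (u, 2)) * (l u)⁻¹ = g v (p (w, 2)) * (l w)⁻¹ := by
  induction n using Nat.strong_induction_on with
  | _ n ih =>
    intro u w hu hw hr hd
    set H := edgesInside A hsym hdiag S with hH
    obtain ⟨q, hq⟩ := hr.exists_walk_length_eq_dist
    rw [hd] at hq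
    rcases n with _ | N
    · rw [SimpleGraph.Walk.eq_of_length_eq_zero hq]
    by_cases hinterior : ∃ i, 0 < i ∧ i < N + 1 ∧ A v (q.getVert i) = 1
    · obtain ⟨i, i1, i2, hi⟩ := hinterior
      have d1 : H.dist u (q.getVert i) ≤ i :=
        (SimpleGraph.dist_le (q.take i)).trans (by rw [SimpleGraph.Walk.take_length]; omega)
      have d2 : H.dist (q.getVert i) w ≤ N + 1 - i :=
        (SimpleGraph.dist_le (q.drop i)).trans (by rw [SimpleGraph.Walk.drop_length, hq])
      exact (ih _ (by omega) u _ hu hi ⟨q.take i⟩ rfl).trans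
        (ih _ (by omega) _ w hi hw ⟨q.drop i⟩ rfl)
    · push Not at hinterior
      have hadj : ∀ i ≤ N, H.Adj (q.getVert i) (q.getVert (i + 1)) := fun i hi =>
        q.adj_getVert_succ (by omega)
      have hS : ∀ i ≤ N + 1, q.getVert i ∈ S := by
        intro i hi
        by_cases h : i ≤ N
        · exact (hadj i h).1
        · obtain rfl : i = N + 1 := by omega
          exact (hadj N le_rfl).2.1
      have hshort : ∀ i j, i < j → j ≤ N + 1 →
          ∀ r : H.Walk (q.getVert i) (q.getVert j), j ≤ i + r.length := by
        intro i j hij hj r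
        have := SimpleGraph.dist_le (((q.take i).append r).append (q.drop j))
        rw [SimpleGraph.Walk.length_append, SimpleGraph.Walk.length_append,
          SimpleGraph.Walk.take_length, SimpleGraph.Walk.drop_length, hd, hq] at this
        omega
      have hinj : ∀ i j, i < j → j ≤ N + 1 → q.getVert i ≠ q.getVert j := by
        intro i j hij hj e
        have := hshort i j hij hj (SimpleGraph.Walk.nil.copy rfl e)
        simp at this
        omega
      have hnon : ∀ i j, i + 1 < j → j ≤ N + 1 → A (q.getVert i) (q.getVert j) = 0 := by
        intro i j hij hj
        apply ZMod.two_eq_zero_of_ne_one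
        intro e
        have h : H.Adj (q.getVert i) (q.getVert j) := ⟨hS i (by omega), hS j hj, e⟩
        have := hshort i j (by omega) hj (SimpleGraph.Walk.cons h SimpleGraph.Walk.nil)
        simp at this
        omega
      have hc : IsInducedPath A q.getVert N := by
        refine ⟨fun i j hi hj e => ?_, fun i j hi hj => ?_⟩
        · rcases lt_trichotomy i j with h | h | h
          · exact absurd e (hinj i j h hj)
          · exact h
          · exact absurd e.symm (hinj j i h hi)
        · split_ifs with h
          · rcases h with rfl | rfl
            · exact (hadj i (by omega)).2.2
            · rw [hsym.apply]
              exact (hadj j (by omega)).2.2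
          · rcases lt_trichotomy i j with h' | rfl | h'
            · exact hnon i j (by omega) hj
            · exact hdiag _
            · rw [hsym.apply]
              exact hnon j i (by omega) hi
      have h0 : q.getVert 0 = u := q.getVert_zero
      have hM : q.getVert (N + 1) = w := by rw [← hq, q.getVert_length]
      have key := hc.psi_eq_of_adj_ends hp hg hsym hdiag hl
        (fun i hi => hb _ (hS i (by omega)) _ (hS (i + 1) (by omega)) (hadj i hi).2.2) (v := v)
        (fun i hi e => hv (e ▸ hS i hi))
        (by
          intro i hi
          split_ifs with h
          · rcases h with rfl | rfl
            · rw [h0, hu]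
            · rw [hM, hw]
          · exact ZMod.two_eq_zero_of_ne_one (hinterior i (by omega) (by omega)))
      rw [h0, hM] at key
      have h1 := hl u
      have h2 := hl w
      field_simp
      linear_combination key

lemma Shelters.exists_balanced (hp : Shelters F A p) (hg : IsDual p g) (hsym : A.IsSymm)
    (hdiag : ∀ v, A v v = 0) (S : Finset V) :
    ∃ l : V → F, (∀ v, l v ≠ 0) ∧ ∀ u ∈ S, ∀ w ∈ S, A u w = 1 → IsBalancedEdge p g l u w := by
  classical
  induction S using Finset.induction_on with
  | empty => exact ⟨fun _ => 1, fun _ => one_ne_zero, by simp⟩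
  | insert v S hv ih =>
    obtain ⟨l, hl, hb⟩ := ih
    set H := edgesInside A hsym hdiag S with hH
    set a : V → F := fun u => g v (p (u, 2)) * (l u)⁻¹ with ha
    have hcv : ∀ u w, A v u = 1 → A v w = 1 → H.Reachable u w → a u = a w := fun u w hu hw hr =>
      hp.psi_eq_of_reachable hg hsym hdiag hl hb hv _ u w hu hw hr rfl
    have hs : ∀ w, ∃ s : F, s ≠ 0 ∧ (∀ u, A v u = 1 → H.Reachable w u → s = a u) ∧
        ((∀ u, A v u = 1 → ¬ H.Reachable w u) → s = 1) := by
      intro w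
      by_cases h : ∃ u, A v u = 1 ∧ H.Reachable w u
      · obtain ⟨u, hu, hr⟩ := h
        refine ⟨a u, mul_ne_zero (hp.psi_ne_zero hg hsym hdiag hu) (inv_ne_zero (hl u)),
          fun u' hu' hr' => hcv _ _ hu hu' (hr.symm.trans hr'), fun h => absurd hr (h u hu)⟩
      · push Not at h
        exact ⟨1, one_ne_zero, fun u hu hr => absurd hr (h u hu), fun _ => rfl⟩
    choose s hs0 hs1 hs2 using hs
    have hsadj : ∀ u w, H.Adj u w → s u = s w := by
      intro u w huw
      by_cases h : ∃ x, A v x = 1 ∧ H.Reachable u x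
      · obtain ⟨x, hx, hr⟩ := h
        rw [hs1 u x hx hr, hs1 w x hx (huw.symm.reachable.trans hr)]
      · push Not at h
        rw [hs2 u h, hs2 w fun x hx hr => h x hx (huw.reachable.trans hr)]
    set l' : V → F := fun w => if w = v then g v (p (v, 2)) else l w * s w with hl'
    have hbv : ∀ u ∈ S, A v u = 1 → IsBalancedEdge p g l' v u := by
      intro u hu hvu
      have hne : u ≠ v := fun e => hv (e ▸ hu)
      unfold IsBalancedEdge
      rw [hl']
      simp only [hne, if_true, if_false]
      rw [hs1 u u hvu (SimpleGraph.Reachable.refl u), ha]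
      have := hl u
      field_simp
    refine ⟨l', fun w => ?_, fun u hu w hw huw => ?_⟩
    · rw [hl']
      dsimp only
      split_ifs
      · exact hg.psi v
      · exact mul_ne_zero (hl w) (hs0 w)
    · rw [Finset.mem_insert] at hu hw
      rcases hu with rfl | hu
      · rcases hw with rfl | hw
        · simp [hdiag] at huw
        · exact hbv w hw huw
      · rcases hw with rfl | hw
        · have hwu : A w u = 1 := by rw [hsym.apply, huw]
          exact hp.isBalancedEdge_symm hg hsym hdiag hwu (hbv u hu hwu)
        · have h1 : u ≠ v := fun e => hv (e ▸ hu)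
          have h2 : w ≠ v := fun e => hv (e ▸ hw)
          have h := hb u hu w hw huw
          unfold IsBalancedEdge at h ⊢
          rw [hl']
          simp only [h1, h2, if_false]
          rw [hsadj u w ⟨hu, hw, huw⟩]
          linear_combination s w * h

theorem Shelters.exists_isMulNaji (hp : Shelters F A p) (hsym : A.IsSymm)
    (hdiag : ∀ v, A v v = 0) : ∃ x : V → V → Fˣ, IsMulNaji A x := by
  classical
  obtain ⟨g, hg⟩ := hp.exists_isDual hdiag
  obtain ⟨l, hl, hb⟩ := hp.exists_balanced hg hsym hdiag Finset.univ
  obtain ⟨C, hC⟩ : ∃ C : V → V → F, ∀ v w, C v w = g v ((l w)⁻¹ • p (w, 2)) := ⟨_, fun _ _ => rfl⟩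
  have hpC : ∀ v w, g v (p (w, 2)) = l w * C v w := by
    intro v w
    rw [hC, map_smul, smul_eq_mul, mul_inv_cancel_left₀ (hl w)]
  have hedge : ∀ u w, A u w = 1 → ∀ z, C z u = C z w ↔ (z = u ∨ z = w ∨ A z u = A z w) := by
    intro u w huw z
    rw [hC, hC]
    exact (hp.psi_edge_of_isBalancedEdge hg hsym hdiag hl huw
      (hb u (Finset.mem_univ _) w (Finset.mem_univ _) huw)).2 z
  have hCne : ∀ v, C v v ≠ 0 := by
    intro v e
    apply hg.psi v
    rw [hpC, e, mul_zero]
  have hx : ∀ v w, ∃ x : Fˣ, (A v w = 1 → (x : F) = g v (p (w, 1))) ∧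
      (A v w = 0 → C v w - C v v ≠ 0 → (x : F) = C v w - C v v) ∧
      (A v w = 0 → C v w - C v v = 0 → x = 1) := by
    intro v w
    by_cases h : A v w = 1
    · refine ⟨Units.mk0 _ (hp.chi_ne_zero hg hdiag h), fun _ => rfl, fun h' => ?_, fun h' => ?_⟩ <;>
      · rw [h] at h'
        exact absurd h' one_ne_zero
    · by_cases h0 : C v w - C v v = 0
      · exact ⟨1, fun h' => absurd h' h, fun _ h' => absurd h0 h', fun _ _ => rfl⟩
      · exact ⟨Units.mk0 _ h0, fun h' => absurd h' h, fun _ _ => rfl, fun _ h' => absurd h' h0⟩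
  choose x hx1 hx2 hx3 using hx
  refine ⟨x, ⟨?_, ?_, ?_⟩⟩
  · intro u v w huw hvu hvw _ _
    have e : C v u = C v w := (hedge u w huw v).2 (Or.inr (Or.inr (by rw [hvu, hvw])))
    by_cases h : C v u - C v v = 0
    · rw [hx3 v u hvu h, hx3 v w hvw (e ▸ h)]
    · apply Units.ext
      rw [hx2 v u hvu h, hx2 v w hvw (e ▸ h), e]
  · intro u v w hvu huw hvw hne
    have huv : A u v = 1 := by rw [hsym.apply, hvu]
    have hwu : A w u = 1 := by rw [hsym.apply, huw]
    have hwv : A w v = 0 := by rw [hsym.apply, hvw]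
    have nvu : v ≠ u := by
      rintro rfl
      simp [hdiag] at hvu
    have nwu : w ≠ u := by
      rintro rfl
      simp [hdiag] at hwu
    have c1 : C v v = C v u := (hedge v u hvu v).2 (Or.inl rfl)
    have c2 : C w w = C w u := (hedge w u hwu w).2 (Or.inl rfl)
    have c3 : C u v = C u u := (hedge v u hvu u).2 (Or.inr (Or.inl rfl))
    have c4 : C u w = C u u := (hedge w u hwu u).2 (Or.inr (Or.inl rfl))
    have n1 : C v w - C v v ≠ 0 := by
      rw [c1, sub_ne_zero, Ne, hedge w u hwu v, hvw, hvu]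
      simp [hne, nvu]
    have n2 : C w v - C w w ≠ 0 := by
      rw [c2, sub_ne_zero, Ne, hedge v u hvu w, hwv, hwu]
      simp [hne.symm, nwu]
    obtain ⟨r, κ, h⟩ := hp.psi_path hg hsym hdiag hvu huw hvw hne
    have hu := h u (by simp)
    have hv := h v (by simp)
    have hw := h w (by simp)
    rw [(hp.chi_mem hg hdiag _).2 _ (hdiag _), mul_zero, add_zero, hpC, hpC, c3, c4,
      ← mul_assoc] at hu
    have hr := mul_right_cancel₀ (hCne u) hu
    rw [hpC, hpC, ← mul_assoc, ← hr] at hv hw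
    apply Units.ext
    push_cast
    rw [hx1 v u hvu, hx1 w u hwu, hx2 w v hwv n2, hx2 v w hvw n1]
    apply mul_left_cancel₀ (hl v)
    linear_combination g v (p (u, 1)) * hw - g w (p (u, 1)) * hv
  · intro u v w huv hvw huw
    have hvu : A v u = 1 := by rw [hsym.apply, huv]
    have hwu : A w u = 1 := by rw [hsym.apply, huw]
    have hwv : A w v = 1 := by rw [hsym.apply, hvw]
    apply Units.ext
    push_cast
    rw [hx1 u v huv, hx1 v w hvw, hx1 w u hwu, hx1 u w huw, hx1 w v hwv, hx1 v u hvu,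
      hp.chi_triangle hg hsym hdiag huv hvw huw]
    ring

end Potential

/-- If `Z₃(G)` is representable over some field `F` with `char(F) ≠ 2`, then the
simple graph `G` is a circle graph. -/
theorem circle_graph_of_Z3_representable_char_ne_two
    {V : Type} [Fintype V] [DecidableEq V] (A : Matrix V V (ZMod 2))
    (hsym : A.IsSymm) (hdiag : ∀ v, A v v = 0)
    (F : Type) [Field F] (hchar : ringChar F ≠ 2) (hrep : Z3Rep F A) :
    IsCircleGraph A := by
  obtain ⟨k, p, hp⟩ := hrep.exists_shelters
  obtain ⟨x, hx⟩ := hp.exists_isMulNaji hsym hdiag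
  exact hx.isCircleGraph (Ring.two_ne_zero hchar) hsym hdiag
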